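/- arXiv:2106.11235 — 4 statements merged into one kernel-verified Lean document; each statement's English description precedes it below -/
import Mathlib

section
/- Assume α > β+1, β ≥ 0 and θ := γ + 2 + β − α > 0. For ρ > 0 let u(·,ρ) be the regular solution of L(u) + e^{u} = 0 with u(0,ρ) = ρ, ∂_r u(0,ρ) = 0, let R(0,ρ) be its unique zero and λ(ρ) = R(0,ρ)^θ. Let u*(r) = ln(θ^{β+1}(α−β−1)) − θ ln r, λ* = θ^{β+1}(α−β−1), u_{λ(ρ)}(r) = u(λ(ρ)^{1/θ} r, ρ) and u*_{λ*}(r) = u*((λ*)^{1/θ} r). Then, as ρ → +∞: (i) u(·,ρ) → u* uniformly on every compact subset of (0,∞); (ii) λ(ρ) → λ*; (iii) u_{λ(ρ)} → u*_{λ*} uniformly on every compact subset of (0,∞). -/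
open Filter Set Real

/-- Two-sided bounds for an antiderivative `φ` of a monotone function `s`, vanishing at `c`. -/
lemma potential_bounds {I : Set ℝ} (hI : I.OrdConnected) {φ s : ℝ → ℝ} {c κ : ℝ} (hc : c ∈ I)
    (hφ : ∀ x ∈ I, HasDerivAt φ (s x) x) (hs : MonotoneOn s I) (h0 : φ c = 0)
    (hκ : ∀ x ∈ I, κ * (x - c) ^ 2 ≤ (x - c) * s x) {x : ℝ} (hx : x ∈ I) :
    κ / 2 * (x - c) ^ 2 ≤ φ x ∧ φ x ≤ (x - c) * s x := by
  have hψ : ∀ y ∈ I, HasDerivAt (fun z => φ z - κ / 2 * (z - c) ^ 2) (s y - κ * (y - c)) y := by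
    intro y hy
    have := (hφ y hy).sub ((((hasDerivAt_id y).sub_const c).pow 2).const_mul (κ / 2))
    exact this.congr_deriv (by norm_num; ring)
  rcases lt_trichotomy c x with h | h | h
  · have hsub : Icc c x ⊆ I := hI.out hc hx
    have hsub' : Ioo c x ⊆ I := Ioo_subset_Icc_self.trans hsub
    obtain ⟨ξ, hξ, e⟩ := exists_hasDerivAt_eq_slope φ s h
      (fun y hy => (hφ y (hsub hy)).continuousAt.continuousWithinAt)
      (fun y hy => hφ y (hsub' hy))
    obtain ⟨η, hη, e'⟩ := exists_hasDerivAt_eq_slope _ _ h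
      (fun y hy => (hψ y (hsub hy)).continuousAt.continuousWithinAt)
      (fun y hy => hψ y (hsub' hy))
    have hd : 0 < x - c := sub_pos.2 h
    rw [eq_div_iff hd.ne'] at e e'
    have m := hs (hsub' hξ) hx hξ.2.le
    have k := hκ η (hsub' hη)
    have hd' : 0 < η - c := sub_pos.2 hη.1
    have k' : 0 ≤ s η - κ * (η - c) := by
      by_contra! hneg
      nlinarith
    simp only [h0, sub_self] at e e'
    constructor <;> nlinarith
  · subst h
    simp [h0]
  · have hsub : Icc x c ⊆ I := hI.out hx hc
    have hsub' : Ioo x c ⊆ I := Ioo_subset_Icc_self.trans hsub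
    obtain ⟨ξ, hξ, e⟩ := exists_hasDerivAt_eq_slope φ s h
      (fun y hy => (hφ y (hsub hy)).continuousAt.continuousWithinAt)
      (fun y hy => hφ y (hsub' hy))
    obtain ⟨η, hη, e'⟩ := exists_hasDerivAt_eq_slope _ _ h
      (fun y hy => (hψ y (hsub hy)).continuousAt.continuousWithinAt)
      (fun y hy => hψ y (hsub' hy))
    have hd : 0 < c - x := sub_pos.2 h
    rw [eq_div_iff hd.ne'] at e e'
    have m := hs hx (hsub' hξ) hξ.1.le
    have k := hκ η (hsub' hη)
    have hd' : 0 < c - η := sub_pos.2 hη.2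
    have k' : s η - κ * (η - c) ≤ 0 := by
      by_contra! hneg
      nlinarith
    simp only [h0, sub_self] at e e'
    constructor <;> nlinarith

/-- A primitive of `exp v - exp c` vanishing at `c`. -/
noncomputable def expPotential (c v : ℝ) : ℝ := exp v - exp c - exp c * (v - c)

/-- A primitive of `x ^ (1 / p) - θ` vanishing at `θ ^ p`. -/
noncomputable def powPotential (p θ x : ℝ) : ℝ :=
  (x ^ (1 / p + 1) / (1 / p + 1) - θ * x) -
    ((θ ^ p) ^ (1 / p + 1) / (1 / p + 1) - θ * θ ^ p)

lemma hasDerivAt_expPotential (c v : ℝ) :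
    HasDerivAt (expPotential c) (exp v - exp c) v := by
  have := ((Real.hasDerivAt_exp v).sub_const (exp c)).sub
    (((hasDerivAt_id v).sub_const c).const_mul (exp c))
  exact this.congr_deriv (by simp)

lemma hasDerivAt_powPotential {p : ℝ} (hp : 1 ≤ p) (θ x : ℝ) :
    HasDerivAt (powPotential p θ) (x ^ (1 / p) - θ) x := by
  have hq : 0 < 1 / p := by positivity
  have h := (((Real.hasDerivAt_rpow_const (x := x) (p := 1 / p + 1)
    (Or.inr (by linarith))).div_const (1 / p + 1)).sub
    ((hasDerivAt_id x).const_mul θ)).sub_const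
    ((θ ^ p) ^ (1 / p + 1) / (1 / p + 1) - θ * θ ^ p)
  have e : (1 / p + 1) * x ^ (1 / p + 1 - 1) / (1 / p + 1) - θ * 1 = x ^ (1 / p) - θ := by
    rw [add_sub_cancel_right, mul_div_cancel_left₀ _ (by positivity), mul_one]
  rw [e] at h
  exact h

lemma exp_sub_exp_mul_ge {B c v : ℝ} (h : |v - c| ≤ B) :
    exp (c - B) * (v - c) ^ 2 ≤ (v - c) * (exp v - exp c) := by
  have h1 : exp v = exp c * exp (v - c) := by rw [← exp_add]; ring_nf
  have h2 : exp c = exp v * exp (c - v) := by rw [← exp_add]; ring_nf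
  have h3 := add_one_le_exp (v - c)
  have h4 := add_one_le_exp (c - v)
  have h5 : exp (c - B) ≤ exp c := exp_le_exp.2 (by linarith [(abs_nonneg _).trans h])
  have h6 : exp (c - B) ≤ exp v := exp_le_exp.2 (by linarith [(abs_le.1 h).1])
  have := exp_pos c
  have := exp_pos v
  rcases le_total c v with hcv | hcv
  · have h7 : exp c * (v - c) ≤ exp v - exp c := by nlinarith
    have h8 : exp (c - B) * (v - c) ≤ exp c * (v - c) :=
      mul_le_mul_of_nonneg_right h5 (by linarith)
    nlinarith
  · have h7 : exp v * (c - v) ≤ exp c - exp v := by nlinarith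
    have h8 : exp (c - B) * (c - v) ≤ exp v * (c - v) :=
      mul_le_mul_of_nonneg_right h6 (by linarith)
    nlinarith

lemma sub_mul_rpow_inv_sub_nonneg {p θ : ℝ} (hp : 1 ≤ p) (hθ : 0 < θ) {x : ℝ} (hx : 0 ≤ x) :
    0 ≤ (x - θ ^ p) * (x ^ (1 / p) - θ) := by
  have hp0 : 0 < p := by linarith
  rcases le_total x (θ ^ p) with h | h
  · have := rpow_le_rpow hx h (by positivity : 0 ≤ 1 / p)
    rw [← rpow_mul hθ.le, mul_one_div_cancel hp0.ne', rpow_one] at this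
    nlinarith
  · have := rpow_le_rpow (by positivity) h (by positivity : 0 ≤ 1 / p)
    rw [← rpow_mul hθ.le, mul_one_div_cancel hp0.ne', rpow_one] at this
    nlinarith

lemma rpow_inv_sub_mul_ge {p θ M : ℝ} (hp : 1 ≤ p) (hθ : 0 < θ) (hM : θ ^ p ≤ M) {x : ℝ}
    (hx : x ∈ Icc 0 M) :
    (p * (M ^ (1 / p)) ^ (p - 1))⁻¹ * (x - θ ^ p) ^ 2 ≤ (x - θ ^ p) * (x ^ (1 / p) - θ) := by
  have hp0 : 0 < p := by linarith
  have hM0 : 0 < M := (rpow_pos_of_pos hθ p).trans_le hM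
  set K := p * (M ^ (1 / p)) ^ (p - 1) with hK
  have hKpos : 0 < K := by positivity
  have root : ∀ y : ℝ, 0 ≤ y → (y ^ (1 / p)) ^ p = y := fun y hy => by
    rw [← rpow_mul hy, one_div_mul_cancel hp0.ne', rpow_one]
  have hθM : θ ≤ M ^ (1 / p) := by
    have := rpow_le_rpow (by positivity) hM (by positivity : 0 ≤ 1 / p)
    rwa [← rpow_mul hθ.le, mul_one_div_cancel hp0.ne', rpow_one] at this
  have hlip : |x - θ ^ p| ≤ K * |x ^ (1 / p) - θ| := by
    have h := Convex.norm_image_sub_le_of_norm_hasDerivWithin_le (𝕜 := ℝ)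
      (f := fun y : ℝ => y ^ p) (f' := fun y => p * y ^ (p - 1)) (C := K)
      (s := Icc 0 (M ^ (1 / p))) (x := θ) (y := x ^ (1 / p))
      (fun y _ => (Real.hasDerivAt_rpow_const (Or.inr hp)).hasDerivWithinAt)
      (fun y hy => by
        rw [Real.norm_of_nonneg (mul_nonneg hp0.le (rpow_nonneg hy.1 _))]
        exact mul_le_mul_of_nonneg_left (rpow_le_rpow hy.1 hy.2 (by linarith)) hp0.le)
      (convex_Icc _ _) ⟨hθ.le, hθM⟩
      ⟨rpow_nonneg hx.1 _, rpow_le_rpow hx.1 hx.2 (by positivity)⟩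
    rwa [root x hx.1] at h
  have hsign := sub_mul_rpow_inv_sub_nonneg hp hθ hx.1
  rw [← abs_of_nonneg hsign, abs_mul, ← sq_abs, inv_mul_le_iff₀ hKpos]
  nlinarith [abs_nonneg (x - θ ^ p)]

lemma expPotential_nonneg (c v : ℝ) : 0 ≤ expPotential c v := by
  have h1 : exp v = exp c * exp (v - c) := by rw [← exp_add]; ring_nf
  have h3 := add_one_le_exp (v - c)
  have := exp_pos c
  unfold expPotential
  nlinarith

lemma monotoneOn_rpow_sub {q : ℝ} (hq : 0 ≤ q) (θ : ℝ) :
    MonotoneOn (fun x : ℝ => x ^ q - θ) (Ici 0) := fun _ hx _ _ hxy =>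
  sub_le_sub_right (rpow_le_rpow hx hxy hq) _

lemma powPotential_nonneg {p θ x : ℝ} (hp : 1 ≤ p) (hθ : 0 < θ) (hx : 0 ≤ x) :
    0 ≤ powPotential p θ x := by
  have h := (potential_bounds (I := Ici 0) (κ := 0) ordConnected_Ici
    (c := θ ^ p) (rpow_nonneg hθ.le p)
    (fun y _ => hasDerivAt_powPotential hp θ y) (monotoneOn_rpow_sub (by positivity) θ)
    (by simp [powPotential]) (fun y hy => ?_) hx).1
  · simpa using h
  · simpa using sub_mul_rpow_inv_sub_nonneg hp hθ hy

lemma abs_sub_le_of_expPotential_le {c v V : ℝ} (h : expPotential c v ≤ V) :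
    |v - c| ≤ 1 + 2 * V / exp c := by
  have hc := exp_pos c
  have hV : 0 ≤ V / exp c := div_nonneg ((expPotential_nonneg c v).trans h) hc.le
  have h1 : exp v = exp c * exp (v - c) := by rw [← exp_add]; ring_nf
  have h2 : exp (v - c) - 1 - (v - c) ≤ V / exp c := by
    rw [le_div_iff₀ hc]
    unfold expPotential at h
    nlinarith
  rw [mul_div_assoc, abs_le]
  constructor
  · linarith [exp_pos (v - c)]
  · rcases le_total (v - c) 0 with h0 | h0
    · linarith
    · have := Real.quadratic_le_exp_of_nonneg h0
      nlinarith [sq_nonneg (v - c - 1)]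

lemma le_of_powPotential_le {p θ x V : ℝ} (hp : 1 ≤ p) (hθ : 0 < θ) (hx : 0 ≤ x)
    (h : powPotential p θ x ≤ V) : x ≤ max (((θ + 1) * (1 / p + 1)) ^ p) V := by
  have hp0 : 0 < p := by linarith
  by_contra! hlt
  obtain ⟨h1, h2⟩ := max_lt_iff.1 hlt
  have hq : 0 < 1 / p := by positivity
  have h3 := rpow_le_rpow (by positivity) h1.le hq.le
  rw [← rpow_mul (by positivity), mul_one_div_cancel hp0.ne', rpow_one] at h3
  have hx0 : 0 < x := lt_of_le_of_lt (by positivity) h1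
  have e1 : x ^ (1 / p + 1) = x ^ (1 / p) * x := by rw [rpow_add hx0, rpow_one]
  have e2 : (θ ^ p) ^ (1 / p + 1) = θ * θ ^ p := by
    rw [rpow_add (by positivity), rpow_one, ← rpow_mul hθ.le, mul_one_div_cancel hp0.ne', rpow_one]
  have h4 : (θ + 1) * x ≤ x ^ (1 / p + 1) / (1 / p + 1) := by
    rw [le_div_iff₀ (by positivity), e1]
    nlinarith
  have h5 : (θ ^ p) ^ (1 / p + 1) / (1 / p + 1) ≤ θ * θ ^ p := by
    rw [e2]
    exact div_le_self (by positivity) (by linarith)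
  unfold powPotential at h
  nlinarith

/-- The perturbed Lyapunov function `H + G - ε a b` is comparable to `H + G` and controlled by its
dissipation rate. -/
lemma perturbed_lyapunov_bounds {N κ μ ε a b S E H G : ℝ} (hN : 0 < N) (hκ : 0 < κ) (hμ : 0 < μ)
    (hε : 0 < ε) (hεκ : ε ≤ κ / 2) (hεμ : ε ≤ μ / 2)
    (hεN : ε * (1 + N ^ 2 / (2 * μ * κ)) ≤ N / 2)
    (haS : κ * a ^ 2 ≤ a * S) (hbE : μ * b ^ 2 ≤ b * E)
    (hH : κ / 2 * a ^ 2 ≤ H ∧ H ≤ a * S) (hG : μ / 2 * b ^ 2 ≤ G ∧ G ≤ b * E) :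
    μ / 4 * b ^ 2 ≤ H + G - ε * (a * b) ∧ H + G - ε * (a * b) ≤ 2 * (H + G) ∧
      min N ε / 4 * (H + G - ε * (a * b)) ≤ N * (a * S) + ε * (E * b - N * (a * b) - a * S) := by
  have ha2 := sq_nonneg a
  have hb2 := sq_nonneg b
  have hab1 : ε * (a * b) ≤ ε * (a ^ 2 + b ^ 2) / 2 := by nlinarith [sq_nonneg (a - b)]
  have hab2 : -(ε * (a ^ 2 + b ^ 2) / 2) ≤ ε * (a * b) := by nlinarith [sq_nonneg (a + b)]
  have h1 : ε * a ^ 2 ≤ κ / 2 * a ^ 2 := mul_le_mul_of_nonneg_right hεκ ha2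
  have h2 : ε * b ^ 2 ≤ μ / 2 * b ^ 2 := mul_le_mul_of_nonneg_right hεμ hb2
  have hκa := mul_nonneg hκ.le ha2
  have hμb := mul_nonneg hμ.le hb2
  have hW2 : H + G - ε * (a * b) ≤ 2 * (H + G) := by linarith
  refine ⟨by linarith, hW2, ?_⟩
  have hNab : N * (a * b) ≤ μ * b ^ 2 / 2 + N ^ 2 / (2 * μ * κ) * (κ * a ^ 2) := by
    have e : N ^ 2 / (2 * μ * κ) * (κ * a ^ 2) = (N * a) ^ 2 / (2 * μ) := by
      field_simp
    rw [e, ← sub_nonneg]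
    have : μ * b ^ 2 / 2 + (N * a) ^ 2 / (2 * μ) - N * (a * b) = (μ * b - N * a) ^ 2 / (2 * μ) := by
      field_simp; ring
    rw [this]; positivity
  have hc : 0 ≤ N ^ 2 / (2 * μ * κ) := by positivity
  have h3 : N ^ 2 / (2 * μ * κ) * (κ * a ^ 2) ≤ N ^ 2 / (2 * μ * κ) * (a * S) :=
    mul_le_mul_of_nonneg_left haS hc
  have h4 : ε * (N * (a * b)) ≤ ε * (b * E / 2 + N ^ 2 / (2 * μ * κ) * (a * S)) :=
    mul_le_mul_of_nonneg_left (by linarith) hε.le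
  have h5 : ε * (1 + N ^ 2 / (2 * μ * κ)) * (a * S) ≤ N / 2 * (a * S) :=
    mul_le_mul_of_nonneg_right hεN (by linarith)
  have hm : 0 < min N ε := lt_min hN hε
  have h6 : min N ε / 4 * (H + G - ε * (a * b)) ≤ min N ε / 4 * (2 * (a * S + b * E)) :=
    mul_le_mul_of_nonneg_left (by linarith) (by linarith)
  have h7 : min N ε * (a * S) ≤ N * (a * S) :=
    mul_le_mul_of_nonneg_right (min_le_left _ _) (by linarith)
  have h8 : min N ε * (b * E) ≤ ε * (b * E) :=
    mul_le_mul_of_nonneg_right (min_le_right _ _) (by linarith)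
  linarith

/-- Trajectories of `r X' = e ^ v - N X`, `r v' = θ - X ^ (1 / p)` starting in a fixed sublevel set
of the Lyapunov function converge to the equilibrium at a uniform algebraic rate. -/
theorem exists_uniform_decay {p θ N : ℝ} (hp : 1 ≤ p) (hθ : 0 < θ) (hN : 0 < N) (V₀ : ℝ) :
    ∃ C c : ℝ, 0 < c ∧ ∀ (X v : ℝ → ℝ) (r₀ : ℝ), 0 < r₀ → (∀ r, r₀ ≤ r → 0 ≤ X r) →
      (∀ r, r₀ ≤ r → HasDerivAt X ((exp (v r) - N * X r) / r) r) →
      (∀ r, r₀ ≤ r → HasDerivAt v ((θ - X r ^ (1 / p)) / r) r) →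
      powPotential p θ (X r₀) + expPotential (log (N * θ ^ p)) (v r₀) ≤ V₀ →
      ∀ r, r₀ ≤ r → |v r - log (N * θ ^ p)| ≤ C * (r₀ / r) ^ c := by
  have hy : 0 < N * θ ^ p := by positivity
  set vs := log (N * θ ^ p)
  have hexp : exp vs = N * θ ^ p := exp_log hy
  set B := 1 + 2 * V₀ / exp vs
  set M := max (θ ^ p) (max (((θ + 1) * (1 / p + 1)) ^ p) V₀)
  have hM : 0 < M := lt_max_of_lt_left (by positivity)
  set κ := (p * (M ^ (1 / p)) ^ (p - 1))⁻¹
  have hκ : 0 < κ := by positivity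
  set μ := exp (vs - B)
  have hμ : 0 < μ := exp_pos _
  set ε := min (min (κ / 2) (μ / 2)) (N / 2 / (1 + N ^ 2 / (2 * μ * κ)))
  have hε : 0 < ε := by positivity
  have hεκ : ε ≤ κ / 2 := (min_le_left _ _).trans (min_le_left _ _)
  have hεμ : ε ≤ μ / 2 := (min_le_left _ _).trans (min_le_right _ _)
  have hεN : ε * (1 + N ^ 2 / (2 * μ * κ)) ≤ N / 2 := by
    rw [← le_div_iff₀ (by positivity)]
    exact min_le_right _ _
  set k := min N ε / 4
  have hk : 0 < k := by positivity
  refine ⟨√(8 * V₀ / μ), k / 2, by positivity, ?_⟩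
  intro X v r₀ hr₀ hX hdX hdv hV₀
  have hV : ∀ r, r₀ ≤ r → powPotential p θ (X r) + expPotential vs (v r) ≤ V₀ := by
    have hd : ∀ r, r₀ ≤ r → HasDerivAt (fun r => powPotential p θ (X r) + expPotential vs (v r))
        (-(N * ((X r - θ ^ p) * (X r ^ (1 / p) - θ)) / r)) r := fun r hr => by
      have hr' : r ≠ 0 := (hr₀.trans_le hr).ne'
      refine (((hasDerivAt_powPotential hp θ (X r)).comp r (hdX r hr)).add
        ((hasDerivAt_expPotential vs (v r)).comp r (hdv r hr))).congr_deriv ?_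
      rw [hexp]; field_simp; ring
    have hanti : AntitoneOn (fun r => powPotential p θ (X r) + expPotential vs (v r)) (Ici r₀) := by
      refine antitoneOn_of_deriv_nonpos (convex_Ici r₀)
        (fun r hr => (hd r hr).continuousAt.continuousWithinAt)
        (fun r hr => (hd r (interior_subset hr)).differentiableAt.differentiableWithinAt)
        (fun r hr => ?_)
      have hr' : r₀ ≤ r := interior_subset hr
      have := sub_mul_rpow_inv_sub_nonneg hp hθ (hX r hr')
      have : 0 < r := hr₀.trans_le hr'
      rw [(hd r hr').deriv, neg_nonpos]
      positivity
    intro r hr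
    exact (hanti self_mem_Ici hr hr).trans hV₀
  let W : ℝ → ℝ := fun r => powPotential p θ (X r) + expPotential vs (v r) -
    ε * ((X r - θ ^ p) * (v r - vs))
  have hvB : ∀ r, r₀ ≤ r → |v r - vs| ≤ B := fun r hr =>
    abs_sub_le_of_expPotential_le (by linarith [hV r hr, powPotential_nonneg hp hθ (hX r hr)])
  have hXM : ∀ r, r₀ ≤ r → X r ∈ Icc 0 M := fun r hr =>
    ⟨hX r hr, (le_of_powPotential_le hp hθ (hX r hr)
      (by linarith [hV r hr, expPotential_nonneg vs (v r)])).trans (le_max_right _ _)⟩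
  have hbounds := fun r hr => perturbed_lyapunov_bounds hN hκ hμ hε hεκ hεμ hεN
    (rpow_inv_sub_mul_ge hp hθ (le_max_left _ _) (hXM r hr)) (exp_sub_exp_mul_ge (hvB r hr))
    (potential_bounds (I := Icc 0 M) ordConnected_Icc ⟨by positivity, le_max_left _ _⟩
      (fun y _ => hasDerivAt_powPotential hp θ y)
      ((monotoneOn_rpow_sub (by positivity) θ).mono Icc_subset_Ici_self) (by simp [powPotential])
      (fun y hy => rpow_inv_sub_mul_ge hp hθ (le_max_left _ _) hy) (hXM r hr))
    (potential_bounds (I := Icc (vs - B) (vs + B)) ordConnected_Icc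
      (by have := (abs_nonneg _).trans (hvB r hr); constructor <;> linarith)
      (fun y _ => hasDerivAt_expPotential vs y)
      (fun y _ z _ hyz => sub_le_sub_right (exp_le_exp.2 hyz) _) (by simp [expPotential])
      (fun y hy => exp_sub_exp_mul_ge (abs_le.2 ⟨by linarith [hy.1], by linarith [hy.2]⟩))
      (by have := abs_le.1 (hvB r hr); constructor <;> linarith))
  have hdW : ∀ r, r₀ ≤ r → HasDerivAt W (-((N * ((X r - θ ^ p) * (X r ^ (1 / p) - θ)) +
      ε * ((exp (v r) - exp vs) * (v r - vs) - N * ((X r - θ ^ p) * (v r - vs)) -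
        (X r - θ ^ p) * (X r ^ (1 / p) - θ))) / r)) r := fun r hr => by
    have hr' : r ≠ 0 := (hr₀.trans_le hr).ne'
    refine ((((hasDerivAt_powPotential hp θ (X r)).comp r (hdX r hr)).add
      ((hasDerivAt_expPotential vs (v r)).comp r (hdv r hr))).sub
      ((((hdX r hr).sub_const (θ ^ p)).mul ((hdv r hr).sub_const vs)).const_mul ε)).congr_deriv ?_
    rw [hexp]; field_simp; ring
  have hdkW : ∀ r, r₀ ≤ r → HasDerivAt (fun r => r ^ k * W r) _ r := fun r hr =>
    (Real.hasDerivAt_rpow_const (p := k) (Or.inl (hr₀.trans_le hr).ne')).mul (hdW r hr)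
  have hanti : AntitoneOn (fun r => r ^ k * W r) (Ici r₀) := by
    refine antitoneOn_of_deriv_nonpos (convex_Ici r₀)
      (fun r hr => (hdkW r hr).continuousAt.continuousWithinAt)
      (fun r hr => (hdkW r (interior_subset hr)).differentiableAt.differentiableWithinAt)
      (fun r hr => ?_)
    have hr' : r₀ ≤ r := interior_subset hr
    have hr0 : 0 < r := hr₀.trans_le hr'
    rw [(hdkW r hr').deriv, rpow_sub_one hr0.ne']
    have h := (hbounds r hr').2.2
    have h' : 0 ≤ r ^ k / r := by positivity
    have := mul_le_mul_of_nonneg_left h h'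
    have e : ∀ D : ℝ, k * (r ^ k / r) * W r + r ^ k * -(D / r) =
      r ^ k / r * (k * W r) - r ^ k / r * D := fun D => by field_simp; ring
    exact (e _).trans_le (sub_nonpos.2 this)
  intro r hr
  have hr0 : 0 < r := hr₀.trans_le hr
  have h1 : r ^ k * W r ≤ r₀ ^ k * W r₀ := hanti self_mem_Ici hr hr
  have h2 : μ / 4 * (v r - vs) ^ 2 ≤ W r := (hbounds r hr).1
  have h3 : W r₀ ≤ 2 * V₀ := (hbounds r₀ le_rfl).2.1.trans (by linarith)
  have h4 : (v r - vs) ^ 2 ≤ 8 * V₀ / μ * (r₀ / r) ^ k := by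
    have hWr : W r ≤ 2 * V₀ * (r₀ / r) ^ k := by
      rw [div_rpow hr₀.le hr0.le, ← mul_div_assoc, le_div_iff₀ (by positivity)]
      have : r₀ ^ k * W r₀ ≤ r₀ ^ k * (2 * V₀) := mul_le_mul_of_nonneg_left h3 (by positivity)
      linarith
    have := h2.trans hWr
    rw [div_mul_eq_mul_div, le_div_iff₀ hμ]
    linarith
  have h5 := Real.abs_le_sqrt h4
  have hV0 : 0 ≤ V₀ := by
    linarith [powPotential_nonneg hp hθ (hX r₀ le_rfl), expPotential_nonneg vs (v r₀)]
  rwa [Real.sqrt_mul (by positivity), Real.sqrt_eq_rpow ((r₀ / r) ^ k), ← rpow_mul (by positivity),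
    mul_one_div] at h5

/-- The weight `∫₀ᵗ s ^ γ e ^ {u(s)} ds`. -/
noncomputable def expMass (γ : ℝ) (u : ℝ → ℝ) (t : ℝ) : ℝ := ∫ s in (0 : ℝ)..t, s ^ γ * exp (u s)

/-- `u` is a regular solution with value `ρ` at the origin, where `p = β + 1`. -/
def IsRegularSolution (α p γ ρ : ℝ) (u : ℝ → ℝ) : Prop :=
  ContinuousOn u (Ici 0) ∧ ∀ r, 0 ≤ r →
    u r = ρ - ∫ t in (0 : ℝ)..r, t ^ (-(α / p)) * expMass γ u t ^ (1 / p)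

section RegularSolution

variable {α p γ ρ : ℝ} {u : ℝ → ℝ}

lemma intervalIntegrable_rpow_mul_exp (hγ : -1 < γ) (hu : ContinuousOn u (Ici 0)) {t : ℝ}
    (ht : 0 ≤ t) :
    IntervalIntegrable (fun s => s ^ γ * exp (u s)) MeasureTheory.volume 0 t :=
  (intervalIntegral.intervalIntegrable_rpow' hγ).mul_continuousOn
    (continuous_exp.comp_continuousOn (hu.mono (by rw [uIcc_of_le ht]; exact Icc_subset_Ici_self)))

lemma expMass_nonneg {t : ℝ} (ht : 0 ≤ t) : 0 ≤ expMass γ u t :=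
  intervalIntegral.integral_nonneg ht fun _ hs => mul_nonneg (rpow_nonneg hs.1 _) (exp_pos _).le

lemma expMass_le (hγ : -1 < γ) (hu : ContinuousOn u (Ici 0)) {m t : ℝ} (ht : 0 ≤ t)
    (hm : ∀ s ∈ Icc 0 t, u s ≤ m) : expMass γ u t ≤ exp m / (γ + 1) * t ^ (γ + 1) := by
  have h : expMass γ u t ≤ ∫ s in (0 : ℝ)..t, s ^ γ * exp m :=
    intervalIntegral.integral_mono_on ht (intervalIntegrable_rpow_mul_exp hγ hu ht)
      ((intervalIntegral.intervalIntegrable_rpow' hγ).mul_const _) fun _ hs =>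
      mul_le_mul_of_nonneg_left (exp_le_exp.2 (hm _ hs)) (rpow_nonneg hs.1 _)
  rw [intervalIntegral.integral_mul_const, integral_rpow (Or.inl hγ),
    zero_rpow (by linarith)] at h
  refine h.trans_eq ?_
  ring

lemma continuousOn_rpow_mul_exp (hu : ContinuousOn u (Ici 0)) :
    ContinuousOn (fun s => s ^ γ * exp (u s)) (Ioi 0) := fun s hs =>
  ((Real.continuousAt_rpow_const s γ (Or.inl (ne_of_gt hs))).continuousWithinAt).mul
    (continuous_exp.continuousAt.comp_continuousWithinAt
      ((hu s (Ioi_subset_Ici_self hs)).mono Ioi_subset_Ici_self))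

lemma hasDerivAt_expMass (hγ : -1 < γ) (hu : ContinuousOn u (Ici 0)) {t : ℝ} (ht : 0 < t) :
    HasDerivAt (expMass γ u) (t ^ γ * exp (u t)) t :=
  intervalIntegral.integral_hasDerivAt_right (intervalIntegrable_rpow_mul_exp hγ hu ht.le)
    ((continuousOn_rpow_mul_exp hu).stronglyMeasurableAtFilter isOpen_Ioi t ht)
    ((continuousOn_rpow_mul_exp hu).continuousAt (Ioi_mem_nhds ht))

lemma continuousOn_flux (hp : 0 < p) (hγ : -1 < γ) (hu : ContinuousOn u (Ici 0)) :
    ContinuousOn (fun t => t ^ (-(α / p)) * expMass γ u t ^ (1 / p)) (Ioi 0) := fun t ht =>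
  (ContinuousAt.mul (Real.continuousAt_rpow_const t _ (Or.inl (ne_of_gt ht)))
    ((hasDerivAt_expMass hγ hu ht).continuousAt.rpow_const
      (Or.inr (by positivity)))).continuousWithinAt

lemma flux_nonneg {t : ℝ} (ht : 0 ≤ t) : 0 ≤ t ^ (-(α / p)) * expMass γ u t ^ (1 / p) :=
  mul_nonneg (rpow_nonneg ht _) (rpow_nonneg (expMass_nonneg ht) _)

lemma flux_le (hp : 0 < p) (hγ : -1 < γ) (hu : ContinuousOn u (Ici 0)) {m t : ℝ} (ht : 0 < t)
    (hm : ∀ s ∈ Icc 0 t, u s ≤ m) :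
    t ^ (-(α / p)) * expMass γ u t ^ (1 / p) ≤
      (exp m / (γ + 1)) ^ (1 / p) * t ^ ((γ + 1 + p - α) / p - 1) := by
  have hγ' : 0 < γ + 1 := by linarith
  have h := rpow_le_rpow (expMass_nonneg ht.le) (expMass_le hγ hu ht.le hm)
    (by positivity : 0 ≤ 1 / p)
  rw [mul_rpow (by positivity) (by positivity), ← rpow_mul ht.le] at h
  refine (mul_le_mul_of_nonneg_left h (rpow_nonneg ht.le _)).trans_eq ?_
  rw [mul_left_comm, ← rpow_add ht]
  congr 2
  field_simp; ring

lemma intervalIntegrable_flux (hp : 0 < p) (hγ : -1 < γ) (hθ : 0 < γ + 1 + p - α)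
    (hu : ContinuousOn u (Ici 0)) {r : ℝ} (hr : 0 ≤ r) :
    IntervalIntegrable (fun t => t ^ (-(α / p)) * expMass γ u t ^ (1 / p))
      MeasureTheory.volume 0 r := by
  obtain ⟨m, hm⟩ := isCompact_Icc.bddAbove_image
    (hu.mono (Icc_subset_Ici_self : Icc 0 r ⊆ Ici 0))
  have hint : IntervalIntegrable
      (fun t => (exp m / (γ + 1)) ^ (1 / p) * t ^ ((γ + 1 + p - α) / p - 1))
      MeasureTheory.volume 0 r :=
    (intervalIntegral.intervalIntegrable_rpow' (by
      have : 0 < (γ + 1 + p - α) / p := by positivity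
      linarith)).const_mul _
  refine hint.mono_fun ?_ ?_
  · rw [uIoc_of_le hr]
    exact ((continuousOn_flux hp hγ hu).mono Ioc_subset_Ioi_self).aestronglyMeasurable
      measurableSet_Ioc
  · rw [uIoc_of_le hr]
    refine (MeasureTheory.ae_restrict_mem measurableSet_Ioc).mono fun t ht => ?_
    beta_reduce
    rw [Real.norm_of_nonneg (flux_nonneg ht.1.le)]
    exact (flux_le hp hγ hu ht.1 fun s hs =>
      hm (mem_image_of_mem u ⟨hs.1, hs.2.trans ht.2⟩)).trans (le_abs_self _)

namespace IsRegularSolution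

lemma le (h : IsRegularSolution α p γ ρ u) {r : ℝ} (hr : 0 ≤ r) : u r ≤ ρ := by
  rw [h.2 r hr]
  have := intervalIntegral.integral_nonneg (μ := MeasureTheory.volume) hr
    fun t ht => flux_nonneg (α := α) (p := p) (γ := γ) (u := u) ht.1
  linarith

lemma ge (h : IsRegularSolution α p γ ρ u) (hp : 0 < p) (hγ : -1 < γ) (hθ : 0 < γ + 1 + p - α)
    {r : ℝ} (hr : 0 ≤ r) :
    ρ - (exp ρ / (γ + 1)) ^ (1 / p) * (r ^ ((γ + 1 + p - α) / p) * (p / (γ + 1 + p - α))) ≤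
      u r := by
  have hq : 0 < (γ + 1 + p - α) / p := by positivity
  rw [h.2 r hr]
  have h1 := intervalIntegral.integral_mono_on_of_le_Ioo hr
    (intervalIntegrable_flux hp hγ hθ h.1 hr)
    ((intervalIntegral.intervalIntegrable_rpow' (a := 0) (b := r)
      (by linarith : -1 < (γ + 1 + p - α) / p - 1)).const_mul ((exp ρ / (γ + 1)) ^ (1 / p)))
    (fun t ht => flux_le hp hγ h.1 ht.1 fun s hs => h.le hs.1)
  rw [intervalIntegral.integral_const_mul, integral_rpow (Or.inl (by linarith)),
    sub_add_cancel, zero_rpow hq.ne', sub_zero, div_div_eq_mul_div, mul_div_assoc] at h1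
  linarith

lemma hasDerivAt (h : IsRegularSolution α p γ ρ u) (hp : 0 < p) (hγ : -1 < γ)
    (hθ : 0 < γ + 1 + p - α) {r : ℝ} (hr : 0 < r) :
    HasDerivAt u (-(r ^ (-(α / p)) * expMass γ u r ^ (1 / p))) r := by
  have hd := (intervalIntegral.integral_hasDerivAt_right
    (intervalIntegrable_flux hp hγ hθ h.1 hr.le)
    ((continuousOn_flux hp hγ h.1).stronglyMeasurableAtFilter isOpen_Ioi r hr)
    ((continuousOn_flux hp hγ h.1).continuousAt (Ioi_mem_nhds hr))).const_sub ρ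
  refine hd.congr_of_eventuallyEq ?_
  filter_upwards [Ioi_mem_nhds hr] with s hs using h.2 s (le_of_lt hs)

lemma antitoneOn (h : IsRegularSolution α p γ ρ u) (hp : 0 < p) (hγ : -1 < γ)
    (hθ : 0 < γ + 1 + p - α) : AntitoneOn u (Ioi 0) :=
  antitoneOn_of_deriv_nonpos (convex_Ioi 0) (h.1.mono Ioi_subset_Ici_self)
    (fun r hr => (h.hasDerivAt hp hγ hθ (interior_subset hr :)).differentiableAt.differentiableWithinAt)
    (fun r hr => by
      have hr' : 0 < r := (interior_subset hr :)
      rw [(h.hasDerivAt hp hγ hθ hr').deriv, neg_nonpos]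
      exact flux_nonneg hr'.le)

end IsRegularSolution

end RegularSolution

/-- Regular solutions approach the singular solution `log (N θ ^ p) - θ log r`, `N = α - p`, at a
rate which is uniform in the initial value `ρ`. -/
theorem IsRegularSolution.exists_uniform_rate {α p γ θ : ℝ} (hp : 1 ≤ p) (hα : p < α)
    (hθ : θ = γ + 1 + p - α) (hθ0 : 0 < θ) :
    ∃ C c : ℝ, 0 < c ∧ ∀ (ρ : ℝ) (u : ℝ → ℝ), IsRegularSolution α p γ ρ u →
      ∀ r, exp (-(ρ / θ)) ≤ r →
        |u r + θ * log r - log ((α - p) * θ ^ p)| ≤ C * (exp (-(ρ / θ)) / r) ^ c := by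
  have hp0 : 0 < p := by linarith
  have hγ : -1 < γ := by linarith
  have hγ' : 0 < γ + 1 := by linarith
  have hN : 0 < α - p := by linarith
  set D := (1 / (γ + 1)) ^ (1 / p) * (p / θ)
  set vs := log ((α - p) * θ ^ p)
  have hcont : ContinuousOn (fun z : ℝ × ℝ => powPotential p θ z.1 + expPotential vs z.2)
      (Icc 0 (1 / (γ + 1)) ×ˢ Icc (-D) 0) := by
    refine Continuous.continuousOn (Continuous.add ?_ ?_)
    · exact (continuous_iff_continuousAt.2
        fun x => (hasDerivAt_powPotential hp θ x).continuousAt).comp continuous_fst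
    · exact (continuous_iff_continuousAt.2
        fun x => (hasDerivAt_expPotential vs x).continuousAt).comp continuous_snd
  obtain ⟨V₀, hV₀⟩ := (isCompact_Icc.prod isCompact_Icc).bddAbove_image hcont
  obtain ⟨C, c, hc, H⟩ := exists_uniform_decay hp hθ0 hN V₀
  refine ⟨C, c, hc, fun ρ u hu => ?_⟩
  set r₀ := exp (-(ρ / θ)) with hr₀
  have hr₀pos : 0 < r₀ := exp_pos _
  have hlog : θ * log r₀ = -ρ := by rw [hr₀, log_exp]; field_simp
  have hpow : r₀ ^ θ = exp (-ρ) := by rw [hr₀, ← exp_mul]; congr 1; field_simp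
  refine H (fun r => r ^ (-(α - p)) * expMass γ u r) (fun r => u r + θ * log r) r₀ hr₀pos ?_ ?_ ?_ ?_
  · intro r hr
    have hr' := hr₀pos.trans_le hr
    exact mul_nonneg (rpow_nonneg hr'.le _) (expMass_nonneg hr'.le)
  · intro r hr
    have hr' := hr₀pos.trans_le hr
    refine ((Real.hasDerivAt_rpow_const (Or.inl hr'.ne')).mul
      (hasDerivAt_expMass hγ hu.1 hr')).congr_deriv ?_
    have e1 : exp (u r + θ * log r) = r * (r ^ (-(α - p)) * r ^ γ) * exp (u r) := by
      rw [exp_add, mul_comm θ, ← rpow_def_of_pos hr', ← rpow_add hr', mul_comm]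
      congr 1
      nth_rewrite 2 [← rpow_one r]
      rw [← rpow_add hr']
      congr 1; rw [hθ]; ring
    rw [e1, rpow_sub_one hr'.ne']
    field_simp; ring
  · intro r hr
    have hr' := hr₀pos.trans_le hr
    refine ((hu.hasDerivAt hp0 hγ (hθ ▸ hθ0) hr').add
      ((Real.hasDerivAt_log hr'.ne').const_mul θ)).congr_deriv ?_
    have e1 : (r ^ (-(α - p)) * expMass γ u r) ^ (1 / p) =
        r * (r ^ (-(α / p)) * expMass γ u r ^ (1 / p)) := by
      rw [mul_rpow (by positivity) (expMass_nonneg hr'.le), ← mul_assoc, ← rpow_mul hr'.le]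
      congr 1
      nth_rewrite 2 [← rpow_one r]
      rw [← rpow_add hr']
      congr 1; field_simp; ring
    rw [e1]
    field_simp; ring
  · refine hV₀ (mem_image_of_mem (fun z : ℝ × ℝ => powPotential p θ z.1 + expPotential vs z.2)
      (show (r₀ ^ (-(α - p)) * expMass γ u r₀, u r₀ + θ * log r₀) ∈
        Icc 0 (1 / (γ + 1)) ×ˢ Icc (-D) 0 from ⟨⟨?_, ?_⟩, ?_, ?_⟩))
    · exact mul_nonneg (rpow_nonneg hr₀pos.le _) (expMass_nonneg hr₀pos.le)
    · refine (mul_le_mul_of_nonneg_left (expMass_le hγ hu.1 hr₀pos.le fun s hs => hu.le hs.1)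
        (rpow_nonneg hr₀pos.le _)).trans_eq ?_
      rw [mul_left_comm, ← rpow_add hr₀pos, show -(α - p) + (γ + 1) = θ by rw [hθ]; ring, hpow,
        div_mul_eq_mul_div, ← exp_add, add_neg_cancel, exp_zero]
    · have h := hu.ge hp0 hγ (hθ ▸ hθ0) hr₀pos.le
      rw [← hθ] at h
      have e : (exp ρ / (γ + 1)) ^ (1 / p) * (r₀ ^ (θ / p) * (p / θ)) = D := by
        rw [div_eq_mul_one_div θ p, rpow_mul hr₀pos.le, hpow, ← mul_assoc,
          ← mul_rpow (by positivity) (exp_pos _).le, div_mul_eq_mul_div, ← exp_add,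
          add_neg_cancel, exp_zero]
      rw [e] at h
      change -D ≤ u r₀ + θ * log r₀
      linarith
    · have := hu.le hr₀pos.le
      change u r₀ + θ * log r₀ ≤ 0
      linarith

/-- Theorem 1.7 / 5.3: for `L(u) + e^u = 0`, as `ρ → +∞` the regular solutions
`u(·,ρ)` converge to the singular solution `u*` uniformly on compact subsets of
`(0,∞)`, `λ(ρ) = R(0,ρ)^θ → λ* = θ^{β+1}(α−β−1)`, and the rescaled solutions
`u_{λ(ρ)}` converge to `u*_{λ*}` uniformly on compact subsets of `(0,∞)`. -/
theorem stmt_7 (α β γ θ : ℝ) (hθ : θ = γ + 2 + β - α)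
    (hαβ : α > β + 1) (hβ : 0 ≤ β) (hθpos : 0 < θ)
    (u : ℝ → ℝ → ℝ)
    (hucont : ∀ ρ, 0 < ρ → ContinuousOn (u ρ) (Ici 0))
    (hueq : ∀ ρ, 0 < ρ → ∀ r, 0 ≤ r →
      u ρ r = ρ - ∫ t in (0:ℝ)..r, t ^ (-(α / (β + 1))) *
        (∫ s in (0:ℝ)..t, s ^ γ * Real.exp (u ρ s)) ^ ((1:ℝ) / (β + 1)))
    (R lam : ℝ → ℝ)
    (hR : ∀ ρ, 0 < ρ → 0 < R ρ ∧ u ρ (R ρ) = 0 ∧ ∀ r, 0 < r → u ρ r = 0 → r = R ρ)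
    (hlam : ∀ ρ, lam ρ = R ρ ^ θ)
    (ustar : ℝ → ℝ)
    (hustar : ∀ r, ustar r = Real.log (θ ^ (β + 1) * (α - β - 1)) - θ * Real.log r)
    (lamstar : ℝ) (hlamstar : lamstar = θ ^ (β + 1) * (α - β - 1)) :
    (∀ K : Set ℝ, IsCompact K → K ⊆ Ioi 0 →
      TendstoUniformlyOn (fun ρ s => u ρ s) ustar atTop K) ∧
    Tendsto lam atTop (nhds lamstar) ∧
    (∀ K : Set ℝ, IsCompact K → K ⊆ Ioi 0 →
      TendstoUniformlyOn (fun ρ r => u ρ (lam ρ ^ ((1:ℝ) / θ) * r))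
        (fun r => ustar (lamstar ^ ((1:ℝ) / θ) * r)) atTop K) := by
  have hp : 1 ≤ β + 1 := by linarith
  have hθ' : θ = γ + 1 + (β + 1) - α := by rw [hθ]; ring
  have hreg : ∀ ρ, 0 < ρ → IsRegularSolution α (β + 1) γ ρ (u ρ) := fun ρ hρ =>
    ⟨hucont ρ hρ, hueq ρ hρ⟩
  have hpos : 0 < lamstar := by
    rw [hlamstar]
    exact mul_pos (rpow_pos_of_pos hθpos _) (by linarith)
  rw [← hlamstar] at hustar
  have hunif : ∀ r₁, 0 < r₁ → TendstoUniformlyOn (fun ρ s => u ρ s) ustar atTop (Ici r₁) := by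
    obtain ⟨C, c, hc, H⟩ := IsRegularSolution.exists_uniform_rate hp hαβ hθ' hθpos
    have hL : (α - (β + 1)) * θ ^ (β + 1) = lamstar := by rw [hlamstar]; ring
    rw [hL] at H
    intro r₁ hr₁
    have hexp : Tendsto (fun ρ : ℝ => exp (-(ρ / θ))) atTop (nhds 0) :=
      tendsto_exp_neg_atTop_nhds_zero.comp (tendsto_id.atTop_div_const hθpos)
    have hδ : Tendsto (fun ρ : ℝ => |C| * (exp (-(ρ / θ)) / r₁) ^ c) atTop (nhds 0) := by
      have := ((hexp.div_const r₁).rpow_const (Or.inr hc.le)).const_mul |C|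
      simpa [zero_rpow hc.ne'] using this
    refine Metric.tendstoUniformlyOn_iff.2 fun η hη => ?_
    filter_upwards [eventually_gt_atTop 0, hexp.eventually (gt_mem_nhds hr₁),
      hδ.eventually (gt_mem_nhds hη)] with ρ hρ h1 h2 r hr
    have hr : r₁ ≤ r := hr
    rw [dist_comm, Real.dist_eq, hustar, show u ρ r - (log lamstar - θ * log r) =
      u ρ r + θ * log r - log lamstar by ring]
    refine ((H ρ (u ρ) (hreg ρ hρ) r (h1.le.trans hr)).trans ?_).trans_lt h2
    have hr0 : 0 < r := hr₁.trans_le hr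
    gcongr
    exact le_abs_self C
  have hcpt : ∀ K : Set ℝ, IsCompact K → K ⊆ Ioi 0 → ∃ r₁, 0 < r₁ ∧ K ⊆ Ici r₁ := by
    intro K hK hK0
    rcases K.eq_empty_or_nonempty with rfl | hne
    · exact ⟨1, one_pos, empty_subset _⟩
    · obtain ⟨r₁, hr₁, hmin⟩ := hK.exists_isLeast hne
      exact ⟨r₁, hK0 hr₁, hmin⟩
  have hlogR : Tendsto (fun ρ => log (R ρ)) atTop (nhds (log lamstar / θ)) := by
    set r₁ := exp ((log lamstar - 1) / θ)
    have hr₁ : ustar r₁ = 1 := by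
      rw [hustar, log_exp]; field_simp; ring
    have hu := Metric.tendstoUniformlyOn_iff.1 (hunif r₁ (exp_pos _))
    refine Metric.tendsto_nhds.2 fun η hη => ?_
    filter_upwards [eventually_gt_atTop 0, hu 1 one_pos, hu (θ * η) (by positivity)]
      with ρ hρ h1 h2
    obtain ⟨hR0, hRz, -⟩ := hR ρ hρ
    have hRr : r₁ ≤ R ρ := by
      by_contra! hlt
      have h3 := (hreg ρ hρ).antitoneOn (by linarith) (by linarith) (hθ' ▸ hθpos) hR0
        (exp_pos _ : r₁ ∈ Ioi 0) hlt.le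
      have h4 := h1 r₁ self_mem_Ici
      rw [hr₁, Real.dist_eq, abs_lt] at h4
      linarith [h4.2]
    have h5 := h2 (R ρ) hRr
    rw [hRz, hustar, Real.dist_eq, sub_zero] at h5
    rw [dist_comm, Real.dist_eq, ← mul_lt_mul_iff_right₀ hθpos, ← abs_of_pos hθpos, ← abs_mul,
      abs_of_pos hθpos, mul_sub, mul_div_cancel₀ _ hθpos.ne']
    exact h5
  have hRlim : Tendsto R atTop (nhds (lamstar ^ (1 / θ))) := by
    rw [rpow_def_of_pos hpos, mul_one_div]
    refine ((continuous_exp.tendsto _).comp hlogR).congr' ?_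
    filter_upwards [eventually_gt_atTop 0] with ρ hρ using exp_log (hR ρ hρ).1
  refine ⟨fun K hK hK0 => ?_, ?_, fun K hK hK0 => ?_⟩
  · obtain ⟨r₁, hr₁, hsub⟩ := hcpt K hK hK0
    exact (hunif r₁ hr₁).mono hsub
  · have h := hRlim.rpow_const (p := θ) (Or.inr hθpos.le)
    rw [← rpow_mul hpos.le, one_div_mul_cancel hθpos.ne', rpow_one] at h
    exact h.congr fun ρ => (hlam ρ).symm
  · obtain ⟨r₁, hr₁, hsub⟩ := hcpt K hK hK0
    have hRs : 0 < lamstar ^ (1 / θ) := rpow_pos_of_pos hpos _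
    have hu := Metric.tendstoUniformlyOn_iff.1
      (hunif (lamstar ^ (1 / θ) / 2 * r₁) (by positivity))
    refine Metric.tendstoUniformlyOn_iff.2 fun η hη => ?_
    filter_upwards [eventually_gt_atTop 0, hRlim.eventually (lt_mem_nhds (half_lt_self hRs)),
      hu (η / 2) (by positivity),
      Metric.tendsto_nhds.1 hlogR (η / 2 / θ) (by positivity)] with ρ hρ h1 h2 h3 r hr
    have hrr : r₁ ≤ r := hsub hr
    have hr0 : 0 < r := hr₁.trans_le hrr
    have hR0 := (hR ρ hρ).1
    rw [hlam, ← rpow_mul hR0.le, mul_one_div_cancel hθpos.ne', rpow_one]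
    have h4 := h2 (R ρ * r) (mul_le_mul h1.le hrr hr₁.le hR0.le)
    have h5 : dist (ustar (lamstar ^ (1 / θ) * r)) (ustar (R ρ * r)) < η / 2 := by
      rw [Real.dist_eq, lt_div_iff₀ hθpos] at h3
      rw [hustar, hustar, log_mul hRs.ne' hr0.ne', log_mul hR0.ne' hr0.ne', log_rpow hpos,
        Real.dist_eq, show log lamstar - θ * (1 / θ * log lamstar + log r) -
          (log lamstar - θ * (log (R ρ) + log r)) = (log (R ρ) - log lamstar / θ) * θ by
          field_simp; ring, abs_mul, abs_of_pos hθpos]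
      exact h3
    linarith [dist_triangle (ustar (lamstar ^ (1 / θ) * r)) (ustar (R ρ * r)) (u ρ (R ρ * r))]
end

section
/- Assume (A1)–(A6). Then there exist T > 0 and a C² function η : [T,∞) → ℝ with η(t) = O(g''(θt)) and η'(t) = O(g''(θt)) as t → +∞ such that the function v*(t) = g(θ t + φ₁(t) + φ₂(t)) + η(t) is strictly increasing and solves the equation v'' − (α/(β+1) − 1) v' = − e^{−θ t + f(v)} / |v'|^β on [T,∞), where φ₁(t) = ln( θ^β ( g'(θt) + (β+1) g''(θt) ln g'(θt) )^β ) and φ₂(t) = ln( θ (α/(β+1) − 1) ) + ln( g'(θt) + (β+1) g''(θt) ln g'(θt) ). -/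
open Filter Set Asymptotics Real

/-- The solution of `u' = l u + F` that stays bounded at `+∞` when `0 < l.re` and `F` is bounded. -/
noncomputable def boundedPrimitive (l : ℂ) (F : ℝ → ℂ) (t : ℝ) : ℂ :=
  -∫ s in Ioi t, Complex.exp (l * (t - s)) * F s

lemma norm_exp_mul_sub (l : ℂ) (t s : ℝ) :
    ‖Complex.exp (l * ((t : ℂ) - s))‖ = Real.exp (l.re * (t - s)) := by
  rw [Complex.norm_exp]
  congr 1
  simp [Complex.mul_re]

lemma integral_exp_weight {k M t : ℝ} (hk : 0 < k) :
    MeasureTheory.IntegrableOn (fun s => M * Real.exp (-k * (s - t))) (Ioi t) ∧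
      ∫ s in Ioi t, M * Real.exp (-k * (s - t)) = M / k := by
  have h1 : (fun s => M * Real.exp (-k * (s - t))) =
      fun s => (M * Real.exp (k * t)) * Real.exp (-k * s) := by
    funext s
    rw [mul_assoc, ← Real.exp_add]
    ring_nf
  rw [h1]
  constructor
  · exact (integrableOn_exp_mul_Ioi (by linarith) t).const_mul _
  · rw [MeasureTheory.integral_const_mul, integral_exp_mul_Ioi (by linarith)]
    have : Real.exp (k * t) * Real.exp (-k * t) = 1 := by
      rw [← Real.exp_add]; simp
    rw [mul_div_assoc', mul_neg, mul_assoc M, this]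
    field_simp

lemma weighted_bound {l : ℂ} {F : ℝ → ℂ} {k ε M t : ℝ} (hkε : k + ε ≤ l.re)
    (hF : ∀ s, t ≤ s → ‖F s‖ ≤ M * Real.exp (ε * (s - t))) (s : ℝ) (hs : t ≤ s) :
    ‖Complex.exp (l * ((t : ℂ) - s)) * F s‖ ≤ M * Real.exp (-k * (s - t)) := by
  rw [norm_mul, norm_exp_mul_sub]
  have hM : 0 ≤ M := by
    have := (norm_nonneg _).trans (hF t le_rfl)
    simpa using this
  calc Real.exp (l.re * (t - s)) * ‖F s‖
      ≤ Real.exp (l.re * (t - s)) * (M * Real.exp (ε * (s - t))) := by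
        gcongr; exact hF s hs
    _ = M * Real.exp (l.re * (t - s) + ε * (s - t)) := by rw [Real.exp_add]; ring
    _ ≤ M * Real.exp (-k * (s - t)) := by
        gcongr
        nlinarith

lemma integrableOn_boundedPrimitive {l : ℂ} {F : ℝ → ℂ} {k ε M t : ℝ} (hk : 0 < k)
    (hkε : k + ε ≤ l.re) (hc : Continuous F)
    (hF : ∀ s, t ≤ s → ‖F s‖ ≤ M * Real.exp (ε * (s - t))) :
    MeasureTheory.IntegrableOn (fun s : ℝ => Complex.exp (l * ((t : ℂ) - s)) * F s) (Ioi t) := by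
  refine MeasureTheory.Integrable.mono' (integral_exp_weight (M := M) (t := t) hk).1 ?_ ?_
  · exact Continuous.aestronglyMeasurable (by fun_prop)
  · refine (MeasureTheory.ae_restrict_iff' measurableSet_Ioi).2 (MeasureTheory.ae_of_all _ fun s hs => ?_)
    exact weighted_bound hkε hF s (le_of_lt hs)

lemma norm_boundedPrimitive_le {l : ℂ} {F : ℝ → ℂ} {k ε M t : ℝ} (hk : 0 < k)
    (hkε : k + ε ≤ l.re)
    (hF : ∀ s, t ≤ s → ‖F s‖ ≤ M * Real.exp (ε * (s - t))) :
    ‖boundedPrimitive l F t‖ ≤ M / k := by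
  rw [boundedPrimitive, norm_neg, ← (integral_exp_weight (M := M) (t := t) hk).2]
  refine MeasureTheory.norm_integral_le_of_norm_le (integral_exp_weight hk).1 ?_
  refine (MeasureTheory.ae_restrict_iff' measurableSet_Ioi).2 (MeasureTheory.ae_of_all _ fun s hs => ?_)
  exact weighted_bound hkε hF s (le_of_lt hs)

lemma norm_boundedPrimitive_le_weight {l : ℂ} {F : ℝ → ℂ} {k ε M t : ℝ} (hk : 0 < k)
    (hkε : k + ε ≤ l.re)
    (hF : ∀ s, t ≤ s → ‖F s‖ ≤ M * Real.exp (ε * (s - t))) (s : ℝ) (hs : t ≤ s) :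
    ‖boundedPrimitive l F s‖ ≤ M / k * Real.exp (ε * (s - t)) := by
  have := norm_boundedPrimitive_le (M := M * Real.exp (ε * (s - t))) (t := s) hk hkε
    (F := F) fun r hr => by
      rw [mul_assoc, ← Real.exp_add]
      convert hF r (hs.trans hr) using 3
      ring
  calc _ ≤ _ := this
    _ = _ := by ring

lemma hasDerivAt_boundedPrimitive {l : ℂ} {F : ℝ → ℂ} {B : ℝ} (hl : 0 < l.re)
    (hc : Continuous F) (hF : ∀ s, ‖F s‖ ≤ B) (t : ℝ) :
    HasDerivAt (boundedPrimitive l F) (l * boundedPrimitive l F t + F t) t := by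
  have hinteg : ∀ t : ℝ, MeasureTheory.IntegrableOn
      (fun s : ℝ => Complex.exp (-l * s) * F s) (Ioi t) := fun t => by
    have := (integrableOn_boundedPrimitive (l := l) (F := F) (k := l.re) (ε := 0) (M := B) (t := t)
      hl (by simp) hc (fun s _ => by simpa using hF s)).const_mul (Complex.exp (-l * t))
    refine this.congr (MeasureTheory.ae_of_all _ fun s => ?_)
    simp only
    rw [← mul_assoc, ← Complex.exp_add]
    ring_nf
  have heq : boundedPrimitive l F = fun t : ℝ => Complex.exp (l * t) *
      ((∫ s in (0 : ℝ)..t, Complex.exp (-l * s) * F s) -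
        ∫ s in Ioi (0 : ℝ), Complex.exp (-l * s) * F s) := by
    funext t
    rw [← intervalIntegral.integral_interval_add_Ioi (hinteg 0) (hinteg t), boundedPrimitive,
      sub_add_cancel_left, mul_neg, ← MeasureTheory.integral_const_mul]
    congr 2
    funext s
    rw [← mul_assoc, ← Complex.exp_add]
    ring_nf
  have hexp : HasDerivAt (fun t : ℝ => Complex.exp (l * t)) (l * Complex.exp (l * t)) t := by
    have h1 : HasDerivAt (fun t : ℝ => l * (t : ℂ)) l t := by
      simpa using (Complex.ofRealCLM.hasDerivAt (x := t)).const_mul l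
    simpa [mul_comm] using h1.cexp
  have hcont : Continuous fun s : ℝ => Complex.exp (-l * s) * F s := by fun_prop
  have h2 := (hcont.integral_hasStrictDerivAt 0 t).hasDerivAt.sub_const
    (∫ s in Ioi (0 : ℝ), Complex.exp (-l * s) * F s)
  rw [heq]
  refine (hexp.mul h2).congr_deriv ?_
  have : Complex.exp (l * t) * Complex.exp (-l * t) = 1 := by
    rw [← Complex.exp_add]; simp
  linear_combination F t * this

lemma boundedPrimitive_sub {l : ℂ} {F G : ℝ → ℂ} {A B : ℝ} (hl : 0 < l.re)
    (hF : Continuous F) (hG : Continuous G) (hFA : ∀ s, ‖F s‖ ≤ A) (hGB : ∀ s, ‖G s‖ ≤ B) :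
    boundedPrimitive l (fun s => F s - G s) =
      fun t => boundedPrimitive l F t - boundedPrimitive l G t := by
  funext t
  have h1 := integrableOn_boundedPrimitive (l := l) (k := l.re) (ε := 0) (M := A) (t := t)
    hl (by simp) hF (fun s _ => by simpa using hFA s)
  have h2 := integrableOn_boundedPrimitive (l := l) (k := l.re) (ε := 0) (M := B) (t := t)
    hl (by simp) hG (fun s _ => by simpa using hGB s)
  simp only [boundedPrimitive]
  rw [neg_sub_neg, ← neg_sub, ← MeasureTheory.integral_sub h1 h2]
  congr 2
  funext s
  ring

lemma exists_roots_re_pos {a b : ℝ} (ha : 0 < a) (hb : 0 < b) :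
    ∃ l m : ℂ, 0 < l.re ∧ 0 < m.re ∧ l + m = a ∧ l * m = b := by
  obtain ⟨d, hd⟩ := IsAlgClosed.exists_pow_nat_eq ((a : ℂ) ^ 2 - 4 * b) (n := 2) (by norm_num)
  set l : ℂ := (a + d) / 2 with hl
  set m : ℂ := (a - d) / 2 with hm
  have hs : l + m = a := by rw [hl, hm]; ring
  have hp : l * m = b := by
    rw [hl, hm]; linear_combination -(1 / 4) * hd
  have s1 := congrArg Complex.re hs
  have s2 := congrArg Complex.im hs
  have p1 := congrArg Complex.re hp
  have p2 := congrArg Complex.im hp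
  simp only [Complex.add_re, Complex.add_im, Complex.mul_re, Complex.mul_im, Complex.ofReal_re,
    Complex.ofReal_im] at s1 s2 p1 p2
  have key : 0 < l.re ∧ 0 < m.re := by
    have hmi : m.im = -l.im := by linarith
    rw [hmi] at p1 p2
    have : l.im * (m.re - l.re) = 0 := by linarith
    rcases mul_eq_zero.1 this with h | h
    · rw [h] at p1
      have hpos : 0 < l.re * m.re := by nlinarith
      rcases pos_and_pos_or_neg_and_neg_of_mul_pos hpos with h | h
      · exact h
      · linarith [h.1, h.2]
    · constructor <;> linarith
  exact ⟨l, m, key.1, key.2, hs, hp⟩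

/-- A perturbation of the linear equation `z'' = a z' - b z` with two unstable directions has a
bounded solution, controlled by the size of the perturbation along the zero solution. -/
lemma exists_bounded_solution {a b : ℝ} (ha : 0 < a) (hb : 0 < b) :
    ∃ δ > 0, ∃ ε > 0, ∃ C : ℝ, ∀ N : ℝ → ℝ → ℝ → ℝ,
      (Continuous fun q : ℝ × ℝ × ℝ => N q.1 q.2.1 q.2.2) →
      (∀ t x y x' y', |N t x y - N t x' y'| ≤ δ * (|x - x'| + |y - y'|)) →
      (∃ B, ∀ t, |N t 0 0| ≤ B) →
      ∃ z w : ℝ → ℝ, (∀ t, HasDerivAt z (w t) t) ∧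
        (∀ t, HasDerivAt w (a * w t - b * z t + N t (z t) (w t)) t) ∧
        ∀ t ρ, (∀ s, t ≤ s → |N s 0 0| ≤ ρ * Real.exp (ε * (s - t))) →
          |z t| ≤ C * ρ ∧ |w t| ≤ C * ρ := by
  obtain ⟨l, m, hl, hm, hs, hp⟩ := exists_roots_re_pos ha hb
  set k : ℝ := min l.re m.re / 2 with hk
  have hk0 : 0 < k := by have := lt_min hl hm; positivity
  have hkl : 2 * k ≤ l.re := by rw [hk]; linarith [min_le_left l.re m.re]
  have hkm : 2 * k ≤ m.re := by rw [hk]; linarith [min_le_right l.re m.re]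
  set K : ℝ := 1 / k / k + (‖l‖ * (1 / k / k) + 1 / k) with hK
  have hK0 : 0 < K := by positivity
  let Z : (ℝ → ℝ) → ℝ → ℂ := fun n => boundedPrimitive l (boundedPrimitive m fun s => (n s : ℂ))
  let W : (ℝ → ℝ) → ℝ → ℂ := fun n t => l * Z n t + boundedPrimitive m (fun s => (n s : ℂ)) t
  have hZW : ∀ (n : ℝ → ℝ) (ε M t : ℝ), ε ≤ k →
      (∀ s, t ≤ s → |n s| ≤ M * Real.exp (ε * (s - t))) → ∀ s, t ≤ s →
      ‖Z n s‖ ≤ K * M * Real.exp (ε * (s - t)) ∧ ‖W n s‖ ≤ K * M * Real.exp (ε * (s - t)) := by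
    intro n ε M t hε hn s hts
    have hM : 0 ≤ M := by
      have := (abs_nonneg _).trans (hn t le_rfl)
      simpa using this
    have h1 := norm_boundedPrimitive_le_weight (l := m) (F := fun s => (n s : ℂ)) (k := k)
      (ε := ε) (M := M) (t := t) hk0 (by linarith) (by simpa using hn)
    have h2 := norm_boundedPrimitive_le_weight (l := l) (k := k) hk0 (by linarith) h1
    have e0 := Real.exp_pos (ε * (s - t))
    constructor
    · refine (h2 s hts).trans ?_
      have : M / k / k = (1 / k / k) * M := by ring
      rw [this]
      gcongr
      rw [hK]
      have : 0 ≤ ‖l‖ * (1 / k / k) + 1 / k := by positivity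
      linarith
    · calc ‖W n s‖ ≤ ‖l‖ * ‖Z n s‖ + ‖boundedPrimitive m (fun s => (n s : ℂ)) s‖ := by
            refine (norm_add_le _ _).trans ?_
            rw [norm_mul]
        _ ≤ ‖l‖ * (M / k / k * Real.exp (ε * (s - t))) + M / k * Real.exp (ε * (s - t)) := by
            gcongr
            · exact h2 s hts
            · exact h1 s hts
        _ = (‖l‖ * (1 / k / k) + 1 / k) * M * Real.exp (ε * (s - t)) := by ring
        _ ≤ K * M * Real.exp (ε * (s - t)) := by
            gcongr
            rw [hK]
            have : 0 ≤ 1 / k / k := by positivity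
            linarith
  have hZW0 : ∀ (n : ℝ → ℝ) (M : ℝ), (∀ s, |n s| ≤ M) → ∀ s,
      ‖Z n s‖ ≤ K * M ∧ ‖W n s‖ ≤ K * M := by
    intro n M hn s
    have := hZW n 0 M s hk0.le (fun r _ => by simpa using hn r) s le_rfl
    simpa using this
  have hU : ∀ (n : ℝ → ℝ) (M : ℝ), (∀ s, |n s| ≤ M) → ∀ s,
      ‖boundedPrimitive m (fun s => (n s : ℂ)) s‖ ≤ M / k := by
    intro n M hn s
    exact norm_boundedPrimitive_le (ε := 0) hk0 (by linarith) (fun r _ => by simpa using hn r)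
  have hUd : ∀ (n : ℝ → ℝ) (M : ℝ), Continuous n → (∀ s, |n s| ≤ M) → ∀ t,
      HasDerivAt (boundedPrimitive m (fun s => (n s : ℂ)))
        (m * boundedPrimitive m (fun s => (n s : ℂ)) t + n t) t := by
    intro n M hc hn t
    exact hasDerivAt_boundedPrimitive hm (by fun_prop) (B := M) (by simpa using hn) t
  have hUc : ∀ (n : ℝ → ℝ) (M : ℝ), Continuous n → (∀ s, |n s| ≤ M) →
      Continuous (boundedPrimitive m (fun s => (n s : ℂ))) := fun n M hc hn =>
    continuous_iff_continuousAt.2 fun t => (hUd n M hc hn t).continuousAt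
  have hZd : ∀ (n : ℝ → ℝ) (M : ℝ), Continuous n → (∀ s, |n s| ≤ M) → ∀ t,
      HasDerivAt (Z n) (W n t) t := by
    intro n M hc hn t
    exact hasDerivAt_boundedPrimitive hl (hUc n M hc hn) (hU n M hn) t
  have hWd : ∀ (n : ℝ → ℝ) (M : ℝ), Continuous n → (∀ s, |n s| ≤ M) → ∀ t,
      HasDerivAt (W n) (a * W n t - b * Z n t + n t) t := by
    intro n M hc hn t
    refine (((hZd n M hc hn t).const_mul l).add (hUd n M hc hn t)).congr_deriv ?_
    simp only [W]
    linear_combination (l * Z n t + boundedPrimitive m (fun s => (n s : ℂ)) t) * hs - Z n t * hp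
  have hsub : ∀ (n n' : ℝ → ℝ) (M M' : ℝ), Continuous n → Continuous n' → (∀ s, |n s| ≤ M) →
      (∀ s, |n' s| ≤ M') → ∀ t, Z (fun s => n s - n' s) t = Z n t - Z n' t ∧
        W (fun s => n s - n' s) t = W n t - W n' t := by
    intro n n' M M' hc hc' hn hn' t
    have h1 : boundedPrimitive m (fun s => ((n s - n' s : ℝ) : ℂ)) = fun t =>
        boundedPrimitive m (fun s => (n s : ℂ)) t - boundedPrimitive m (fun s => (n' s : ℂ)) t := by
      rw [← boundedPrimitive_sub hm (A := M) (B := M') (by fun_prop) (by fun_prop)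
        (by simpa using hn) (by simpa using hn')]
      congr 1
      funext s
      push_cast
      rfl
    have h2 : Z (fun s => n s - n' s) t = Z n t - Z n' t := by
      simp only [Z]
      rw [h1, boundedPrimitive_sub hl (hUc n M hc hn) (hUc n' M' hc' hn') (hU n M hn)
        (hU n' M' hn')]
    refine ⟨h2, ?_⟩
    simp only [W]
    rw [h2, h1]
    ring
  refine ⟨1 / (4 * K), by positivity, k, hk0, K * 2, ?_⟩
  intro N hN hlip ⟨B, hB⟩
  have hlip0 : ∀ t x y, |N t x y| ≤ |N t 0 0| + 1 / (4 * K) * (|x| + |y|) := by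
    intro t x y
    have h1 := hlip t x y 0 0
    have h2 := abs_add_le (N t x y - N t 0 0) (N t 0 0)
    simp only [sub_add_cancel, sub_zero] at h1 h2
    linarith
  have hstep : ∀ (M x y x' y' : ℝ), |x - x'| ≤ K * M → |y - y'| ≤ K * M →
      1 / (4 * K) * (|x - x'| + |y - y'|) ≤ M / 2 := by
    intro M x y x' y' h1 h2
    calc 1 / (4 * K) * (|x - x'| + |y - y'|) ≤ 1 / (4 * K) * (K * M + K * M) := by gcongr
      _ = M / 2 := by field_simp; ring
  have hbd : ∀ n : BoundedContinuousFunction ℝ ℝ, ∀ s, |n s| ≤ ‖n‖ := fun n s => by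
    simpa using n.norm_coe_le_norm s
  have hcontZ : ∀ n : BoundedContinuousFunction ℝ ℝ, Continuous (Z n) := fun n =>
    continuous_iff_continuousAt.2 fun t => (hZd n _ n.continuous (hbd n) t).continuousAt
  have hcontW : ∀ n : BoundedContinuousFunction ℝ ℝ, Continuous (W n) := fun n =>
    continuous_iff_continuousAt.2 fun t => (hWd n _ n.continuous (hbd n) t).continuousAt
  let Φ : BoundedContinuousFunction ℝ ℝ → BoundedContinuousFunction ℝ ℝ := fun n =>
    BoundedContinuousFunction.ofNormedAddCommGroup (fun t => N t (Z n t).re (W n t).re)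
      (hN.comp (continuous_id.prodMk ((Complex.continuous_re.comp (hcontZ n)).prodMk
        (Complex.continuous_re.comp (hcontW n))))) (B + 1 / (4 * K) * (K * ‖n‖ + K * ‖n‖)) (by
        intro t
        refine (hlip0 t _ _).trans ?_
        have := hZW0 n ‖n‖ (hbd n) t
        gcongr
        · exact hB t
        · exact (Complex.abs_re_le_norm _).trans this.1
        · exact (Complex.abs_re_le_norm _).trans this.2)
  have hΦ : ∀ n t, Φ n t = N t (Z n t).re (W n t).re := fun n t => rfl
  have hcontr : ContractingWith (1 / 2) Φ := by
    refine ⟨by rw [← NNReal.coe_lt_coe]; norm_num, LipschitzWith.of_dist_le_mul fun n n' => ?_⟩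
    rw [BoundedContinuousFunction.dist_le (by positivity)]
    intro t
    rw [hΦ, hΦ, Real.dist_eq]
    refine (hlip t _ _ _ _).trans ?_
    have h1 := hZW0 (fun s => n s - n' s) (dist n n') (fun s => by
      rw [← Real.dist_eq]; exact BoundedContinuousFunction.dist_coe_le_dist s) t
    obtain ⟨e1, e2⟩ := hsub n n' _ _ n.continuous n'.continuous (hbd n) (hbd n') t
    rw [e1, e2] at h1
    have h2 := (Complex.abs_re_le_norm _).trans h1.1
    have h3 := (Complex.abs_re_le_norm _).trans h1.2
    rw [Complex.sub_re] at h2 h3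
    refine (hstep _ _ _ _ _ h2 h3).trans (le_of_eq ?_)
    push_cast
    ring
  set n := hcontr.fixedPoint with hn
  have hfix : ∀ t, n t = N t (Z n t).re (W n t).re := fun t => by
    have h : Φ n = n := hcontr.fixedPoint_isFixedPt
    rw [← hΦ, h]
  have hre : ∀ {u : ℝ → ℂ} {u' : ℂ} {t : ℝ}, HasDerivAt u u' t →
      HasDerivAt (fun t => (u t).re) u'.re t := fun h => by
    exact Complex.reCLM.hasFDerivAt.comp_hasDerivAt _ h
  refine ⟨fun t => (Z n t).re, fun t => (W n t).re,
    fun t => hre (hZd n _ n.continuous (hbd n) t), fun t => ?_, fun t ρ hρ => ?_⟩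
  · refine (hre (hWd n _ n.continuous (hbd n) t)).congr_deriv ?_
    rw [← hfix]
    simp [Complex.mul_re]
  · have hit : ∀ j : ℕ, ∀ s, t ≤ s →
        |n s| ≤ (2 * ρ + ‖n‖ * (1 / 2) ^ j) * Real.exp (k * (s - t)) := by
      have hρ0 : 0 ≤ ρ := by
        have := (abs_nonneg _).trans (hρ t le_rfl)
        simpa using this
      intro j
      induction j with
      | zero =>
        intro s hs
        refine (hbd n s).trans ?_
        have h1 : 1 ≤ Real.exp (k * (s - t)) := Real.one_le_exp (by
          have := sub_nonneg.2 hs; positivity)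
        have : 0 ≤ ‖n‖ := norm_nonneg n
        nlinarith [mul_nonneg hρ0 (zero_le_one.trans h1)]
      | succ j ih =>
        intro s hs
        set M := 2 * ρ + ‖n‖ * (1 / 2) ^ j with hM
        rw [hfix]
        refine (hlip0 s _ _).trans ?_
        have h1 := hZW n k M t le_rfl ih s hs
        have h2 := hstep (M * Real.exp (k * (s - t))) (Z n s).re (W n s).re 0 0
          (by rw [sub_zero, ← mul_assoc]; exact (Complex.abs_re_le_norm _).trans h1.1)
          (by rw [sub_zero, ← mul_assoc]; exact (Complex.abs_re_le_norm _).trans h1.2)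
        rw [sub_zero, sub_zero] at h2
        calc _ ≤ ρ * Real.exp (k * (s - t)) + M * Real.exp (k * (s - t)) / 2 :=
              add_le_add (hρ s hs) h2
          _ = _ := by rw [hM, pow_succ]; ring
    have hlim : ∀ s, t ≤ s → |n s| ≤ 2 * ρ * Real.exp (k * (s - t)) := by
      intro s hs
      have h1 : Tendsto (fun j : ℕ => (2 * ρ + ‖n‖ * (1 / 2 : ℝ) ^ j) * Real.exp (k * (s - t)))
          atTop (nhds ((2 * ρ + ‖n‖ * 0) * Real.exp (k * (s - t)))) :=
        (((tendsto_pow_atTop_nhds_zero_of_lt_one (by norm_num) (by norm_num)).const_mul _).const_add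
          _).mul_const _
      have := ge_of_tendsto' h1 fun j => hit j s hs
      simpa using this
    have h1 := hZW n k (2 * ρ) t le_rfl hlim t le_rfl
    simp only [sub_self, mul_zero, Real.exp_zero, mul_one] at h1
    rw [← mul_assoc] at h1
    exact ⟨(Complex.abs_re_le_norm _).trans h1.1, (Complex.abs_re_le_norm _).trans h1.2⟩

lemma exists_lipschitz_of_deriv_tendsto_zero {L p : ℝ → ℝ} {a : ℝ}
    (hL : ∀ y, a < y → HasDerivAt L (p y) y) (hp : Tendsto p atTop (nhds 0)) {ε : ℝ}
    (hε : 0 < ε) : ∃ Y, ∀ y, Y ≤ y → ∀ y', Y ≤ y' → |L y - L y'| ≤ ε * |y - y'| := by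
  have h1 : ∀ᶠ y in atTop, |p y| ≤ ε := by
    filter_upwards [hp.eventually (Metric.closedBall_mem_nhds 0 hε)] with y hy
    simpa using hy
  obtain ⟨Y, hY⟩ := eventually_atTop.1 (h1.and (eventually_gt_atTop a))
  refine ⟨Y, fun y hy y' hy' => ?_⟩
  exact Convex.norm_image_sub_le_of_norm_hasDerivWithin_le (s := Ici Y)
    (fun x hx => (hL x (hY x hx).2).hasDerivWithinAt) (fun x hx => (hY x hx).1) (convex_Ici Y) hy' hy

/-- The right-hand side of the second order equation for the deviation `z` from `θ t + φ t`. -/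
noncomputable def deviationRHS (κ θ β : ℝ) (L p φ φ₁ φ₂ : ℝ → ℝ) (t x y : ℝ) : ℝ :=
  κ * (θ + φ₁ t + y) - p (θ * t + φ t + x) * (θ + φ₁ t + y) ^ 2 -
    Real.exp (φ t + x - (β + 1) * L (θ * t + φ t + x)) * (θ + φ₁ t + y) ^ (-β) - φ₂ t

lemma abs_clamp_sub_clamp_le (R x y : ℝ) :
    |max (-R) (min x R) - max (-R) (min y R)| ≤ |x - y| := by
  refine (abs_max_sub_max_le_max _ _ _ _).trans ?_
  rw [sub_self, abs_zero, max_eq_right (abs_nonneg _)]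
  refine (abs_min_sub_min_le_max _ _ _ _).trans ?_
  rw [sub_self, abs_zero, max_eq_left (abs_nonneg _)]

lemma abs_clamp_le {R : ℝ} (hR : 0 ≤ R) (x : ℝ) : |max (-R) (min x R)| ≤ R :=
  abs_le.2 ⟨le_max_left _ _, max_le (by linarith) (min_le_right _ _)⟩

lemma clamp_eq_self {R x : ℝ} (hx : |x| ≤ R) : max (-R) (min x R) = x := by
  rw [min_eq_left (abs_le.1 hx).2, max_eq_right (abs_le.1 hx).1]

lemma exists_deviation {κ θ β a b : ℝ} (hκ : 0 < κ) (hθ : 0 < θ) (hβ : 0 ≤ β)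
    {L p p₁ φ φ₁ φ₂ r : ℝ → ℝ}
    (hL : ∀ y, a < y → HasDerivAt L (p y) y) (hp : ∀ y, a < y → HasDerivAt p (p₁ y) y)
    (hp0 : Tendsto p atTop (nhds 0)) (hp1 : Tendsto p₁ atTop (nhds 0))
    (hφ : ∀ t, b < t → HasDerivAt φ (φ₁ t) t) (hφ1 : ∀ t, b < t → HasDerivAt φ₁ (φ₂ t) t)
    (hφ2 : ContinuousOn φ₂ (Ioi b)) (hφ10 : Tendsto φ₁ atTop (nhds 0))
    (hY : Tendsto (fun t => θ * t + φ t) atTop atTop)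
    (hE : Tendsto (fun t => Real.exp (φ t - (β + 1) * L (θ * t + φ t))) atTop
      (nhds (κ * θ ^ β * θ)))
    (hres : (fun t => deviationRHS κ θ β L p φ φ₁ φ₂ t 0 0) =O[atTop] r)
    (hr : Tendsto r atTop (nhds 0))
    (hrm : ∀ ε > 0, ∃ C : ℝ, ∀ᶠ t in atTop, ∀ s, t ≤ s →
      |r s| ≤ C * |r t| * Real.exp (ε * (s - t))) :
    ∃ z w : ℝ → ℝ, (∀ᶠ t in atTop, HasDerivAt z (w t) t ∧
        HasDerivAt w (deviationRHS κ θ β L p φ φ₁ φ₂ t (z t) (w t)) t) ∧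
      z =O[atTop] r ∧ w =O[atTop] r := by
  obtain ⟨δ, hδ, ε, hε, C, hsol⟩ := exists_bounded_solution (a := κ * (1 + β)) (b := κ * θ)
    (by positivity) (by positivity)
  set F : Filter (ℝ × ℝ × ℝ) := atTop ×ˢ nhds ((0 : ℝ), (0 : ℝ)) with hF
  have ft : Tendsto (fun q : ℝ × ℝ × ℝ => q.1) F atTop := tendsto_fst
  have fx : Tendsto (fun q : ℝ × ℝ × ℝ => q.2.1) F (nhds 0) :=
    (continuous_fst.tendsto ((0 : ℝ), (0 : ℝ))).comp tendsto_snd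
  have fy : Tendsto (fun q : ℝ × ℝ × ℝ => q.2.2) F (nhds 0) :=
    (continuous_snd.tendsto ((0 : ℝ), (0 : ℝ))).comp tendsto_snd
  have fY0 : Tendsto (fun q : ℝ × ℝ × ℝ => θ * q.1 + φ q.1) F atTop := hY.comp ft
  have fY : Tendsto (fun q : ℝ × ℝ × ℝ => θ * q.1 + φ q.1 + q.2.1) F atTop :=
    fY0.atTop_add fx
  have fD : Tendsto (fun q : ℝ × ℝ × ℝ => θ + φ₁ q.1 + q.2.2) F (nhds θ) := by
    simpa using ((hφ10.comp ft).const_add θ).add fy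
  have fp : Tendsto (fun q : ℝ × ℝ × ℝ => p (θ * q.1 + φ q.1 + q.2.1)) F (nhds 0) :=
    hp0.comp fY
  have fp1 : Tendsto (fun q : ℝ × ℝ × ℝ => p₁ (θ * q.1 + φ q.1 + q.2.1)) F (nhds 0) :=
    hp1.comp fY
  have fE : Tendsto (fun q : ℝ × ℝ × ℝ => Real.exp (φ q.1 + q.2.1 -
      (β + 1) * L (θ * q.1 + φ q.1 + q.2.1))) F (nhds (κ * θ ^ β * θ)) := by
    obtain ⟨Y, hYL⟩ := exists_lipschitz_of_deriv_tendsto_zero hL hp0 one_pos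
    have h1 : Tendsto (fun q : ℝ × ℝ × ℝ =>
        L (θ * q.1 + φ q.1 + q.2.1) - L (θ * q.1 + φ q.1)) F (nhds 0) := by
      refine squeeze_zero_norm' ?_ (by simpa using fx.abs)
      filter_upwards [fY0.eventually_ge_atTop Y, fY.eventually_ge_atTop Y] with q h0 h1
      simpa using hYL _ h1 _ h0
    have h2 := ((fx.sub (h1.const_mul (β + 1))).rexp).mul (hE.comp ft)
    simp only [mul_zero, sub_zero, Real.exp_zero, one_mul] at h2
    refine h2.congr fun q => ?_
    simp only [Function.comp]
    rw [← Real.exp_add]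
    ring_nf
  have hθβ : θ ^ β * θ ^ (-β) = 1 := by
    rw [← Real.rpow_add hθ]; simp
  have hθβ' : θ ^ β * θ * θ ^ (-β - 1) = 1 := by
    rw [← Real.rpow_add_one hθ.ne', ← Real.rpow_add hθ]; simp
  have fpow : ∀ c : ℝ, Tendsto (fun q : ℝ × ℝ × ℝ => (θ + φ₁ q.1 + q.2.2) ^ c) F (nhds (θ ^ c)) :=
    fun c => fD.rpow_const (Or.inl hθ.ne')
  let Dx : ℝ × ℝ × ℝ → ℝ := fun q =>
    -(p₁ (θ * q.1 + φ q.1 + q.2.1) * (θ + φ₁ q.1 + q.2.2) ^ 2) -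
    Real.exp (φ q.1 + q.2.1 - (β + 1) * L (θ * q.1 + φ q.1 + q.2.1)) *
      (1 - (β + 1) * p (θ * q.1 + φ q.1 + q.2.1)) * (θ + φ₁ q.1 + q.2.2) ^ (-β) + κ * θ
  let Dy : ℝ × ℝ × ℝ → ℝ := fun q =>
    κ - p (θ * q.1 + φ q.1 + q.2.1) * (2 * (θ + φ₁ q.1 + q.2.2)) -
    Real.exp (φ q.1 + q.2.1 - (β + 1) * L (θ * q.1 + φ q.1 + q.2.1)) *
      (-β * (θ + φ₁ q.1 + q.2.2) ^ (-β - 1)) - κ * (1 + β)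
  have fDx : Tendsto Dx F (nhds 0) := by
    have h := (((fp1.mul (fD.pow 2)).neg.sub ((fE.mul ((fp.const_mul (β + 1)).const_sub 1)).mul
      (fpow (-β)))).add_const (κ * θ))
    convert h using 2
    linear_combination κ * θ * hθβ
  have fDy : Tendsto Dy F (nhds 0) := by
    have h := ((((fp.mul (fD.const_mul 2)).const_sub κ).sub
      (fE.mul ((fpow (-β - 1)).const_mul (-β)))).sub_const (κ * (1 + β)))
    convert h using 2
    linear_combination -κ * β * hθβ'
  have hres0 : Tendsto (fun t => deviationRHS κ θ β L p φ φ₁ φ₂ t 0 0) atTop (nhds 0) :=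
    hres.trans_tendsto hr
  have hev : ∀ᶠ q in F, b < q.1 ∧ a < θ * q.1 + φ q.1 + q.2.1 ∧ 0 < θ + φ₁ q.1 + q.2.2 ∧
      |Dx q| ≤ δ ∧ |Dy q| ≤ δ ∧ |deviationRHS κ θ β L p φ φ₁ φ₂ q.1 0 0| ≤ 1 := by
    filter_upwards [ft.eventually_gt_atTop b, fY.eventually_gt_atTop a,
      fD.eventually_const_lt hθ, fDx.eventually (Metric.closedBall_mem_nhds 0 hδ),
      fDy.eventually (Metric.closedBall_mem_nhds 0 hδ),
      (hres0.comp ft).eventually (Metric.closedBall_mem_nhds 0 one_pos)] with q h1 h2 h3 h4 h5 h6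
    exact ⟨h1, h2, h3, by simpa using h4, by simpa using h5, by simpa using h6⟩
  obtain ⟨P, hP, Q, hQ, hPQ⟩ := eventually_prod_iff.1 hev
  obtain ⟨T₀, hT₀⟩ := eventually_atTop.1 hP
  obtain ⟨R, hR, hQR⟩ := Metric.nhds_basis_closedBall.eventually_iff.1 hQ
  have hbox : ∀ t x y, T₀ ≤ t → |x| ≤ R → |y| ≤ R →
      b < t ∧ a < θ * t + φ t + x ∧ 0 < θ + φ₁ t + y ∧ |Dx (t, x, y)| ≤ δ ∧ |Dy (t, x, y)| ≤ δ ∧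
      |deviationRHS κ θ β L p φ φ₁ φ₂ t 0 0| ≤ 1 := by
    intro t x y ht hx hy
    refine hPQ (x := t) (hT₀ t ht) (y := (x, y)) (hQR ?_)
    rw [Metric.mem_closedBall, Prod.dist_eq]
    simpa using ⟨hx, hy⟩
  let M : ℝ → ℝ → ℝ → ℝ := fun t x y =>
    deviationRHS κ θ β L p φ φ₁ φ₂ t x y - κ * (1 + β) * y + κ * θ * x
  have hMx : ∀ t x y, T₀ ≤ t → |x| ≤ R → |y| ≤ R →
      HasDerivAt (fun x => M t x y) (Dx (t, x, y)) x := by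
    intro t x y ht hx hy
    obtain ⟨-, h2, h3, -⟩ := hbox t x y ht hx hy
    have e1 : HasDerivAt (fun x => θ * t + φ t + x) 1 x := (hasDerivAt_id x).const_add _
    have e2 : HasDerivAt (fun x => p (θ * t + φ t + x)) (p₁ (θ * t + φ t + x) * 1) x :=
      (hp _ h2).comp x e1
    have e3 : HasDerivAt (fun x => L (θ * t + φ t + x)) (p (θ * t + φ t + x) * 1) x :=
      (hL _ h2).comp x e1
    have e4 := (((hasDerivAt_id x).const_add (φ t)).sub (e3.const_mul (β + 1))).exp
    have e5 := (((((e2.mul_const ((θ + φ₁ t + y) ^ 2)).const_sub (κ * (θ + φ₁ t + y))).sub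
      (e4.mul_const ((θ + φ₁ t + y) ^ (-β)))).sub_const (φ₂ t)).sub_const (κ * (1 + β) * y)).add
      ((hasDerivAt_id x).const_mul (κ * θ))
    refine e5.congr_deriv ?_
    simp only [Dx, id]
    simp
  have hMy : ∀ t x y, T₀ ≤ t → |x| ≤ R → |y| ≤ R →
      HasDerivAt (fun y => M t x y) (Dy (t, x, y)) y := by
    intro t x y ht hx hy
    obtain ⟨-, h2, h3, -⟩ := hbox t x y ht hx hy
    have e1 : HasDerivAt (fun y => θ + φ₁ t + y) 1 y := (hasDerivAt_id y).const_add _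
    have e2 := (e1.rpow_const (p := -β) (Or.inl h3.ne')).const_mul
      (Real.exp (φ t + x - (β + 1) * L (θ * t + φ t + x)))
    have e5 := (((((e1.const_mul κ).sub ((e1.pow 2).const_mul (p (θ * t + φ t + x)))).sub
      e2).sub_const (φ₂ t)).sub ((hasDerivAt_id y).const_mul (κ * (1 + β)))).add_const (κ * θ * x)
    refine e5.congr_deriv ?_
    simp only [Dy]
    simp
  have hconv : Convex ℝ (Icc (-R) R) := convex_Icc _ _
  have hMlip : ∀ t x y x' y', T₀ ≤ t → |x| ≤ R → |y| ≤ R → |x'| ≤ R → |y'| ≤ R →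
      |M t x y - M t x' y'| ≤ δ * (|x - x'| + |y - y'|) := by
    intro t x y x' y' ht hx hy hx' hy'
    have h1 : |M t x y - M t x' y| ≤ δ * |x - x'| :=
      Convex.norm_image_sub_le_of_norm_hasDerivWithin_le (s := Icc (-R) R)
        (f := fun x => M t x y) (f' := fun x => Dx (t, x, y))
        (fun u hu => (hMx t u y ht (abs_le.2 hu) hy).hasDerivWithinAt)
        (fun u hu => (hbox t u y ht (abs_le.2 hu) hy).2.2.2.1) hconv (abs_le.1 hx') (abs_le.1 hx)
    have h2 : |M t x' y - M t x' y'| ≤ δ * |y - y'| :=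
      Convex.norm_image_sub_le_of_norm_hasDerivWithin_le (s := Icc (-R) R)
        (f := fun y => M t x' y) (f' := fun y => Dy (t, x', y))
        (fun u hu => (hMy t x' u ht hx' (abs_le.2 hu)).hasDerivWithinAt)
        (fun u hu => (hbox t x' u ht hx' (abs_le.2 hu)).2.2.2.2.1) hconv (abs_le.1 hy')
        (abs_le.1 hy)
    have h3 := abs_sub_le (M t x y) (M t x' y) (M t x' y')
    linarith
  let N : ℝ → ℝ → ℝ → ℝ := fun t x y => M (max t T₀) (max (-R) (min x R)) (max (-R) (min y R))
  have hN0 : ∀ t, T₀ ≤ t → N t 0 0 = deviationRHS κ θ β L p φ φ₁ φ₂ t 0 0 := by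
    intro t ht
    simp only [N, M]
    rw [clamp_eq_self (by simpa using hR.le), max_eq_left ht]
    simp
  have hNc : Continuous fun q : ℝ × ℝ × ℝ => N q.1 q.2.1 q.2.2 := by
    rw [continuous_iff_continuousAt]
    intro q
    obtain ⟨h1, h2, h3, -⟩ := hbox (max q.1 T₀) (max (-R) (min q.2.1 R)) (max (-R) (min q.2.2 R))
      (le_max_right _ _) (abs_clamp_le hR.le _) (abs_clamp_le hR.le _)
    have ct : ContinuousAt (fun q : ℝ × ℝ × ℝ => max q.1 T₀) q := by fun_prop
    have cx : ContinuousAt (fun q : ℝ × ℝ × ℝ => max (-R) (min q.2.1 R)) q := by fun_prop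
    have cy : ContinuousAt (fun q : ℝ × ℝ × ℝ => max (-R) (min q.2.2 R)) q := by fun_prop
    have c0 : ContinuousAt (fun q : ℝ × ℝ × ℝ => φ (max q.1 T₀)) q :=
      ContinuousAt.comp (g := φ) (hφ _ h1).continuousAt ct
    have c1 : ContinuousAt (fun q : ℝ × ℝ × ℝ => φ₁ (max q.1 T₀)) q :=
      ContinuousAt.comp (g := φ₁) (hφ1 _ h1).continuousAt ct
    have c2 : ContinuousAt (fun q : ℝ × ℝ × ℝ => φ₂ (max q.1 T₀)) q :=
      ContinuousAt.comp (g := φ₂) (hφ2.continuousAt (Ioi_mem_nhds h1)) ct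
    have cY : ContinuousAt (fun q : ℝ × ℝ × ℝ => θ * max q.1 T₀ + φ (max q.1 T₀) +
      max (-R) (min q.2.1 R)) q := ((ct.const_mul θ).add c0).add cx
    have cp := (hp _ h2).continuousAt.comp_of_eq cY rfl
    have cL := (hL _ h2).continuousAt.comp_of_eq cY rfl
    have cD : ContinuousAt (fun q : ℝ × ℝ × ℝ => θ + φ₁ (max q.1 T₀) +
      max (-R) (min q.2.2 R)) q := (c1.const_add θ).add cy
    exact (((((cD.const_mul κ).sub (cp.mul (cD.pow 2))).sub
      (((c0.add cx).sub (cL.const_mul (β + 1))).rexp.mul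
        (cD.rpow_const (Or.inl h3.ne')))).sub c2).sub (cy.const_mul (κ * (1 + β)))).add
      (cx.const_mul (κ * θ))
  have hNlip : ∀ t x y x' y', |N t x y - N t x' y'| ≤ δ * (|x - x'| + |y - y'|) := by
    intro t x y x' y'
    refine (hMlip _ _ _ _ _ (le_max_right _ _) (abs_clamp_le hR.le _) (abs_clamp_le hR.le _)
      (abs_clamp_le hR.le _) (abs_clamp_le hR.le _)).trans ?_
    exact mul_le_mul_of_nonneg_left
      (add_le_add (abs_clamp_sub_clamp_le _ _ _) (abs_clamp_sub_clamp_le _ _ _)) hδ.le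
  have hNB : ∀ t, |N t 0 0| ≤ 1 := by
    intro t
    have : N t 0 0 = N (max t T₀) 0 0 := by simp only [N]; rw [max_assoc, max_self]
    rw [this, hN0 _ (le_max_right _ _)]
    exact (hbox _ 0 0 (le_max_right _ _) (by simpa using hR.le) (by simpa using hR.le)).2.2.2.2.2
  obtain ⟨z, w, hz, hw, hzw⟩ := hsol N hNc hNlip ⟨1, hNB⟩
  obtain ⟨C₁, hC₁, hresC⟩ := hres.exists_pos
  obtain ⟨T₁, hT₁⟩ := eventually_atTop.1 hresC.bound
  obtain ⟨C₂, hC₂⟩ := hrm ε hε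
  have hbound : ∀ᶠ t in atTop, |z t| ≤ C * (C₁ * C₂) * |r t| ∧ |w t| ≤ C * (C₁ * C₂) * |r t| := by
    filter_upwards [hC₂, eventually_ge_atTop T₀, eventually_ge_atTop T₁] with t h1 h2 h3
    have := hzw t (C₁ * C₂ * |r t|) (fun s hs => by
      rw [hN0 s (h2.trans hs)]
      calc _ ≤ C₁ * |r s| := hT₁ s (h3.trans hs)
        _ ≤ C₁ * (C₂ * |r t| * Real.exp (ε * (s - t))) := by gcongr; exact h1 s hs
        _ = _ := by ring)
    rwa [← mul_assoc] at this
  have hzO : z =O[atTop] r := IsBigO.of_bound _ (hbound.mono fun t h => h.1)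
  have hwO : w =O[atTop] r := IsBigO.of_bound _ (hbound.mono fun t h => h.2)
  refine ⟨z, w, ?_, hzO, hwO⟩
  filter_upwards [eventually_ge_atTop T₀,
    (hzO.trans_tendsto hr).eventually (Metric.closedBall_mem_nhds 0 hR),
    (hwO.trans_tendsto hr).eventually (Metric.closedBall_mem_nhds 0 hR)] with t h1 h2 h3
  refine ⟨hz t, (hw t).congr_deriv ?_⟩
  simp only [N]
  rw [clamp_eq_self (by simpa using h2), clamp_eq_self (by simpa using h3), max_eq_left h1]
  simp only [M]
  ring

lemma tendsto_add_isLittleO_atTop {h : ℝ → ℝ} (hh : h =o[atTop] fun t : ℝ => t) :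
    Tendsto (fun t => t + h t) atTop atTop := by
  refine tendsto_atTop_mono' _ ?_ (tendsto_id.atTop_div_const (zero_lt_two' ℝ))
  filter_upwards [hh.bound (one_half_pos), eventually_ge_atTop 0] with t h1 h2
  rw [Real.norm_eq_abs, Real.norm_eq_abs, abs_of_nonneg h2] at h1
  have := (abs_le.1 h1).1
  simp only [id]
  linarith

lemma exists_mean_value {f f' : ℝ → ℝ} {a x h : ℝ}
    (hf : ∀ y, a < y → HasDerivAt f (f' y) y) (hx : a < x) (hxh : a < x + h) :
    ∃ k, |k| ≤ |h| ∧ a < x + k ∧ f (x + h) - f x = f' (x + k) * h := by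
  obtain ⟨z, hz, hz'⟩ := domain_mvt (s := Ioi a)
    (f' := fun y => ContinuousLinearMap.toSpanSingleton ℝ (f' y))
    (fun y hy => (hf y hy).hasFDerivAt.hasFDerivWithinAt) (convex_Ioi a) hx hxh
  refine ⟨z - x, ?_, ?_, ?_⟩
  · rw [segment_eq_uIcc] at hz
    have := abs_sub_left_of_mem_uIcc hz
    simpa using this
  · have := (convex_Ioi a).segment_subset hx hxh hz
    simpa using this
  · rw [hz']
    simp [mul_comm]

/-- The derivatives `g₁, g₂, g₃, g₄` of a function whose first derivative varies slowly. -/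
structure SlowlyVarying (a : ℝ) (g₁ g₂ g₃ g₄ : ℝ → ℝ) : Prop where
  hasDerivAt₁ : ∀ y, a < y → HasDerivAt g₁ (g₂ y) y
  hasDerivAt₂ : ∀ y, a < y → HasDerivAt g₂ (g₃ y) y
  hasDerivAt₃ : ∀ y, a < y → HasDerivAt g₃ (g₄ y) y
  continuousOn₄ : ContinuousOn g₄ (Ioi a)
  pos : ∀ y, a < y → 0 < g₁ y
  tendsto₂ : Tendsto g₂ atTop (nhds 0)
  ratio : ∀ h : ℝ → ℝ, (h =o[atTop] fun t : ℝ => t) →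
    Tendsto (fun t => g₁ t / g₁ (t + h t)) atTop (nhds 1)
  tendsto_mul_log : Tendsto (fun t => g₂ t / g₁ t * Real.log (g₁ t)) atTop (nhds 0)
  isBigO₃ : ∀ n : ℕ, n ≤ 2 → (fun t => g₃ t * Real.log (g₁ t) ^ n) =O[atTop] g₂
  isBigO₄ : (fun t => g₄ t * Real.log (g₁ t)) =O[atTop] g₂
  almost_antitone : ∃ C : ℝ, ∀ᶠ t in atTop, ∀ s, t ≤ s → |g₂ s| ≤ C * |g₂ t|
  isBigO_shift : ∀ h : ℝ → ℝ, (h =o[atTop] fun t : ℝ => t) → (fun t => g₂ (t + h t)) =O[atTop] g₂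

namespace SlowlyVarying

variable {a : ℝ} {g₁ g₂ g₃ g₄ : ℝ → ℝ}

lemma tendsto_div (H : SlowlyVarying a g₁ g₂ g₃ g₄) :
    Tendsto (fun t => g₂ t / g₁ t) atTop (nhds 0) := by
  have h := (H.tendsto_mul_log.abs).add (H.tendsto₂.abs.mul_const (Real.exp 1))
  simp only [abs_zero, zero_mul, add_zero] at h
  refine squeeze_zero_norm' ?_ h
  filter_upwards [eventually_gt_atTop a] with t ht
  have hp := H.pos t ht
  rw [Real.norm_eq_abs]
  by_cases hl : 1 ≤ |Real.log (g₁ t)|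
  · rw [abs_mul]
    have h1 := abs_nonneg (g₂ t / g₁ t)
    have h2 : 0 ≤ |g₂ t| * Real.exp 1 := by positivity
    nlinarith
  · have h1 : Real.exp (-1) ≤ g₁ t := by
      rw [← Real.le_log_iff_exp_le hp]
      linarith [(abs_le.1 (not_le.1 hl).le).1]
    have h2 : |g₂ t / g₁ t| ≤ |g₂ t| * Real.exp 1 := by
      rw [abs_div, abs_of_pos hp, div_le_iff₀ hp, mul_assoc]
      have : 1 ≤ Real.exp 1 * g₁ t := by
        calc (1 : ℝ) = Real.exp 1 * Real.exp (-1) := by rw [← Real.exp_add]; simp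
          _ ≤ _ := by gcongr
      nlinarith [abs_nonneg (g₂ t)]
    linarith [abs_nonneg (g₂ t / g₁ t * Real.log (g₁ t))]

lemma hasDerivAt_log (H : SlowlyVarying a g₁ g₂ g₃ g₄) (y : ℝ) (hy : a < y) :
    HasDerivAt (fun y => Real.log (g₁ y)) (g₂ y / g₁ y) y :=
  (H.hasDerivAt₁ y hy).log (H.pos y hy).ne'

lemma hasDerivAt_div (H : SlowlyVarying a g₁ g₂ g₃ g₄) (y : ℝ) (hy : a < y) :
    HasDerivAt (fun y => g₂ y / g₁ y) (g₃ y / g₁ y - (g₂ y / g₁ y) ^ 2) y := by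
  have hp := (H.pos y hy).ne'
  refine ((H.hasDerivAt₂ y hy).div (H.hasDerivAt₁ y hy) hp).congr_deriv ?_
  field_simp

lemma isBigO_div {u : ℝ → ℝ} (hu : u =O[atTop] g₂) :
    (fun t => u t / g₁ t) =O[atTop] fun t => g₂ t / g₁ t := by
  simpa only [div_eq_mul_inv] using hu.mul (isBigO_refl (fun t => (g₁ t)⁻¹) atTop)

lemma isBigO₃_zero (H : SlowlyVarying a g₁ g₂ g₃ g₄) : g₃ =O[atTop] g₂ := by
  simpa using H.isBigO₃ 0 (by norm_num)

lemma tendsto_deriv_div (H : SlowlyVarying a g₁ g₂ g₃ g₄) :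
    Tendsto (fun y => g₃ y / g₁ y - (g₂ y / g₁ y) ^ 2) atTop (nhds 0) := by
  simpa using ((isBigO_div H.isBigO₃_zero).trans_tendsto H.tendsto_div).sub (H.tendsto_div.pow 2)

lemma almost_antitone_div (H : SlowlyVarying a g₁ g₂ g₃ g₄) {θ : ℝ} (hθ : 0 < θ) (ε : ℝ)
    (hε : 0 < ε) : ∃ C : ℝ, ∀ᶠ t in atTop, ∀ s, t ≤ s →
      |g₂ (θ * s) / g₁ (θ * s)| ≤ C * |g₂ (θ * t) / g₁ (θ * t)| * Real.exp (ε * (s - t)) := by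
  obtain ⟨C, hC⟩ := H.almost_antitone
  obtain ⟨Y, hY⟩ := exists_lipschitz_of_deriv_tendsto_zero H.hasDerivAt_log H.tendsto_div
    (div_pos hε hθ)
  have hθt : Tendsto (fun t : ℝ => θ * t) atTop atTop := tendsto_id.const_mul_atTop hθ
  refine ⟨C, ?_⟩
  filter_upwards [hθt.eventually hC, hθt.eventually_ge_atTop Y, hθt.eventually_gt_atTop a]
    with t h1 h2 h3 s hs
  have hs' : θ * t ≤ θ * s := by gcongr
  have h4 := h1 _ hs'
  have pt := H.pos _ h3
  have ps := H.pos _ (h3.trans_le hs')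
  have h5 := hY _ h2 _ (h2.trans hs')
  have h6 : g₁ (θ * t) ≤ g₁ (θ * s) * Real.exp (ε * (s - t)) := by
    rw [← Real.log_le_log_iff pt (by positivity), Real.log_mul ps.ne' (Real.exp_pos _).ne',
      Real.log_exp]
    have e1 : ε / θ * |θ * t - θ * s| = ε * (s - t) := by
      rw [abs_of_nonpos (by linarith)]
      field_simp
      ring
    have := (abs_le.1 h5).2
    linarith
  have h7 := (abs_nonneg _).trans h4
  rw [abs_div, abs_div, abs_of_pos pt, abs_of_pos ps, div_le_iff₀ ps]
  calc |g₂ (θ * s)| ≤ C * |g₂ (θ * t)| := h4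
    _ = C * |g₂ (θ * t)| / g₁ (θ * t) * g₁ (θ * t) := by field_simp
    _ ≤ C * |g₂ (θ * t)| / g₁ (θ * t) * (g₁ (θ * s) * Real.exp (ε * (s - t))) := by
        gcongr
    _ = _ := by ring

lemma tendsto_ratio (H : SlowlyVarying a g₁ g₂ g₃ g₄) {h : ℝ → ℝ}
    (hh : h =o[atTop] fun t : ℝ => t) :
    Tendsto (fun t => g₁ (t + h t) / g₁ t) atTop (nhds 1) := by
  simpa using (H.ratio h hh).inv₀ one_ne_zero

lemma isBigO₁_shift (H : SlowlyVarying a g₁ g₂ g₃ g₄) {h : ℝ → ℝ}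
    (hh : h =o[atTop] fun t : ℝ => t) : (fun t => g₁ (t + h t)) =O[atTop] g₁ := by
  refine ((H.tendsto_ratio hh).isBigO_one ℝ).mul (isBigO_refl g₁ atTop) |>.congr' ?_ (by simp)
  filter_upwards [eventually_gt_atTop a] with t ht
  have := (H.pos t ht).ne'
  field_simp

lemma isBigO₁_shift_rev (H : SlowlyVarying a g₁ g₂ g₃ g₄) {h : ℝ → ℝ}
    (hh : h =o[atTop] fun t : ℝ => t) : (fun t => (g₁ (t + h t))⁻¹) =O[atTop] fun t => (g₁ t)⁻¹ := by
  refine ((H.ratio h hh).isBigO_one ℝ).mul (isBigO_refl (fun t => (g₁ t)⁻¹) atTop) |>.congr' ?_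
    (by simp)
  filter_upwards [eventually_gt_atTop a] with t ht
  have := (H.pos t ht).ne'
  field_simp

lemma tendsto_log_sub_log (H : SlowlyVarying a g₁ g₂ g₃ g₄) {h : ℝ → ℝ}
    (hh : h =o[atTop] fun t : ℝ => t) :
    Tendsto (fun t => Real.log (g₁ t) - Real.log (g₁ (t + h t))) atTop (nhds 0) := by
  have h1 := (H.ratio h hh).log one_ne_zero
  rw [Real.log_one] at h1
  refine h1.congr' ?_
  filter_upwards [eventually_gt_atTop a, (tendsto_add_isLittleO_atTop hh).eventually_gt_atTop a]
    with t h2 h3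
  rw [Real.log_div (H.pos _ h2).ne' (H.pos _ h3).ne']

lemma log_isLittleO (H : SlowlyVarying a g₁ g₂ g₃ g₄) :
    (fun t => Real.log (g₁ t)) =o[atTop] fun t : ℝ => t := by
  rw [isLittleO_iff]
  intro c hc
  obtain ⟨Y, hY⟩ := exists_lipschitz_of_deriv_tendsto_zero H.hasDerivAt_log H.tendsto_div
    (half_pos hc)
  filter_upwards [eventually_ge_atTop Y, eventually_ge_atTop 0,
    (tendsto_id.const_mul_atTop (half_pos hc)).eventually_ge_atTop
      (|Real.log (g₁ Y)| - c / 2 * Y)] with t h1 h2 h3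
  have h4 := hY t h1 Y le_rfl
  rw [abs_of_nonneg (sub_nonneg.2 h1)] at h4
  rw [Real.norm_eq_abs, Real.norm_eq_abs, abs_of_nonneg h2]
  have h5 := abs_sub_abs_le_abs_sub (Real.log (g₁ t)) (Real.log (g₁ Y))
  simp only [id] at h3
  linarith

end SlowlyVarying

/-- The quantity `g₁ + c g₂ log g₁`. -/
noncomputable def amp (c : ℝ) (g₁ g₂ : ℝ → ℝ) (t : ℝ) : ℝ :=
  g₁ t + c * g₂ t * Real.log (g₁ t)

/-- The derivative of `amp`. -/
noncomputable def ampDeriv (c : ℝ) (g₁ g₂ g₃ : ℝ → ℝ) (t : ℝ) : ℝ :=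
  g₂ t + c * (g₃ t * Real.log (g₁ t) + g₂ t * (g₂ t / g₁ t))

/-- The second derivative of `amp`. -/
noncomputable def ampDeriv₂ (c : ℝ) (g₁ g₂ g₃ g₄ : ℝ → ℝ) (t : ℝ) : ℝ :=
  g₃ t + c * (g₄ t * Real.log (g₁ t) + 2 * (g₃ t * (g₂ t / g₁ t)) +
    g₂ t * (g₃ t / g₁ t - (g₂ t / g₁ t) ^ 2))

/-- The shift of the argument, `c log (amp) + d`. -/
noncomputable def shift (c d : ℝ) (g₁ g₂ : ℝ → ℝ) (t : ℝ) : ℝ :=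
  c * Real.log (amp c g₁ g₂ t) + d

/-- The derivative of `shift`. -/
noncomputable def shiftDeriv (c : ℝ) (g₁ g₂ g₃ : ℝ → ℝ) (t : ℝ) : ℝ :=
  c * (ampDeriv c g₁ g₂ g₃ t / amp c g₁ g₂ t)

/-- The second derivative of `shift`. -/
noncomputable def shiftDeriv₂ (c : ℝ) (g₁ g₂ g₃ g₄ : ℝ → ℝ) (t : ℝ) : ℝ :=
  c * (ampDeriv₂ c g₁ g₂ g₃ g₄ t / amp c g₁ g₂ t -
    (ampDeriv c g₁ g₂ g₃ t / amp c g₁ g₂ t) ^ 2)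

namespace SlowlyVarying

variable {a : ℝ} {g₁ g₂ g₃ g₄ : ℝ → ℝ}

lemma hasDerivAt_amp (H : SlowlyVarying a g₁ g₂ g₃ g₄) (c y : ℝ) (hy : a < y) :
    HasDerivAt (amp c g₁ g₂) (ampDeriv c g₁ g₂ g₃ y) y := by
  refine ((H.hasDerivAt₁ y hy).add (((H.hasDerivAt₂ y hy).const_mul c).mul
    (H.hasDerivAt_log y hy))).congr_deriv ?_
  simp only [ampDeriv]
  ring

lemma hasDerivAt_ampDeriv (H : SlowlyVarying a g₁ g₂ g₃ g₄) (c y : ℝ) (hy : a < y) :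
    HasDerivAt (ampDeriv c g₁ g₂ g₃) (ampDeriv₂ c g₁ g₂ g₃ g₄ y) y := by
  refine ((H.hasDerivAt₂ y hy).add ((((H.hasDerivAt₃ y hy).mul (H.hasDerivAt_log y hy)).add
    ((H.hasDerivAt₂ y hy).mul (H.hasDerivAt_div y hy))).const_mul c)).congr_deriv ?_
  simp only [ampDeriv₂]
  ring

lemma continuousOn_ampDeriv₂ (H : SlowlyVarying a g₁ g₂ g₃ g₄) (c : ℝ) :
    ContinuousOn (ampDeriv₂ c g₁ g₂ g₃ g₄) (Ioi a) := by
  have h1 : ContinuousOn g₁ (Ioi a) := fun y hy => (H.hasDerivAt₁ y hy).continuousAt.continuousWithinAt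
  have h2 : ContinuousOn g₂ (Ioi a) := fun y hy => (H.hasDerivAt₂ y hy).continuousAt.continuousWithinAt
  have h3 : ContinuousOn g₃ (Ioi a) := fun y hy => (H.hasDerivAt₃ y hy).continuousAt.continuousWithinAt
  have h4 := H.continuousOn₄
  have hn : ∀ y ∈ Ioi a, g₁ y ≠ 0 := fun y hy => (H.pos y hy).ne'
  unfold ampDeriv₂
  fun_prop (disch := assumption)

lemma isBigO_ampDeriv (H : SlowlyVarying a g₁ g₂ g₃ g₄) (c : ℝ) :
    ampDeriv c g₁ g₂ g₃ =O[atTop] g₂ := by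
  have h1 : (fun t => g₃ t * Real.log (g₁ t)) =O[atTop] g₂ := by
    simpa using H.isBigO₃ 1 (by norm_num)
  have h2 : (fun t => g₂ t * (g₂ t / g₁ t)) =O[atTop] g₂ := by
    simpa using (isBigO_refl g₂ atTop).mul (H.tendsto_div.isBigO_one ℝ)
  exact (isBigO_refl g₂ atTop).add ((h1.add h2).const_mul_left c)

lemma isBigO_ampDeriv₂ (H : SlowlyVarying a g₁ g₂ g₃ g₄) (c : ℝ) :
    ampDeriv₂ c g₁ g₂ g₃ g₄ =O[atTop] g₂ := by
  have h1 : (fun t => g₃ t * (g₂ t / g₁ t)) =O[atTop] g₂ := by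
    simpa using H.isBigO₃_zero.mul (H.tendsto_div.isBigO_one ℝ)
  have h2 : (fun t => g₂ t * (g₃ t / g₁ t - (g₂ t / g₁ t) ^ 2)) =O[atTop] g₂ := by
    simpa using (isBigO_refl g₂ atTop).mul (H.tendsto_deriv_div.isBigO_one ℝ)
  exact H.isBigO₃_zero.add (((H.isBigO₄.add (h1.const_mul_left 2)).add h2).const_mul_left c)

lemma tendsto_amp_div (H : SlowlyVarying a g₁ g₂ g₃ g₄) (c : ℝ) :
    Tendsto (fun t => amp c g₁ g₂ t / g₁ t) atTop (nhds 1) := by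
  have h := (H.tendsto_mul_log.const_mul c).const_add 1
  simp only [mul_zero, add_zero] at h
  refine h.congr' ?_
  filter_upwards [eventually_gt_atTop a] with t ht
  have := (H.pos t ht).ne'
  simp only [amp]
  field_simp

lemma eventually_amp_pos (H : SlowlyVarying a g₁ g₂ g₃ g₄) (c : ℝ) :
    ∀ᶠ t in atTop, 0 < amp c g₁ g₂ t := by
  filter_upwards [(H.tendsto_amp_div c).eventually_const_lt one_half_lt_one, eventually_gt_atTop a]
    with t h1 h2
  have hp := H.pos t h2
  exact (div_pos_iff_of_pos_right hp).1 (one_half_pos.trans h1)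

lemma tendsto_log_amp_sub (H : SlowlyVarying a g₁ g₂ g₃ g₄) (c : ℝ) :
    Tendsto (fun t => Real.log (amp c g₁ g₂ t) - Real.log (g₁ t)) atTop (nhds 0) := by
  have h1 := (H.tendsto_amp_div c).log one_ne_zero
  rw [Real.log_one] at h1
  refine h1.congr' ?_
  filter_upwards [H.eventually_amp_pos c, eventually_gt_atTop a] with t h2 h3
  rw [Real.log_div h2.ne' (H.pos _ h3).ne']

lemma isBigO_inv_amp (H : SlowlyVarying a g₁ g₂ g₃ g₄) (c : ℝ) :
    (fun t => (amp c g₁ g₂ t)⁻¹) =O[atTop] fun t => (g₁ t)⁻¹ := by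
  have h := ((H.tendsto_amp_div c).inv₀ one_ne_zero).isBigO_one ℝ
  refine (h.mul (isBigO_refl (fun t => (g₁ t)⁻¹) atTop)).congr' ?_ (by simp)
  filter_upwards [eventually_gt_atTop a, H.eventually_amp_pos c] with t ht h2
  have := (H.pos t ht).ne'
  field_simp

lemma isBigO_div_amp (H : SlowlyVarying a g₁ g₂ g₃ g₄) (c : ℝ) {u : ℝ → ℝ}
    (hu : u =O[atTop] g₂) :
    (fun t => u t / amp c g₁ g₂ t) =O[atTop] fun t => g₂ t / g₁ t := by
  simpa only [div_eq_mul_inv] using hu.mul (H.isBigO_inv_amp c)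

lemma isBigO_shiftDeriv (H : SlowlyVarying a g₁ g₂ g₃ g₄) (c : ℝ) :
    shiftDeriv c g₁ g₂ g₃ =O[atTop] fun t => g₂ t / g₁ t :=
  (H.isBigO_div_amp c (H.isBigO_ampDeriv c)).const_mul_left c

lemma isBigO_shiftDeriv₂ (H : SlowlyVarying a g₁ g₂ g₃ g₄) (c : ℝ) :
    shiftDeriv₂ c g₁ g₂ g₃ g₄ =O[atTop] fun t => g₂ t / g₁ t := by
  have h := H.isBigO_div_amp c (H.isBigO_ampDeriv c)
  have h2 : (fun t => (ampDeriv c g₁ g₂ g₃ t / amp c g₁ g₂ t) ^ 2) =O[atTop]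
      fun t => g₂ t / g₁ t := by
    simpa [sq] using h.mul ((h.trans_tendsto H.tendsto_div).isBigO_one ℝ)
  exact ((H.isBigO_div_amp c (H.isBigO_ampDeriv₂ c)).sub h2).const_mul_left c

lemma exists_hasDerivAt_shift (H : SlowlyVarying a g₁ g₂ g₃ g₄) (c d : ℝ) : ∃ b,
    (∀ s, b < s → HasDerivAt (shift c d g₁ g₂) (shiftDeriv c g₁ g₂ g₃ s) s) ∧
    (∀ s, b < s → HasDerivAt (shiftDeriv c g₁ g₂ g₃) (shiftDeriv₂ c g₁ g₂ g₃ g₄ s) s) ∧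
    ContinuousOn (shiftDeriv₂ c g₁ g₂ g₃ g₄) (Ioi b) := by
  obtain ⟨b, hb⟩ := eventually_atTop.1 ((H.eventually_amp_pos c).and (eventually_gt_atTop a))
  have hp : ∀ s, b < s → amp c g₁ g₂ s ≠ 0 := fun s hs => (hb s hs.le).1.ne'
  have ha : ∀ s, b < s → a < s := fun s hs => (hb s hs.le).2
  refine ⟨b, fun s hs => ?_, fun s hs => ?_, ?_⟩
  · exact (((H.hasDerivAt_amp c s (ha s hs)).log (hp s hs)).const_mul c).add_const d
  · refine (((H.hasDerivAt_ampDeriv c s (ha s hs)).div (H.hasDerivAt_amp c s (ha s hs))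
      (hp s hs)).const_mul c).congr_deriv ?_
    have := hp s hs
    simp only [shiftDeriv₂]
    field_simp
  · have h0 : ContinuousOn (amp c g₁ g₂) (Ioi b) := fun y hy =>
      (H.hasDerivAt_amp c y (ha y hy)).continuousAt.continuousWithinAt
    have h1 : ContinuousOn (ampDeriv c g₁ g₂ g₃) (Ioi b) := fun y hy =>
      (H.hasDerivAt_ampDeriv c y (ha y hy)).continuousAt.continuousWithinAt
    have h2 : ContinuousOn (ampDeriv₂ c g₁ g₂ g₃ g₄) (Ioi b) :=
      (H.continuousOn_ampDeriv₂ c).mono fun y hy => ha y hy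
    unfold shiftDeriv₂
    fun_prop (disch := assumption)

lemma isLittleO_shift (H : SlowlyVarying a g₁ g₂ g₃ g₄) (c d : ℝ) :
    shift c d g₁ g₂ =o[atTop] fun t : ℝ => t := by
  have h1 : (fun t => Real.log (amp c g₁ g₂ t) - Real.log (g₁ t)) =o[atTop] fun t : ℝ => t :=
    ((H.tendsto_log_amp_sub c).isBigO_one ℝ).trans_isLittleO
      (isLittleO_const_id_atTop (1 : ℝ))
  have h2 := (h1.add H.log_isLittleO).const_mul_left c |>.add (isLittleO_const_id_atTop d)
  refine h2.congr_left fun t => ?_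
  simp only [shift]
  ring

lemma tendsto_shift_sub (H : SlowlyVarying a g₁ g₂ g₃ g₄) (c d : ℝ) {h : ℝ → ℝ}
    (hh : h =o[atTop] fun t : ℝ => t) :
    Tendsto (fun t => shift c d g₁ g₂ t - c * Real.log (g₁ (t + h t))) atTop (nhds d) := by
  have := (((H.tendsto_log_amp_sub c).add (H.tendsto_log_sub_log hh)).const_mul c).add_const d
  simp only [add_zero, mul_zero, zero_add] at this
  refine this.congr fun t => ?_
  simp only [shift]
  ring

lemma isBigO_sub_amp (H : SlowlyVarying a g₁ g₂ g₃ g₄) (c d : ℝ) :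
    (fun t => g₁ (t + shift c d g₁ g₂ t) - amp c g₁ g₂ t) =O[atTop] g₂ := by
  have hΦ := H.isLittleO_shift c d
  have hex : ∀ᶠ t in atTop, ∃ ξ, |ξ| ≤ |shift c d g₁ g₂ t| ∧
      |g₁ (t + shift c d g₁ g₂ t) - g₁ t - g₂ t * shift c d g₁ g₂ t| ≤
        |g₃ (t + ξ) * shift c d g₁ g₂ t ^ 2| := by
    filter_upwards [eventually_gt_atTop a,
      (tendsto_add_isLittleO_atTop hΦ).eventually_gt_atTop a] with t h1 h2
    obtain ⟨k, hk, hk', hk''⟩ := exists_mean_value H.hasDerivAt₁ h1 h2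
    obtain ⟨ξ, hξ, hξ', hξ''⟩ := exists_mean_value H.hasDerivAt₂ h1 hk'
    refine ⟨ξ, hξ.trans hk, ?_⟩
    rw [hk'', ← sub_mul, hξ'', abs_mul, abs_mul, abs_mul, mul_assoc, abs_pow, sq]
    gcongr
  obtain ⟨ξ, hξ⟩ := hex.choice
  have hξo : ξ =o[atTop] fun t : ℝ => t :=
    (IsBigO.of_bound 1 (hξ.mono fun t ht => by simpa using ht.1)).trans_isLittleO hΦ
  have hξt := tendsto_add_isLittleO_atTop hξo
  have hB := (H.tendsto_shift_sub c d hξo).isBigO_one ℝ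
  have h3 : ∀ n : ℕ, n ≤ 2 →
      (fun t => g₃ (t + ξ t) * Real.log (g₁ (t + ξ t)) ^ n) =O[atTop] g₂ := fun n hn =>
    ((H.isBigO₃ n hn).comp_tendsto hξt).trans (H.isBigO_shift ξ hξo)
  have hq : (fun t => g₃ (t + ξ t) * shift c d g₁ g₂ t ^ 2) =O[atTop] g₂ := by
    have e0 := (h3 0 (by norm_num)).mul (hB.mul hB)
    have e1 := ((h3 1 (by norm_num)).mul hB).const_mul_left (2 * c)
    have e2 := (h3 2 le_rfl).const_mul_left (c ^ 2)
    simp only [mul_one] at e0 e1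
    refine ((e2.add e1).add e0).congr_left fun t => ?_
    ring
  have hl : (fun t => g₂ t * (shift c d g₁ g₂ t - c * Real.log (g₁ t))) =O[atTop] g₂ := by
    have := (H.tendsto_shift_sub c d (isLittleO_zero _ _)).isBigO_one ℝ
    simpa using (isBigO_refl g₂ atTop).mul this
  have hr : (fun t => g₁ (t + shift c d g₁ g₂ t) - g₁ t - g₂ t * shift c d g₁ g₂ t)
      =O[atTop] g₂ := by
    refine (IsBigO.of_bound 1 (hξ.mono fun t ht => ?_)).trans hq
    rw [one_mul]
    exact ht.2
  refine (hr.add hl).congr_left fun t => ?_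
  simp only [amp]
  ring

lemma isBigO_log_amp_sub (H : SlowlyVarying a g₁ g₂ g₃ g₄) (c d : ℝ) :
    (fun t => Real.log (amp c g₁ g₂ t) - Real.log (g₁ (t + shift c d g₁ g₂ t)))
      =O[atTop] fun t => g₂ t / g₁ t := by
  have hΦ := H.isLittleO_shift c d
  have h1 : (fun t => g₁ (t + shift c d g₁ g₂ t) / amp c g₁ g₂ t - 1) =O[atTop]
      fun t => g₂ t / g₁ t := by
    refine (H.isBigO_div_amp c (H.isBigO_sub_amp c d)).congr' ?_ EventuallyEq.rfl
    filter_upwards [H.eventually_amp_pos c] with t ht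
    rw [sub_div, div_self ht.ne']
  have h2 : Tendsto (fun t => g₁ (t + shift c d g₁ g₂ t) / amp c g₁ g₂ t) atTop (nhds 1) := by
    simpa using (h1.trans_tendsto H.tendsto_div).add_const 1
  have h3 := ((Real.hasDerivAt_log one_ne_zero).isBigO_sub.comp_tendsto h2).trans h1
  refine h3.neg_left.congr' ?_ EventuallyEq.rfl
  filter_upwards [H.eventually_amp_pos c,
    (tendsto_add_isLittleO_atTop hΦ).eventually_gt_atTop a] with t h1 h2
  simp only [Function.comp, Real.log_one, sub_zero]
  rw [Real.log_div (H.pos _ h2).ne' h1.ne']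
  ring

end SlowlyVarying

namespace SlowlyVarying

variable {a : ℝ} {g₁ g₂ g₃ g₄ : ℝ → ℝ}

lemma isBigO_div_shift (H : SlowlyVarying a g₁ g₂ g₃ g₄) {h : ℝ → ℝ}
    (hh : h =o[atTop] fun t : ℝ => t) :
    (fun t => g₂ (t + h t) / g₁ (t + h t)) =O[atTop] fun t => g₂ t / g₁ t := by
  simpa only [div_eq_mul_inv] using (H.isBigO_shift h hh).mul (H.isBigO₁_shift_rev hh)

lemma isBigO_exp_sub (H : SlowlyVarying a g₁ g₂ g₃ g₄) {κ θ β : ℝ} (hκ : 0 < κ) (hθ : 0 < θ) :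
    (fun t => Real.exp (shift (β + 1) (β * Real.log θ + Real.log (θ * κ)) g₁ g₂ t -
        (β + 1) * Real.log (g₁ (t + shift (β + 1) (β * Real.log θ + Real.log (θ * κ)) g₁ g₂ t))) *
          (θ + θ * shiftDeriv (β + 1) g₁ g₂ g₃ t) ^ (-β) - κ * θ)
      =O[atTop] fun t => g₂ t / g₁ t := by
  set d := β * Real.log θ + Real.log (θ * κ) with hd
  set u : ℝ → ℝ := fun t => (β + 1) * (Real.log (amp (β + 1) g₁ g₂ t) -
    Real.log (g₁ (t + shift (β + 1) d g₁ g₂ t))) -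
    β * Real.log (1 + shiftDeriv (β + 1) g₁ g₂ g₃ t) with hu_def
  have hψ := H.isBigO_shiftDeriv (β + 1)
  have hψ0 : Tendsto (fun t => 1 + shiftDeriv (β + 1) g₁ g₂ g₃ t) atTop (nhds 1) := by
    simpa using (hψ.trans_tendsto H.tendsto_div).const_add 1
  have hlog : (fun t => Real.log (1 + shiftDeriv (β + 1) g₁ g₂ g₃ t)) =O[atTop]
      fun t => g₂ t / g₁ t := by
    refine (((Real.hasDerivAt_log one_ne_zero).isBigO_sub.comp_tendsto hψ0).trans
      (hψ.congr_left fun t => ?_)).congr_left fun t => ?_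
    · simp
    · simp
  have hu : u =O[atTop] fun t => g₂ t / g₁ t :=
    ((H.isBigO_log_amp_sub (β + 1) d).const_mul_left (β + 1)).sub (hlog.const_mul_left β)
  have he : (fun t => Real.exp (u t) - 1) =O[atTop] fun t => g₂ t / g₁ t := by
    refine (((Real.hasDerivAt_exp 0).isBigO_sub.comp_tendsto (hu.trans_tendsto H.tendsto_div)).trans
      (hu.congr_left fun t => ?_)).congr_left fun t => ?_
    · simp
    · simp
  refine (he.const_mul_left (κ * θ)).congr' ?_ EventuallyEq.rfl
  filter_upwards [hψ0.eventually_const_lt zero_lt_one] with t ht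
  have e1 : θ + θ * shiftDeriv (β + 1) g₁ g₂ g₃ t =
      Real.exp (Real.log θ + Real.log (1 + shiftDeriv (β + 1) g₁ g₂ g₃ t)) := by
    rw [Real.exp_add, Real.exp_log hθ, Real.exp_log ht]
    ring
  have e2 : κ * θ = Real.exp (Real.log (θ * κ)) := by
    rw [Real.exp_log (by positivity), mul_comm]
  rw [e1, ← Real.exp_mul, ← Real.exp_add, mul_sub, mul_one, e2, ← Real.exp_add]
  congr 2
  simp only [hu_def]
  rw [shift, hd]
  ring

lemma isBigO_deviationRHS (H : SlowlyVarying a g₁ g₂ g₃ g₄) {κ θ β d : ℝ} (hκ : 0 < κ)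
    (hθ : 0 < θ) (hd : d = β * Real.log θ + Real.log (θ * κ)) :
    (fun t => deviationRHS κ θ β (fun y => Real.log (g₁ y)) (fun y => g₂ y / g₁ y)
      (fun t => shift (β + 1) d g₁ g₂ (θ * t))
      (fun t => θ * shiftDeriv (β + 1) g₁ g₂ g₃ (θ * t))
      (fun t => θ ^ 2 * shiftDeriv₂ (β + 1) g₁ g₂ g₃ g₄ (θ * t)) t 0 0)
      =O[atTop] fun t => g₂ (θ * t) / g₁ (θ * t) := by
  subst hd
  set d := β * Real.log θ + Real.log (θ * κ) with hd
  have hψ := H.isBigO_shiftDeriv (β + 1)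
  have h1 := hψ.const_mul_left (κ * θ)
  have hb : (fun t => (θ + θ * shiftDeriv (β + 1) g₁ g₂ g₃ t) ^ 2) =O[atTop]
      fun _ => (1 : ℝ) :=
    ((((hψ.trans_tendsto H.tendsto_div).const_mul θ).const_add θ).pow 2).isBigO_one ℝ
  have h2 := (H.isBigO_div_shift (H.isLittleO_shift (β + 1) d)).mul hb
  simp only [mul_one] at h2
  have h3 := (H.isBigO_shiftDeriv₂ (β + 1)).const_mul_left (θ ^ 2)
  have h4 := ((h1.sub h2).sub (H.isBigO_exp_sub (β := β) hκ hθ)).sub h3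
  refine (h4.comp_tendsto (tendsto_id.const_mul_atTop hθ)).congr_left fun t => ?_
  simp only [deviationRHS, Function.comp, id, add_zero]
  ring

theorem exists_solution (H : SlowlyVarying a g₁ g₂ g₃ g₄) {κ θ β d : ℝ} (hκ : 0 < κ)
    (hθ : 0 < θ) (hβ : 0 ≤ β) (hd : d = β * Real.log θ + Real.log (θ * κ)) :
    ∃ z w : ℝ → ℝ, (∀ᶠ t in atTop, HasDerivAt z (w t) t ∧
      HasDerivAt w (deviationRHS κ θ β (fun y => Real.log (g₁ y)) (fun y => g₂ y / g₁ y)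
      (fun t => shift (β + 1) d g₁ g₂ (θ * t))
      (fun t => θ * shiftDeriv (β + 1) g₁ g₂ g₃ (θ * t))
      (fun t => θ ^ 2 * shiftDeriv₂ (β + 1) g₁ g₂ g₃ g₄ (θ * t)) t (z t) (w t)) t) ∧
      (z =O[atTop] fun t => g₂ (θ * t) / g₁ (θ * t)) ∧
      (w =O[atTop] fun t => g₂ (θ * t) / g₁ (θ * t)) := by
  obtain ⟨b, hb1, hb2, hb3⟩ := H.exists_hasDerivAt_shift (β + 1) d
  have hθt : Tendsto (fun t : ℝ => θ * t) atTop atTop := tendsto_id.const_mul_atTop hθ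
  have hlin : ∀ t, HasDerivAt (fun t : ℝ => θ * t) θ t := fun t => by
    simpa using (hasDerivAt_id t).const_mul θ
  have hbt : ∀ t, b / θ < t → b < θ * t := fun t ht => by
    rwa [div_lt_iff₀ hθ, mul_comm] at ht
  refine exists_deviation (a := a) (b := b / θ) hκ hθ hβ H.hasDerivAt_log H.hasDerivAt_div
    H.tendsto_div H.tendsto_deriv_div ?_ ?_ ?_ ?_ ?_ ?_
    (H.isBigO_deviationRHS hκ hθ hd) (H.tendsto_div.comp hθt) (H.almost_antitone_div hθ)
  · intro t ht
    exact ((hb1 _ (hbt t ht)).comp t (hlin t)).congr_deriv (mul_comm _ _)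
  · intro t ht
    exact (((hb2 _ (hbt t ht)).comp t (hlin t)).const_mul θ).congr_deriv (by ring)
  · exact (hb3.comp (by fun_prop) fun t ht => hbt t ht).const_mul (θ ^ 2)
  · simpa using (((H.isBigO_shiftDeriv (β + 1)).trans_tendsto H.tendsto_div).comp hθt).const_mul θ
  · exact (tendsto_add_isLittleO_atTop (H.isLittleO_shift (β + 1) d)).comp hθt
  · have h := ((H.tendsto_shift_sub (β + 1) d (H.isLittleO_shift (β + 1) d)).comp hθt).rexp
    have e : Real.exp d = κ * θ ^ β * θ := by
      rw [hd, Real.exp_add, Real.exp_log (by positivity), Real.rpow_def_of_pos hθ, mul_comm β]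
      ring
    rw [e] at h
    exact h

end SlowlyVarying

lemma contDiffOn_two_of_hasDerivAt {f f₁ f₂ : ℝ → ℝ} {T : ℝ}
    (h1 : ∀ t, T < t → HasDerivAt f (f₁ t) t) (h2 : ∀ t, T < t → HasDerivAt f₁ (f₂ t) t)
    (h3 : ContinuousOn f₂ (Ioi T)) : ContDiffOn ℝ 2 f (Ioi T) := by
  have e : (2 : WithTop ℕ∞) = 0 + 1 + 1 := by norm_num
  have hf₁ : ContDiffOn ℝ (0 + 1) f₁ (Ioi T) := by
    refine (contDiffOn_succ_iff_deriv_of_isOpen isOpen_Ioi).2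
      ⟨fun t ht => (h2 t ht).differentiableAt.differentiableWithinAt, by simp, ?_⟩
    exact contDiffOn_zero.2 (h3.congr fun t ht => (h2 t ht).deriv)
  rw [e]
  refine (contDiffOn_succ_iff_deriv_of_isOpen isOpen_Ioi).2
    ⟨fun t ht => (h1 t ht).differentiableAt.differentiableWithinAt, by simp, ?_⟩
  exact hf₁.congr fun t ht => (h1 t ht).deriv

lemma isLittleO_comp_div {k : ℝ → ℝ} (hk : Tendsto k atTop (nhds 0)) {θ : ℝ} (hθ : 0 < θ) :
    (fun s => k (s / θ)) =o[atTop] fun s : ℝ => s :=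
  ((hk.comp (tendsto_id.atTop_div_const hθ)).isBigO_one ℝ).trans_isLittleO
    (isLittleO_const_id_atTop (1 : ℝ))

namespace SlowlyVarying

variable {a : ℝ} {g₁ g₂ g₃ g₄ : ℝ → ℝ}

lemma isBigO₁_comp (H : SlowlyVarying a g₁ g₂ g₃ g₄) {θ : ℝ} (hθ : 0 < θ) (c d : ℝ)
    {k : ℝ → ℝ} (hk : Tendsto k atTop (nhds 0)) :
    (fun t => g₁ (θ * t + shift c d g₁ g₂ (θ * t) + k t)) =O[atTop] fun t => g₁ (θ * t) := by
  refine ((H.isBigO₁_shift ((H.isLittleO_shift c d).add (isLittleO_comp_div hk hθ))).comp_tendsto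
    (tendsto_id.const_mul_atTop hθ)).congr_left fun t => ?_
  simp only [Function.comp, id, mul_div_cancel_left₀ t hθ.ne', add_assoc]

lemma isBigO₂_comp (H : SlowlyVarying a g₁ g₂ g₃ g₄) {θ : ℝ} (hθ : 0 < θ) (c d : ℝ)
    {k : ℝ → ℝ} (hk : Tendsto k atTop (nhds 0)) :
    (fun t => g₂ (θ * t + shift c d g₁ g₂ (θ * t) + k t)) =O[atTop] fun t => g₂ (θ * t) := by
  refine ((H.isBigO_shift _ ((H.isLittleO_shift c d).add (isLittleO_comp_div hk hθ))).comp_tendsto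
    (tendsto_id.const_mul_atTop hθ)).congr_left fun t => ?_
  simp only [Function.comp, id, mul_div_cancel_left₀ t hθ.ne', add_assoc]

/-- Increment bound along the shifted argument for a function `u` with derivative `u'`. -/
lemma isBigO_increment {u u' z Y : ℝ → ℝ} {r₁ r₂ : ℝ → ℝ}
    (hu : ∀ y, a < y → HasDerivAt u (u' y) y) (hY : Tendsto Y atTop atTop)
    (hz : Tendsto z atTop (nhds 0)) (hzr : z =O[atTop] r₂)
    (hu' : ∀ k : ℝ → ℝ, Tendsto k atTop (nhds 0) → (fun t => u' (Y t + k t)) =O[atTop] r₁) :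
    (fun t => u (Y t + z t) - u (Y t)) =O[atTop] fun t => r₁ t * r₂ t := by
  have hex : ∀ᶠ t in atTop, ∃ k, |k| ≤ |z t| ∧ u (Y t + z t) - u (Y t) = u' (Y t + k) * z t := by
    filter_upwards [hY.eventually_gt_atTop a, (hY.atTop_add hz).eventually_gt_atTop a] with t h1 h2
    obtain ⟨k, hk, -, hk'⟩ := exists_mean_value hu h1 h2
    exact ⟨k, hk, hk'⟩
  obtain ⟨k, hk⟩ := hex.choice
  have hk0 : Tendsto k atTop (nhds 0) :=
    squeeze_zero_norm' (hk.mono fun t ht => ht.1) (by simpa using hz.abs)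
  exact ((hu' k hk0).mul hzr).congr' (hk.mono fun t ht => ht.2.symm) EventuallyEq.rfl

theorem exists_correction (H : SlowlyVarying a g₁ g₂ g₃ g₄) {g : ℝ → ℝ}
    (hg : ∀ y, a < y → HasDerivAt g (g₁ y) y) {κ θ β d : ℝ} (hκ : 0 < κ)
    (hθ : 0 < θ) (hβ : 0 ≤ β) (hd : d = β * Real.log θ + Real.log (θ * κ)) :
    ∃ (y y₁ y₂ : ℝ → ℝ) (T : ℝ), (∀ t, T < t → a < y t ∧ 0 < y₁ t ∧ HasDerivAt y (y₁ t) t ∧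
      HasDerivAt y₁ (y₂ t) t ∧ y₂ t = κ * y₁ t - g₂ (y t) / g₁ (y t) * y₁ t ^ 2 -
        Real.exp (y t - θ * t - (β + 1) * Real.log (g₁ (y t))) * y₁ t ^ (-β)) ∧
      ContDiffOn ℝ 2 (fun t => g (y t) - g (θ * t + shift (β + 1) d g₁ g₂ (θ * t))) (Ioi T) ∧
      ((fun t => g (y t) - g (θ * t + shift (β + 1) d g₁ g₂ (θ * t))) =O[atTop]
        fun t => g₂ (θ * t)) ∧
      (deriv (fun t => g (y t) - g (θ * t + shift (β + 1) d g₁ g₂ (θ * t))) =O[atTop]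
        fun t => g₂ (θ * t)) := by
  obtain ⟨z, w, hzw, hz, hw⟩ := H.exists_solution hκ hθ hβ hd
  obtain ⟨b, hb1, hb2, hb3⟩ := H.exists_hasDerivAt_shift (β + 1) d
  have hθt : Tendsto (fun t : ℝ => θ * t) atTop atTop := tendsto_id.const_mul_atTop hθ
  have hlin : ∀ t, HasDerivAt (fun t : ℝ => θ * t) θ t := fun t => by
    simpa using (hasDerivAt_id t).const_mul θ
  set ψ := fun t => θ * shiftDeriv (β + 1) g₁ g₂ g₃ (θ * t) with hψ_def
  set ψ' := fun t => θ ^ 2 * shiftDeriv₂ (β + 1) g₁ g₂ g₃ g₄ (θ * t) with hψ'_def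
  set Y := fun t => θ * t + shift (β + 1) d g₁ g₂ (θ * t) with hY_def
  have hY : Tendsto Y atTop atTop :=
    (tendsto_add_isLittleO_atTop (H.isLittleO_shift (β + 1) d)).comp hθt
  have hz0 : Tendsto z atTop (nhds 0) := hz.trans_tendsto (H.tendsto_div.comp hθt)
  have hw0 : Tendsto w atTop (nhds 0) := hw.trans_tendsto (H.tendsto_div.comp hθt)
  have hψ0 : Tendsto ψ atTop (nhds 0) := by
    simpa using
      (((H.isBigO_shiftDeriv (β + 1)).trans_tendsto H.tendsto_div).comp hθt).const_mul θ
  have hq : Tendsto (fun t => θ + ψ t + w t) atTop (nhds θ) := by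
    simpa using (hψ0.const_add θ).add hw0
  obtain ⟨T, hT⟩ := eventually_atTop.1 (hzw.and ((hθt.eventually_gt_atTop b).and
    ((hY.eventually_gt_atTop a).and (((hY.atTop_add hz0).eventually_gt_atTop a).and
      (hq.eventually_const_lt hθ)))))
  have hYd : ∀ t, T < t → HasDerivAt Y (θ + ψ t) t := fun t ht =>
    ((hlin t).add ((hb1 _ (hT t ht.le).2.1).comp t (hlin t))).congr_deriv (by
      simp only [hψ_def]; ring)
  have hψd : ∀ t, T < t → HasDerivAt ψ (ψ' t) t := fun t ht =>
    (((hb2 _ (hT t ht.le).2.1).comp t (hlin t)).const_mul θ).congr_deriv (by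
      simp only [hψ'_def]; ring)
  have hψ'c : ContinuousOn ψ' (Ioi T) :=
    (hb3.comp (by fun_prop) fun t ht => (hT t (le_of_lt ht)).2.1).const_mul (θ ^ 2)
  have hyd : ∀ t, T < t → HasDerivAt (fun t => Y t + z t) (θ + ψ t + w t) t := fun t ht =>
    (hYd t ht).add (hT t ht.le).1.1
  set W := fun t => deviationRHS κ θ β (fun y => Real.log (g₁ y)) (fun y => g₂ y / g₁ y)
      (fun t => shift (β + 1) d g₁ g₂ (θ * t)) ψ ψ' t (z t) (w t) with hW_def
  have hWeq : ∀ t, W t = κ * (θ + ψ t + w t) -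
      g₂ (Y t + z t) / g₁ (Y t + z t) * (θ + ψ t + w t) ^ 2 -
        Real.exp (Y t + z t - θ * t - (β + 1) * Real.log (g₁ (Y t + z t))) *
          (θ + ψ t + w t) ^ (-β) - ψ' t := by
    intro t
    simp only [hW_def, deviationRHS, hY_def]
    congr 4
    ring
  have hy₁d : ∀ t, T < t → HasDerivAt (fun t => θ + ψ t + w t) (ψ' t + W t) t := fun t ht =>
    ((hψd t ht).const_add θ).add (hT t ht.le).1.2
  have hYc : ContinuousOn Y (Ioi T) := fun t ht => (hYd t ht).continuousAt.continuousWithinAt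
  have hzc : ContinuousOn z (Ioi T) := fun t ht =>
    (hT t (le_of_lt ht)).1.1.continuousAt.continuousWithinAt
  have hy₁c : ContinuousOn (fun t => θ + ψ t + w t) (Ioi T) := fun t ht =>
    (hy₁d t ht).continuousAt.continuousWithinAt
  have hyc : ContinuousOn (fun t => Y t + z t) (Ioi T) := hYc.add hzc
  have hym : MapsTo (fun t => Y t + z t) (Ioi T) (Ioi a) := fun t ht => (hT t (le_of_lt ht)).2.2.2.1
  have hg₁c : ContinuousOn (fun t => g₁ (Y t + z t)) (Ioi T) :=
    ContinuousOn.comp (fun y hy => (H.hasDerivAt₁ y hy).continuousAt.continuousWithinAt) hyc hym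
  have hg₂c : ContinuousOn (fun t => g₂ (Y t + z t)) (Ioi T) :=
    ContinuousOn.comp (fun y hy => (H.hasDerivAt₂ y hy).continuousAt.continuousWithinAt) hyc hym
  have hg₁n : ∀ t ∈ Ioi T, g₁ (Y t + z t) ≠ 0 := fun t ht => (H.pos _ (hym ht)).ne'
  have hWc : ContinuousOn W (Ioi T) := by
    rw [show W = _ from funext hWeq]
    refine (((hy₁c.const_mul κ).sub ((hg₂c.div hg₁c hg₁n).mul (hy₁c.pow 2))).sub
      (ContinuousOn.mul ?_ (hy₁c.rpow_const fun t ht =>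
        Or.inl (hT t (le_of_lt ht)).2.2.2.2.ne'))).sub hψ'c
    exact ((hyc.sub (by fun_prop)).sub ((hg₁c.log hg₁n).const_mul _)).rexp
  have hg2 : ContDiffOn ℝ 2 g (Ioi a) := contDiffOn_two_of_hasDerivAt hg H.hasDerivAt₁
    fun y hy => (H.hasDerivAt₂ y hy).continuousAt.continuousWithinAt
  have hη : ∀ t, T < t → HasDerivAt (fun t => g (Y t + z t) - g (Y t))
      (g₁ (Y t + z t) * (θ + ψ t + w t) - g₁ (Y t) * (θ + ψ t)) t := fun t ht =>
    (HasDerivAt.comp (h₂ := g) t (hg _ (hym ht)) (hyd t ht)).sub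
      (HasDerivAt.comp (h₂ := g) t (hg _ (hT t ht.le).2.2.1) (hYd t ht))
  have hprod : (fun t => g₁ (θ * t) * (g₂ (θ * t) / g₁ (θ * t))) =ᶠ[atTop]
      fun t => g₂ (θ * t) := by
    filter_upwards [hθt.eventually_gt_atTop a] with t ht
    exact mul_div_cancel₀ _ (H.pos _ ht).ne'
  have hbig := (H.tendsto_div.comp hθt).isBigO_one ℝ
  refine ⟨fun t => Y t + z t, fun t => θ + ψ t + w t, fun t => ψ' t + W t, T, fun t ht =>
    ⟨hym ht, (hT t ht.le).2.2.2.2, hyd t ht, hy₁d t ht, ?_⟩, ?_, ?_, ?_⟩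
  · simp only [hWeq]
    ring
  · exact (hg2.comp (contDiffOn_two_of_hasDerivAt hyd hy₁d (hψ'c.add hWc)) hym).sub
      (hg2.comp (contDiffOn_two_of_hasDerivAt hYd (fun t ht => (hψd t ht).const_add θ) hψ'c)
        fun t ht => (hT t (le_of_lt ht)).2.2.1)
  · exact (isBigO_increment hg hY hz0 hz fun k hk => H.isBigO₁_comp hθ _ d hk).trans_eventuallyEq
      hprod
  · have h1 : (fun t => g₁ (Y t + z t) * w t) =O[atTop] fun t => g₂ (θ * t) :=
      ((H.isBigO₁_comp hθ (β + 1) d hz0).mul hw).trans_eventuallyEq hprod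
    have h2 : (fun t => (g₁ (Y t + z t) - g₁ (Y t)) * (θ + ψ t)) =O[atTop]
        fun t => g₂ (θ * t) := by
      have h3 := (isBigO_increment H.hasDerivAt₁ hY hz0 (hz.trans hbig) fun k hk =>
        H.isBigO₂_comp hθ (β + 1) d hk).mul ((hψ0.const_add θ).isBigO_one ℝ)
      simpa only [mul_one] using h3
    refine (h1.add h2).congr' ?_ EventuallyEq.rfl
    filter_upwards [eventually_gt_atTop T] with t ht
    rw [(hη t ht).deriv]
    ring

end SlowlyVarying

lemma contDiffOn_of_leftInverse {f g : ℝ → ℝ} {n : WithTop ℕ∞} (hn : n ≠ 0)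
    (hf : ContDiffOn ℝ n f (Ici 0)) (hf' : ∀ u ∈ Ici (0 : ℝ), 0 < deriv f u)
    (hftop : Tendsto f atTop atTop) (hgf : ∀ u ∈ Ici (0 : ℝ), g (f u) = u) :
    ContDiffOn ℝ n g (Ioi (f 0)) ∧ ∀ y, f 0 < y → 0 < deriv g y := by
  have key : ∀ y, f 0 < y → ContDiffAt ℝ n g y ∧ 0 < deriv g y := by
    intro y hy
    obtain ⟨u, hu, rfl⟩ := intermediate_value_Ici hf.continuousOn hftop hy.le
    have hu0 : 0 < u := lt_of_le_of_ne hu fun h => by simp [← h] at hy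
    have hfu : ContDiffAt ℝ n f u := hf.contDiffAt (Ici_mem_nhds hu0)
    have hd : HasDerivAt f (deriv f u) u := (hfu.differentiableAt hn).hasDerivAt
    have hgf' : ∀ᶠ x in nhds u, g (f x) = x := by
      filter_upwards [Ici_mem_nhds hu0] with x hx using hgf x hx
    have hE := hd.hasFDerivAt_equiv (hf' u hu).ne'
    have hg : ContDiffAt ℝ n g (f u) := (hfu.to_localInverse hE hn).congr_of_eventuallyEq
      ((hfu.hasStrictFDerivAt' hE hn).localInverse_unique hgf')
    refine ⟨hg, ?_⟩
    have h1 := ((hg.differentiableAt hn).hasDerivAt.comp u hd).unique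
      ((hasDerivAt_id u).congr_of_eventuallyEq hgf')
    exact pos_of_mul_pos_left (h1 ▸ one_pos) (hf' u hu).le
  exact ⟨fun y hy => (key y hy).1.contDiffWithinAt, fun y hy => (key y hy).2⟩

lemma hasDerivAt_of_contDiffOn_succ {g : ℝ → ℝ} {a : ℝ} {n : ℕ}
    (hg : ContDiffOn ℝ (n + 1) g (Ioi a)) :
    (∀ y, a < y → HasDerivAt g (deriv g y) y) ∧ ContDiffOn ℝ n (deriv g) (Ioi a) := by
  have h := (contDiffOn_succ_iff_deriv_of_isOpen isOpen_Ioi).1 hg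
  exact ⟨fun y hy => ((h.1 y hy).differentiableAt (Ioi_mem_nhds hy)).hasDerivAt, h.2.2⟩

lemma ode_of_hasDerivAt {g g₁ g₂ f v y y₁ y₂ : ℝ → ℝ} {a κ θ β T : ℝ}
    (hg : ∀ y, a < y → HasDerivAt g (g₁ y) y) (hg₁ : ∀ y, a < y → HasDerivAt g₁ (g₂ y) y)
    (hpos : ∀ y, a < y → 0 < g₁ y) (hfg : ∀ y, a < y → f (g y) = y)
    (hy : ∀ t, T < t → a < y t ∧ 0 < y₁ t ∧ HasDerivAt y (y₁ t) t ∧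
      HasDerivAt y₁ (y₂ t) t ∧ y₂ t = κ * y₁ t - g₂ (y t) / g₁ (y t) * y₁ t ^ 2 -
        Real.exp (y t - θ * t - (β + 1) * Real.log (g₁ (y t))) * y₁ t ^ (-β))
    (hv : ∀ t, T < t → v t = g (y t)) (t : ℝ) (ht : T < t) :
    DifferentiableAt ℝ v t ∧ 0 < deriv v t ∧ deriv (deriv v) t - κ * deriv v t =
      -(Real.exp (-θ * t + f (v t)) / |deriv v t| ^ β) := by
  have hv1 : ∀ t, T < t → HasDerivAt v (g₁ (y t) * y₁ t) t := fun t ht =>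
    ((hg _ (hy t ht).1).comp t (hy t ht).2.2.1).congr_of_eventuallyEq
      (by filter_upwards [Ioi_mem_nhds ht] with s hs using hv s hs)
  have hv2 : HasDerivAt (deriv v) (g₂ (y t) * y₁ t * y₁ t + g₁ (y t) * y₂ t) t :=
    (((hg₁ _ (hy t ht).1).comp t (hy t ht).2.2.1).mul (hy t ht).2.2.2.1).congr_of_eventuallyEq
      (by filter_upwards [Ioi_mem_nhds ht] with s hs using (hv1 s hs).deriv)
  obtain ⟨h1, h2, -, -, h5⟩ := hy t ht
  have h3 := hpos _ h1
  have h4 : 0 < g₁ (y t) * y₁ t := mul_pos h3 h2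
  refine ⟨(hv1 t ht).differentiableAt, (hv1 t ht).deriv ▸ h4, ?_⟩
  rw [hv2.deriv, (hv1 t ht).deriv, hv t ht, hfg _ h1, abs_of_pos h4, h5,
    Real.mul_rpow h3.le h2.le, Real.rpow_neg h2.le, Real.rpow_def_of_pos h3]
  have e : Real.exp (y t - θ * t - (β + 1) * Real.log (g₁ (y t))) =
      Real.exp (-θ * t + y t) / (Real.exp (Real.log (g₁ (y t)) * β) * g₁ (y t)) := by
    rw [eq_div_iff (by positivity)]
    nth_rewrite 3 [← Real.exp_log h3]
    rw [← Real.exp_add, ← Real.exp_add]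
    congr 1
    ring
  rw [e]
  have := Real.rpow_pos_of_pos h2 β
  field_simp
  ring

lemma log_add_log_eq_shift {κ θ β t : ℝ} {g₁ g₂ : ℝ → ℝ} (hθ : 0 < θ)
    (hA : 0 < amp (β + 1) g₁ g₂ t) :
    Real.log (θ ^ β * amp (β + 1) g₁ g₂ t ^ β) +
      (Real.log (θ * κ) + Real.log (amp (β + 1) g₁ g₂ t)) =
      shift (β + 1) (β * Real.log θ + Real.log (θ * κ)) g₁ g₂ t := by
  rw [Real.log_mul (Real.rpow_pos_of_pos hθ β).ne' (Real.rpow_pos_of_pos hA β).ne',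
    Real.log_rpow hθ, Real.log_rpow hA, shift]
  ring

/-- Proposition 2.1: under (A1)–(A6) (θ = γ+2+β−α), there exist `T > 0` and a C²
function `η` with `η(t) = O(g''(θt))` and `η'(t) = O(g''(θt))` such that
`v*(t) = g(θt + φ₁(t) + φ₂(t)) + η(t)` is strictly increasing on `[T,∞)` and solves
`v'' − (α/(β+1) − 1) v' = − e^{−θt + f(v)}/|v'|^β` there. -/
theorem stmt_10 (α β γ θ : ℝ) (hθ : θ = γ + 2 + β - α) (f g : ℝ → ℝ)
    -- (A1): f is C⁴ on [0,∞), increasing, tending to +∞; g is its inverse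
    (hf : ContDiffOn ℝ 4 f (Ici 0))
    (hf' : ∀ u ∈ Ici (0:ℝ), 0 < deriv f u)
    (hftop : Tendsto f atTop atTop)
    (hgf : ∀ u ∈ Ici (0:ℝ), g (f u) = u)
    (hfg : ∀ t ∈ Ici (f 0), f (g t) = t)
    -- (A2)
    (hA2a : Tendsto (fun t => deriv (deriv g) t) atTop (nhds 0))
    (hA2b : ∀ ε : ℝ → ℝ, (ε =O[atTop] fun t => deriv (deriv g) t) →
      Tendsto (fun t => f (g t + ε t) / t) atTop (nhds 1))
    -- (A3)
    (hA3 : ∀ h : ℝ → ℝ, (h =o[atTop] fun t : ℝ => t) →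
      Tendsto (fun t => deriv g t / deriv g (t + h t)) atTop (nhds 1))
    -- (A4)
    (hA4 : Tendsto (fun t => deriv (deriv g) t / deriv g t * Real.log (deriv g t))
      atTop (nhds 0))
    -- (A5)
    (hA5a : ∀ n : ℕ, n ≤ 2 →
      (fun t => deriv (deriv (deriv g)) t * Real.log (deriv g t) ^ n)
        =O[atTop] fun t => deriv (deriv g) t)
    (hA5b : (fun t => deriv (deriv (deriv (deriv g))) t * Real.log (deriv g t))
        =O[atTop] fun t => deriv (deriv g) t)
    (hA5c : ∃ C : ℝ, ∀ᶠ t in atTop, ∀ s, t ≤ s →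
      |deriv (deriv g) s| ≤ C * |deriv (deriv g) t|)
    (hA5d : ∀ h : ℝ → ℝ, (h =o[atTop] fun t : ℝ => t) →
      (fun t => deriv (deriv g) (t + h t)) =O[atTop] fun t => deriv (deriv g) t)
    -- (A6)
    (hαβ : α > β + 1) (hβ : 0 ≤ β) (hθpos : 0 < θ)
    :
    ∃ T : ℝ, 0 < T ∧ ∃ η v : ℝ → ℝ,
      (∀ t, v t =
        g (θ * t +
            Real.log (θ ^ β * (deriv g (θ * t) +
              (β + 1) * deriv (deriv g) (θ * t) * Real.log (deriv g (θ * t))) ^ β) +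
            (Real.log (θ * (α / (β + 1) - 1)) +
              Real.log (deriv g (θ * t) +
                (β + 1) * deriv (deriv g) (θ * t) * Real.log (deriv g (θ * t))))) +
          η t) ∧
      ContDiffOn ℝ 2 η (Ici T) ∧
      (η =O[atTop] fun t => deriv (deriv g) (θ * t)) ∧
      (deriv η =O[atTop] fun t => deriv (deriv g) (θ * t)) ∧
      StrictMonoOn v (Ici T) ∧
      ∀ t ∈ Ici T,
        deriv (deriv v) t - (α / (β + 1) - 1) * deriv v t =
          -(Real.exp (-θ * t + f (v t)) / |deriv v t| ^ β) := by
  obtain ⟨hg4, hpos⟩ := contDiffOn_of_leftInverse (by norm_num) hf hf' hftop hgf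
  obtain ⟨hd0, hg3⟩ := hasDerivAt_of_contDiffOn_succ (n := 3) (by exact_mod_cast hg4)
  obtain ⟨hd1, hg2⟩ := hasDerivAt_of_contDiffOn_succ (n := 2) (by exact_mod_cast hg3)
  obtain ⟨hd2, hg1⟩ := hasDerivAt_of_contDiffOn_succ (n := 1) (by exact_mod_cast hg2)
  obtain ⟨hd3, hg0⟩ := hasDerivAt_of_contDiffOn_succ (n := 0) (by exact_mod_cast hg1)
  have H : SlowlyVarying (f 0) (deriv g) (deriv (deriv g)) (deriv (deriv (deriv g)))
      (deriv (deriv (deriv (deriv g)))) :=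
    ⟨hd1, hd2, hd3, hg0.continuousOn, hpos, hA2a, hA3, hA4, hA5a, hA5b, hA5c, hA5d⟩
  have hκ : 0 < α / (β + 1) - 1 := by
    rw [sub_pos, one_lt_div (by linarith)]
    exact hαβ
  obtain ⟨y, y₁, y₂, T₀, hy, hC, hO, hO'⟩ := H.exists_correction hd0 hκ hθpos hβ rfl
  obtain ⟨T₁, hT₁⟩ := eventually_atTop.1
    ((tendsto_id.const_mul_atTop hθpos).eventually (H.eventually_amp_pos (β + 1)))
  have hsub : ∀ t ∈ Ici (max (max T₀ T₁) 0 + 1), max T₀ T₁ < t := fun t ht =>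
    (le_max_left _ 0).trans_lt ((lt_add_one _).trans_le ht)
  replace hT₁ : ∀ t, T₁ ≤ t → 0 < amp (β + 1) (deriv g) (deriv (deriv g)) (θ * t) := hT₁
  set d := β * Real.log θ + Real.log (θ * (α / (β + 1) - 1)) with hd
  obtain ⟨v, hv⟩ : ∃ v : ℝ → ℝ, ∀ t, v t = g (θ * t +
      Real.log (θ ^ β * amp (β + 1) (deriv g) (deriv (deriv g)) (θ * t) ^ β) +
      (Real.log (θ * (α / (β + 1) - 1)) +
        Real.log (amp (β + 1) (deriv g) (deriv (deriv g)) (θ * t)))) +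
      (g (y t) - g (θ * t + shift (β + 1) d (deriv g) (deriv (deriv g)) (θ * t))) :=
    ⟨_, fun t => rfl⟩
  have hode := ode_of_hasDerivAt (v := v) (T := max T₀ T₁) hd0 hd1 hpos
    (fun t ht => hfg t (le_of_lt ht)) (fun t ht => hy t ((le_max_left _ _).trans_lt ht))
    (fun t ht => by
      rw [hv, add_assoc (θ * t),
        log_add_log_eq_shift hθpos (hT₁ t ((le_max_right T₀ _).trans ht.le)), ← hd]
      exact add_sub_cancel _ _)
  refine ⟨max (max T₀ T₁) 0 + 1, by positivity, _, v, hv,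
    hC.mono fun t ht => (le_max_left _ _).trans_lt (hsub t ht), hO, hO', ?_, fun t ht =>
    (hode t (hsub t ht)).2.2⟩
  refine strictMonoOn_of_deriv_pos (convex_Ici _) (fun t ht =>
    (hode t (hsub t ht)).1.continuousAt.continuousWithinAt) fun t ht =>
    (hode t (hsub t (interior_subset ht))).2.1
end

section
/- Let f : ℝ → ℝ be continuous, λ > 0, and let α > β+1 > 0 with γ > −1. Suppose u ∈ C¹([0,∞)) is such that r ↦ r^α |u'(r)|^β u'(r) is differentiable on (0,∞) and satisfies (r^α |u'(r)|^β u'(r))' = − λ r^γ e^{f(u(r))} for all r > 0, together with u'(0) = 0. Then u'(r) < 0 for every r > 0; in particular u is strictly decreasing on [0,∞). -/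
open Filter Set Real
open scoped Topology

/-- Lemma 3.1: any regular radial solution of `−L(u) = λ e^{f(u)}` with `u'(0) = 0`
satisfies `u'(r) < 0` for all `r > 0`; in particular `u` is strictly decreasing
on `[0,∞)`. -/
theorem stmt_12 (α β γ : ℝ) (f : ℝ → ℝ) (hf : Continuous f)
    (lam : ℝ) (hlam : 0 < lam)
    (hαβ : α > β + 1) (hβ : 0 < β + 1) (hγ : γ > -1)
    (u : ℝ → ℝ) (hu : ContDiffOn ℝ 1 u (Ici 0))
    (hode : ∀ r, 0 < r →
      HasDerivAt (fun x : ℝ => x ^ α * |deriv u x| ^ β * deriv u x)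
        (-(lam * r ^ γ * Real.exp (f (u r)))) r)
    (hu0 : HasDerivWithinAt u 0 (Ici 0) 0) :
    (∀ r, 0 < r → deriv u r < 0) ∧ StrictAntiOn u (Ici 0) := by
  set G : ℝ → ℝ := fun x : ℝ => x ^ α * |deriv u x| ^ β * deriv u x with hG
  have hanti : StrictAntiOn G (Ioi 0) := by
    refine strictAntiOn_of_deriv_neg (convex_Ioi 0)
      (fun x hx => (hode x hx).continuousAt.continuousWithinAt) fun x hx => ?_
    rw [interior_Ioi] at hx
    have hx' : 0 < x := hx
    rw [(hode x hx').deriv]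
    have : 0 < lam * x ^ γ * Real.exp (f (u x)) := by positivity
    linarith
  have hderiv : Tendsto (deriv u) (𝓝[>] 0) (𝓝 0) := by
    have hcont := hu.continuousOn_derivWithin (uniqueDiffOn_Ici 0) le_rfl 0 self_mem_Ici
    have h0 : derivWithin u (Ici 0) 0 = 0 :=
      hu0.derivWithin (uniqueDiffOn_Ici 0 0 self_mem_Ici)
    rw [ContinuousWithinAt, h0] at hcont
    refine (hcont.mono_left (nhdsWithin_mono 0 Ioi_subset_Ici_self)).congr' ?_
    filter_upwards [self_mem_nhdsWithin] with x hx
    exact derivWithin_of_mem_nhds (Ici_mem_nhds hx)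
  have habs : ∀ x, 0 < x → |G x| = x ^ α * |deriv u x| ^ (β + 1) := by
    intro x hx
    have hpow : |deriv u x| ^ β * |deriv u x| = |deriv u x| ^ (β + 1) :=
      (rpow_add_one' (abs_nonneg _) hβ.ne').symm
    rw [hG, abs_mul, abs_mul, abs_of_nonneg (rpow_nonneg hx.le α),
      abs_of_nonneg (rpow_nonneg (abs_nonneg _) β), mul_assoc, hpow]
  have hlim : Tendsto G (𝓝[>] 0) (𝓝 0) := by
    rw [tendsto_zero_iff_abs_tendsto_zero]
    have h1 : Tendsto (fun x : ℝ => x ^ α) (𝓝[>] 0) (𝓝 (0 ^ α)) :=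
      (tendsto_id.mono_left nhdsWithin_le_nhds).rpow_const (Or.inr (by linarith))
    have h2 : Tendsto (fun x => |deriv u x| ^ (β + 1)) (𝓝[>] 0) (𝓝 (|0| ^ (β + 1))) :=
      hderiv.abs.rpow_const (Or.inr hβ.le)
    have h3 := h1.mul h2
    rw [abs_zero, zero_rpow hβ.ne', mul_zero] at h3
    refine h3.congr' ?_
    filter_upwards [self_mem_nhdsWithin] with x hx
    exact (habs x hx).symm
  have hneg : ∀ r, 0 < r → deriv u r < 0 := by
    intro r hr
    have hhalf : 0 < r / 2 := by linarith
    have hle : G (r / 2) ≤ 0 := by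
      refine ge_of_tendsto hlim ?_
      filter_upwards [Ioo_mem_nhdsGT hhalf] with x hx
      exact (hanti hx.1 hhalf hx.2).le
    have hlt : G r < 0 := (hanti hhalf hr (by linarith)).trans_le hle
    by_contra! h
    have : 0 ≤ G r :=
      mul_nonneg (mul_nonneg (rpow_nonneg hr.le α) (rpow_nonneg (abs_nonneg _) β)) h
    linarith
  refine ⟨hneg, strictAntiOn_of_deriv_neg (convex_Ici 0) hu.continuousOn fun x hx => ?_⟩
  rw [interior_Ici] at hx
  exact hneg x hx
end

section
/- Assume f : ℝ → ℝ is of class C¹ with f' > 0 and f(u) → +∞ as u → +∞, and assume α > β+1 > 0, θ := γ + 2 + β − α > 0. Then for every ρ ∈ ℝ the integral equation u(r) = ρ − ∫₀^r t^{−α/(β+1)} ( ∫₀^t s^γ e^{f(u(s))} ds )^{1/(β+1)} dt has exactly one continuous solution u : [0,∞) → ℝ. -/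
open Filter Set Real
open MeasureTheory Topology
open scoped Nat Interval

/-- The inner integral `∫₀ᵗ s^γ g(u(s)) ds`. -/
noncomputable def innerIntegral (γ : ℝ) (g u : ℝ → ℝ) (t : ℝ) : ℝ :=
  ∫ s in (0:ℝ)..t, s ^ γ * g (u s)

/-- The integral operator whose fixed points are the solutions of the integral equation. -/
noncomputable def picardMap (a γ p ρ : ℝ) (g u : ℝ → ℝ) (r : ℝ) : ℝ :=
  ρ - ∫ t in (0:ℝ)..r, t ^ (-a) * innerIntegral γ g u t ^ p

/-- Functions that are measurable and bounded above by `ρ` on the half line. -/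
def Admissible (ρ : ℝ) (u : ℝ → ℝ) : Prop :=
  AEStronglyMeasurable u (volume.restrict (Ioi 0)) ∧ ∀ r, 0 ≤ r → u r ≤ ρ

lemma exists_lipschitz_Icc {h : ℝ → ℝ} {x y : ℝ} (hh : ContDiffOn ℝ 1 h (Icc x y)) :
    ∃ K : ℝ, 0 ≤ K ∧ ∀ a ∈ Icc x y, ∀ b ∈ Icc x y, |h a - h b| ≤ K * |a - b| := by
  obtain ⟨K, hK⟩ := (hh.locallyLipschitzOn (convex_Icc x y)).exists_lipschitzOnWith_of_compact
    isCompact_Icc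
  exact ⟨K, K.2, fun a ha b hb => by simpa [Real.dist_eq] using hK.dist_le_mul a ha b hb⟩

section

variable {a γ p q ρ : ℝ} {g u v : ℝ → ℝ}

lemma integral_zero_rpow {c t : ℝ} (hc : 0 < c) :
    ∫ s in (0:ℝ)..t, s ^ (c - 1) = t ^ c / c := by
  rw [integral_rpow (Or.inl (by linarith))]
  simp [Real.zero_rpow hc.ne']

lemma Admissible.aestronglyMeasurable_comp (hu : Admissible ρ u) (hg : Continuous g) {t : ℝ}
    (ht : 0 ≤ t) : AEStronglyMeasurable (fun s => s ^ γ * g (u s)) (volume.restrict (Ι 0 t)) := by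
  refine AEStronglyMeasurable.mul (by fun_prop) ?_
  refine hg.comp_aestronglyMeasurable (hu.1.mono_measure (Measure.restrict_mono ?_ le_rfl))
  rw [uIoc_of_le ht]
  exact Ioc_subset_Ioi_self

lemma Admissible.intervalIntegrable (hu : Admissible ρ u) (hg : Continuous g) (hm : Monotone g)
    (hpos : ∀ x, 0 < g x) (hγ : 0 < γ + 1) {t : ℝ} (ht : 0 ≤ t) :
    IntervalIntegrable (fun s => s ^ γ * g (u s)) volume 0 t := by
  have h : IntervalIntegrable (fun s : ℝ => s ^ γ * g ρ) volume 0 t :=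
    (intervalIntegral.intervalIntegrable_rpow' (by linarith)).mul_const _
  refine h.mono_fun' (hu.aestronglyMeasurable_comp hg ht) ?_
  refine (ae_restrict_iff' measurableSet_uIoc).2 (ae_of_all _ fun s hs => ?_)
  rw [uIoc_of_le ht] at hs
  have hs0 := rpow_nonneg hs.1.le γ
  refine (Real.norm_of_nonneg (mul_nonneg hs0 (hpos _).le)).trans_le ?_
  exact mul_le_mul_of_nonneg_left (hm (hu.2 s hs.1.le)) hs0

lemma innerIntegral_nonneg (hpos : ∀ x, 0 < g x) {t : ℝ} (ht : 0 ≤ t) :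
    0 ≤ innerIntegral γ g u t :=
  intervalIntegral.integral_nonneg ht fun _ hs => mul_nonneg (rpow_nonneg hs.1 γ) (hpos _).le

lemma integral_zero_rpow_mul_const (hγ : 0 < γ + 1) (c t : ℝ) :
    ∫ s in (0:ℝ)..t, s ^ γ * c = t ^ (γ + 1) * (c / (γ + 1)) := by
  have := integral_zero_rpow (t := t) hγ
  rw [add_sub_cancel_right] at this
  rw [intervalIntegral.integral_mul_const, this]
  ring

lemma Admissible.innerIntegral_le (hu : Admissible ρ u) (hg : Continuous g) (hm : Monotone g)
    (hpos : ∀ x, 0 < g x) (hγ : 0 < γ + 1) {t : ℝ} (ht : 0 ≤ t) :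
    innerIntegral γ g u t ≤ t ^ (γ + 1) * (g ρ / (γ + 1)) := by
  rw [← integral_zero_rpow_mul_const hγ]
  refine intervalIntegral.integral_mono_on ht (hu.intervalIntegrable hg hm hpos hγ ht)
    ((intervalIntegral.intervalIntegrable_rpow' (by linarith)).mul_const _) fun s hs => ?_
  exact mul_le_mul_of_nonneg_left (hm (hu.2 s hs.1)) (rpow_nonneg hs.1 γ)

lemma Admissible.le_innerIntegral (hu : Admissible ρ u) (hg : Continuous g) (hm : Monotone g)
    (hpos : ∀ x, 0 < g x) (hγ : 0 < γ + 1) {t m : ℝ} (ht : 0 ≤ t)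
    (hlow : ∀ s ∈ Icc 0 t, m ≤ u s) :
    t ^ (γ + 1) * (g m / (γ + 1)) ≤ innerIntegral γ g u t := by
  rw [← integral_zero_rpow_mul_const hγ]
  refine intervalIntegral.integral_mono_on ht
    ((intervalIntegral.intervalIntegrable_rpow' (by linarith)).mul_const _)
    (hu.intervalIntegrable hg hm hpos hγ ht) fun s hs => ?_
  exact mul_le_mul_of_nonneg_left (hm (hlow s hs)) (rpow_nonneg hs.1 γ)

lemma rpow_mul_rpow_eq (hq : q = (γ + 1) * p - a + 1) {t J : ℝ} (ht : 0 < t) (hJ : 0 ≤ J) :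
    t ^ (-a) * (t ^ (γ + 1) * J) ^ p = t ^ (q - 1) * J ^ p := by
  rw [mul_rpow (by positivity) hJ, ← rpow_mul ht.le, ← mul_assoc, ← rpow_add ht]
  congr 2
  rw [hq]; ring

lemma Admissible.integrand_le (hu : Admissible ρ u) (hg : Continuous g) (hm : Monotone g)
    (hpos : ∀ x, 0 < g x) (hγ : 0 < γ + 1) (hp : 0 < p) (hq : q = (γ + 1) * p - a + 1)
    {t : ℝ} (ht : 0 < t) :
    t ^ (-a) * innerIntegral γ g u t ^ p ≤ t ^ (q - 1) * (g ρ / (γ + 1)) ^ p := by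
  rw [← rpow_mul_rpow_eq hq ht (div_pos (hpos _) hγ).le]
  refine mul_le_mul_of_nonneg_left ?_ (rpow_nonneg ht.le _)
  exact rpow_le_rpow (innerIntegral_nonneg hpos ht.le)
    (hu.innerIntegral_le hg hm hpos hγ ht.le) hp.le

lemma Admissible.intervalIntegrable_integrand (hu : Admissible ρ u) (hg : Continuous g)
    (hm : Monotone g) (hpos : ∀ x, 0 < g x) (hγ : 0 < γ + 1) (hp : 0 < p) (hq0 : 0 < q)
    (hq : q = (γ + 1) * p - a + 1) {r : ℝ} (hr : 0 ≤ r) :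
    IntervalIntegrable (fun t => t ^ (-a) * innerIntegral γ g u t ^ p) volume 0 r := by
  have h : IntervalIntegrable (fun t : ℝ => t ^ (q - 1) * (g ρ / (γ + 1)) ^ p) volume 0 r :=
    (intervalIntegral.intervalIntegrable_rpow' (by linarith)).mul_const _
  refine h.mono_fun' ?_ ?_
  · refine AEStronglyMeasurable.mul (by fun_prop) ?_
    have hc : ContinuousOn (innerIntegral γ g u) [[0, r]] :=
      intervalIntegral.continuousOn_primitive_interval'
        (hu.intervalIntegrable hg hm hpos hγ hr) left_mem_uIcc
    have hc' : ContinuousOn (fun t => innerIntegral γ g u t ^ p) (Ι 0 r) :=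
      (hc.mono uIoc_subset_uIcc).rpow_const fun _ _ => Or.inr hp.le
    exact hc'.aestronglyMeasurable measurableSet_uIoc
  · refine (ae_restrict_iff' measurableSet_uIoc).2 (ae_of_all _ fun s hs => ?_)
    rw [uIoc_of_le hr] at hs
    refine (Real.norm_of_nonneg (mul_nonneg (rpow_nonneg hs.1.le _)
      (rpow_nonneg (innerIntegral_nonneg hpos hs.1.le) _))).trans_le ?_
    exact hu.integrand_le hg hm hpos hγ hp hq hs.1

lemma picardMap_le (hpos : ∀ x, 0 < g x) {r : ℝ} (hr : 0 ≤ r) : picardMap a γ p ρ g u r ≤ ρ :=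
  sub_le_self _ <| intervalIntegral.integral_nonneg hr fun _ ht =>
    mul_nonneg (rpow_nonneg ht.1 _) (rpow_nonneg (innerIntegral_nonneg hpos ht.1) _)

lemma Admissible.le_picardMap (hu : Admissible ρ u) (hg : Continuous g)
    (hm : Monotone g) (hpos : ∀ x, 0 < g x) (hγ : 0 < γ + 1) (hp : 0 < p) (hq0 : 0 < q)
    (hq : q = (γ + 1) * p - a + 1) {r : ℝ} (hr : 0 ≤ r) :
    ρ - r ^ q / q * (g ρ / (γ + 1)) ^ p ≤ picardMap a γ p ρ g u r := by
  rw [← integral_zero_rpow hq0, ← intervalIntegral.integral_mul_const]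
  refine sub_le_sub_left (intervalIntegral.integral_mono_on_of_le_Ioo hr
    (hu.intervalIntegrable_integrand hg hm hpos hγ hp hq0 hq hr)
    ((intervalIntegral.intervalIntegrable_rpow' (by linarith)).mul_const _) fun s hs => ?_) _
  exact hu.integrand_le hg hm hpos hγ hp hq hs.1

lemma Admissible.continuousOn_picardMap (hu : Admissible ρ u) (hg : Continuous g)
    (hm : Monotone g) (hpos : ∀ x, 0 < g x) (hγ : 0 < γ + 1) (hp : 0 < p) (hq0 : 0 < q)
    (hq : q = (γ + 1) * p - a + 1) : ContinuousOn (picardMap a γ p ρ g u) (Ici 0) := by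
  intro r hr
  have hr' : (0:ℝ) ≤ r + 1 := by linarith [mem_Ici.1 hr]
  have h := intervalIntegral.continuousOn_primitive_interval'
    (hu.intervalIntegrable_integrand hg hm hpos hγ hp hq0 hq hr') left_mem_uIcc
  rw [uIcc_of_le hr'] at h
  refine (continuousWithinAt_const.sub (h r ⟨hr, by linarith⟩)).mono_of_mem_nhdsWithin ?_
  exact mem_nhdsWithin.2 ⟨Iio (r + 1), isOpen_Iio, by simp, fun x hx => ⟨hx.2, hx.1.le⟩⟩

lemma ContinuousOn.admissible (hu : ContinuousOn u (Ici 0)) (hle : ∀ r, 0 ≤ r → u r ≤ ρ) :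
    Admissible ρ u :=
  ⟨(hu.mono Ioi_subset_Ici_self).aestronglyMeasurable measurableSet_Ioi, hle⟩

/-- One application of the integral operator gains a factor `M r^q / (k + 1)`. -/
lemma exists_picardMap_estimate (hg : ContDiff ℝ 1 g) (hm : Monotone g) (hpos : ∀ x, 0 < g x)
    (hγ : 0 < γ + 1) (hp : 0 < p) (hq0 : 0 < q) (hq : q = (γ + 1) * p - a + 1) (m R : ℝ) :
    ∃ M : ℝ, 0 ≤ M ∧ ∀ u v : ℝ → ℝ, Admissible ρ u → Admissible ρ v →
      (∀ s ∈ Icc 0 R, m ≤ u s) → (∀ s ∈ Icc 0 R, m ≤ v s) → ∀ (A : ℝ) (k : ℕ), 0 ≤ A →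
      (∀ s ∈ Ioc 0 R, |u s - v s| ≤ A * s ^ (k * q)) → ∀ r ∈ Icc 0 R,
      |picardMap a γ p ρ g u r - picardMap a γ p ρ g v r|
        ≤ A * M / (k + 1) * r ^ ((k + 1 : ℕ) * q) := by
  obtain ⟨L, hL0, hL⟩ := exists_lipschitz_Icc (x := m) (y := ρ) hg.contDiffOn
  have hgm : 0 < g m / (γ + 1) := div_pos (hpos _) hγ
  obtain ⟨K, hK0, hK⟩ := exists_lipschitz_Icc (h := fun x : ℝ => x ^ p)
    (x := g m / (γ + 1)) (y := g ρ / (γ + 1))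
    fun x hx => (contDiffAt_rpow_const (Or.inl (hgm.trans_le hx.1).ne')).contDiffWithinAt
  refine ⟨K * (L / (γ + 1)) / q, by positivity, fun u v hu hv hum hvm A k hA huv r hr => ?_⟩
  have hkq : 0 ≤ k * q := by positivity
  have hc := hg.continuous
  have inner : ∀ t ∈ Ioc 0 R, |innerIntegral γ g u t - innerIntegral γ g v t|
      ≤ t ^ (γ + 1) * (L * A / (γ + 1) * t ^ (k * q)) := by
    intro t ht
    have hlip : ∀ s ∈ Ioc 0 t, ‖s ^ γ * g (u s) - s ^ γ * g (v s)‖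
        ≤ s ^ (γ + 1 + k * q - 1) * (L * A) := by
      intro s hs
      have hsR : s ∈ Ioc 0 R := ⟨hs.1, hs.2.trans ht.2⟩
      have hsR' := Ioc_subset_Icc_self hsR
      have h1 := hL (u s) ⟨hum s hsR', hu.2 s hs.1.le⟩ (v s) ⟨hvm s hsR', hv.2 s hs.1.le⟩
      have h2 : L * |u s - v s| ≤ L * (A * s ^ (k * q)) := by gcongr; exact huv s hsR
      have e : s ^ (γ + 1 + k * q - 1) = s ^ γ * s ^ (k * q) := by
        rw [← rpow_add hs.1]; congr 1; ring
      rw [← mul_sub, norm_mul, Real.norm_of_nonneg (rpow_nonneg hs.1.le _), Real.norm_eq_abs, e]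
      calc s ^ γ * |g (u s) - g (v s)| ≤ s ^ γ * (L * (A * s ^ (k * q))) :=
            mul_le_mul_of_nonneg_left (h1.trans h2) (rpow_nonneg hs.1.le _)
        _ = _ := by ring
    have := intervalIntegral.norm_integral_le_of_norm_le ht.1.le (ae_of_all volume hlip)
      ((intervalIntegral.intervalIntegrable_rpow' (by linarith)).mul_const _)
    rw [intervalIntegral.integral_sub (hu.intervalIntegrable hc hm hpos hγ ht.1.le)
      (hv.intervalIntegrable hc hm hpos hγ ht.1.le), intervalIntegral.integral_mul_const,
      integral_zero_rpow (by linarith), rpow_add ht.1] at this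
    refine (Real.norm_eq_abs _ ▸ this).trans ?_
    have ht0 := ht.1
    have hden : γ + 1 ≤ γ + 1 + k * q := by linarith
    calc t ^ (γ + 1) * t ^ (k * q) / (γ + 1 + k * q) * (L * A)
        ≤ t ^ (γ + 1) * t ^ (k * q) / (γ + 1) * (L * A) := by gcongr
      _ = _ := by ring
  have normalized : ∀ w : ℝ → ℝ, Admissible ρ w → (∀ s ∈ Icc 0 R, m ≤ w s) → ∀ t ∈ Ioc 0 R,
      innerIntegral γ g w t / t ^ (γ + 1) ∈ Icc (g m / (γ + 1)) (g ρ / (γ + 1)) := by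
    intro w hw hwm t ht
    have hpow : 0 < t ^ (γ + 1) := rpow_pos_of_pos ht.1 _
    rw [mem_Icc, le_div_iff₀' hpow, div_le_iff₀' hpow]
    exact ⟨hw.le_innerIntegral hc hm hpos hγ ht.1.le fun s hs => hwm s ⟨hs.1, hs.2.trans ht.2⟩,
      hw.innerIntegral_le hc hm hpos hγ ht.1.le⟩
  have factor : ∀ w : ℝ → ℝ, ∀ t ∈ Ioc 0 R, t ^ (-a) * innerIntegral γ g w t ^ p
      = t ^ (q - 1) * (innerIntegral γ g w t / t ^ (γ + 1)) ^ p := by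
    intro w t ht
    have hpow : 0 < t ^ (γ + 1) := rpow_pos_of_pos ht.1 _
    rw [← rpow_mul_rpow_eq hq ht.1 (div_nonneg (innerIntegral_nonneg hpos ht.1.le) hpow.le),
      mul_div_cancel₀ _ hpow.ne']
  have outer : ∀ t ∈ Ioc 0 r,
      ‖t ^ (-a) * innerIntegral γ g v t ^ p - t ^ (-a) * innerIntegral γ g u t ^ p‖
      ≤ t ^ ((k + 1 : ℕ) * q - 1) * (K * (L * A / (γ + 1))) := by
    intro t htr
    have ht : t ∈ Ioc 0 R := ⟨htr.1, htr.2.trans hr.2⟩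
    have hpow : 0 < t ^ (γ + 1) := rpow_pos_of_pos ht.1 _
    have h1 := hK _ (normalized v hv hvm t ht) _ (normalized u hu hum t ht)
    rw [← sub_div, abs_div, abs_of_pos hpow, abs_sub_comm (innerIntegral γ g v t)] at h1
    have h2 : |innerIntegral γ g u t - innerIntegral γ g v t| / t ^ (γ + 1)
        ≤ L * A / (γ + 1) * t ^ (k * q) := (div_le_iff₀' hpow).2 (inner t ht)
    have e : t ^ ((k + 1 : ℕ) * q - 1) = t ^ (q - 1) * t ^ (k * q) := by
      rw [← rpow_add ht.1]; congr 1; push_cast; ring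
    rw [factor v t ht, factor u t ht, ← mul_sub, norm_mul,
      Real.norm_of_nonneg (rpow_nonneg ht.1.le _), Real.norm_eq_abs, e]
    calc _ ≤ t ^ (q - 1) * (K * (L * A / (γ + 1) * t ^ (k * q))) :=
          mul_le_mul_of_nonneg_left (h1.trans (mul_le_mul_of_nonneg_left h2 hK0))
            (rpow_nonneg ht.1.le _)
      _ = _ := by ring
  have hk1 : 0 < ((k + 1 : ℕ) : ℝ) * q := by positivity
  have := intervalIntegral.norm_integral_le_of_norm_le hr.1 (ae_of_all volume outer)
    ((intervalIntegral.intervalIntegrable_rpow' (by linarith)).mul_const _)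
  rw [intervalIntegral.integral_sub
    (hv.intervalIntegrable_integrand hc hm hpos hγ hp hq0 hq hr.1)
    (hu.intervalIntegrable_integrand hc hm hpos hγ hp hq0 hq hr.1),
    intervalIntegral.integral_mul_const, integral_zero_rpow hk1, Real.norm_eq_abs] at this
  simp only [picardMap, sub_sub_sub_cancel_left]
  refine this.trans (le_of_eq ?_)
  push_cast
  field_simp

lemma Admissible.bound_on_Icc (hu : Admissible ρ u) (hg : Continuous g)
    (hm : Monotone g) (hpos : ∀ x, 0 < g x) (hγ : 0 < γ + 1) (hp : 0 < p) (hq0 : 0 < q)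
    (hq : q = (γ + 1) * p - a + 1) {R s : ℝ} (hs : s ∈ Icc 0 R) :
    ρ - R ^ q / q * (g ρ / (γ + 1)) ^ p ≤ picardMap a γ p ρ g u s := by
  refine le_trans ?_ (hu.le_picardMap hg hm hpos hγ hp hq0 hq hs.1)
  have := hpos ρ
  have := rpow_le_rpow hs.1 hs.2 hq0.le
  gcongr

lemma picardMap_fixedPoint_unique (hg : ContDiff ℝ 1 g) (hm : Monotone g) (hpos : ∀ x, 0 < g x)
    (hγ : 0 < γ + 1) (hp : 0 < p) (hq0 : 0 < q) (hq : q = (γ + 1) * p - a + 1)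
    (huc : ContinuousOn u (Ici 0)) (hvc : ContinuousOn v (Ici 0))
    (hu : ∀ r, 0 ≤ r → u r = picardMap a γ p ρ g u r)
    (hv : ∀ r, 0 ≤ r → v r = picardMap a γ p ρ g v r) {R : ℝ} (hR : 0 ≤ R) : u R = v R := by
  have hua : Admissible ρ u := huc.admissible fun r hr => hu r hr ▸ picardMap_le hpos hr
  have hva : Admissible ρ v := hvc.admissible fun r hr => hv r hr ▸ picardMap_le hpos hr
  set m := ρ - R ^ q / q * (g ρ / (γ + 1)) ^ p
  have hum : ∀ s ∈ Icc 0 R, m ≤ u s := fun s hs =>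
    hu s hs.1 ▸ hua.bound_on_Icc hg.continuous hm hpos hγ hp hq0 hq hs
  have hvm : ∀ s ∈ Icc 0 R, m ≤ v s := fun s hs =>
    hv s hs.1 ▸ hva.bound_on_Icc hg.continuous hm hpos hγ hp hq0 hq hs
  obtain ⟨M, hM0, hM⟩ := exists_picardMap_estimate (ρ := ρ) hg hm hpos hγ hp hq0 hq m R
  have hmρ : 0 ≤ ρ - m := by linarith [hum R ⟨hR, le_rfl⟩, hua.2 R hR]
  have key : ∀ n : ℕ, ∀ s ∈ Icc 0 R, |u s - v s| ≤ (ρ - m) * M ^ n / n ! * s ^ (n * q) := by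
    intro n
    induction n with
    | zero =>
      intro s hs
      have h1 := hum s hs
      have h2 := hvm s hs
      have h3 := hua.2 s hs.1
      have h4 := hva.2 s hs.1
      simp only [pow_zero, mul_one, Nat.factorial_zero, Nat.cast_one, div_one,
        CharP.cast_eq_zero, zero_mul, rpow_zero]
      exact abs_sub_le_iff.2 ⟨by linarith, by linarith⟩
    | succ n ih =>
      intro s hs
      rw [hu s hs.1, hv s hs.1]
      refine (hM u v hua hva hum hvm _ n (by positivity)
        (fun s hs => ih s (Ioc_subset_Icc_self hs)) s hs).trans (le_of_eq ?_)
      congr 1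
      rw [Nat.factorial_succ]
      push_cast
      field_simp
      ring
  have lim : Tendsto (fun n : ℕ => (ρ - m) * ((M * R ^ q) ^ n / n !)) atTop (𝓝 0) := by
    simpa using (FloorSemiring.tendsto_pow_div_factorial_atTop (M * R ^ q)).const_mul (ρ - m)
  have hle : |u R - v R| ≤ 0 := ge_of_tendsto' lim fun n => by
    refine (key n R ⟨hR, le_rfl⟩).trans (le_of_eq ?_)
    rw [mul_comm (n : ℝ) q, rpow_mul hR, rpow_natCast, mul_pow]
    ring
  exact sub_eq_zero.1 (abs_nonpos_iff.1 hle)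

lemma exists_picardMap_fixedPoint (hg : ContDiff ℝ 1 g) (hm : Monotone g) (hpos : ∀ x, 0 < g x)
    (hγ : 0 < γ + 1) (hp : 0 < p) (hq0 : 0 < q) (hq : q = (γ + 1) * p - a + 1) :
    ∃ u : ℝ → ℝ, ContinuousOn u (Ici 0) ∧ ∀ r, 0 ≤ r → u r = picardMap a γ p ρ g u r := by
  have hc := hg.continuous
  set U : ℕ → ℝ → ℝ := fun n => (picardMap a γ p ρ g)^[n] fun _ => ρ
  have hU1 : ∀ n, U (n + 1) = picardMap a γ p ρ g (U n) := fun n =>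
    Function.iterate_succ_apply' _ _ _
  have hUa : ∀ n, Admissible ρ (U n) := by
    intro n
    induction n with
    | zero => exact ⟨aestronglyMeasurable_const, fun _ _ => le_rfl⟩
    | succ n ih =>
      rw [hU1]
      exact (ih.continuousOn_picardMap hc hm hpos hγ hp hq0 hq).admissible
        fun r hr => picardMap_le hpos hr
  have hUm : ∀ R, ∀ n, ∀ s ∈ Icc 0 R, ρ - R ^ q / q * (g ρ / (γ + 1)) ^ p ≤ U n s := by
    intro R n s hs
    cases n with
    | zero =>
      have := hpos ρ
      have := rpow_nonneg (hs.1.trans hs.2) q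
      exact sub_le_self _ (by positivity)
    | succ n =>
      rw [hU1]
      exact (hUa n).bound_on_Icc hc hm hpos hγ hp hq0 hq hs
  have step : ∀ R, 0 ≤ R → ∃ d : ℕ → ℝ, Summable d ∧
      ∀ n, ∀ s ∈ Icc 0 R, dist (U n s) (U (n + 1) s) ≤ d n := by
    intro R hR
    set m := ρ - R ^ q / q * (g ρ / (γ + 1)) ^ p
    obtain ⟨M, hM0, hM⟩ := exists_picardMap_estimate (ρ := ρ) hg hm hpos hγ hp hq0 hq m R
    have hmρ : 0 ≤ ρ - m := by linarith [hUm R 0 R ⟨hR, le_rfl⟩, (hUa 0).2 R hR]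
    have key : ∀ n : ℕ, ∀ s ∈ Icc 0 R,
        |U n s - U (n + 1) s| ≤ (ρ - m) * M ^ n / n ! * s ^ (n * q) := by
      intro n
      induction n with
      | zero =>
        intro s hs
        have h1 := hUm R 0 s hs
        have h2 := hUm R 1 s hs
        have h3 := (hUa 0).2 s hs.1
        have h4 := (hUa 1).2 s hs.1
        simp only [pow_zero, mul_one, Nat.factorial_zero, Nat.cast_one, div_one, CharP.cast_eq_zero,
          zero_mul, rpow_zero, zero_add]
        exact abs_sub_le_iff.2 ⟨by linarith, by linarith⟩
      | succ n ih =>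
        intro s hs
        rw [hU1 n, hU1 (n + 1)]
        refine (hM _ _ (hUa n) (hUa (n + 1)) (hUm R n) (hUm R (n + 1)) _ n (by positivity)
          (fun s hs => ih s (Ioc_subset_Icc_self hs)) s hs).trans (le_of_eq ?_)
        congr 1
        rw [Nat.factorial_succ]
        push_cast
        field_simp
        ring
    refine ⟨fun n => (ρ - m) * ((M * R ^ q) ^ n / n !),
      (Real.summable_pow_div_factorial _).mul_left _, fun n s hs => (key n s hs).trans ?_⟩
    have hpow := rpow_le_rpow hs.1 hs.2 hq0.le
    have hs0 := rpow_nonneg hs.1 q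
    rw [mul_comm (n : ℝ) q, rpow_mul hs.1, rpow_natCast]
    calc (ρ - m) * M ^ n / n ! * (s ^ q) ^ n ≤ (ρ - m) * M ^ n / n ! * (R ^ q) ^ n := by gcongr
      _ = (ρ - m) * ((M * R ^ q) ^ n / n !) := by rw [mul_pow]; ring
  have lim : ∀ r, ∃ l, 0 ≤ r → Tendsto (fun n => U n r) atTop (𝓝 l) := by
    intro r
    by_cases hr : 0 ≤ r
    · obtain ⟨d, hd, hdist⟩ := step r hr
      obtain ⟨l, hl⟩ := cauchySeq_tendsto_of_complete
        (cauchySeq_of_dist_le_of_summable d (fun n => hdist n r ⟨hr, le_rfl⟩) hd)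
      exact ⟨l, fun _ => hl⟩
    · exact ⟨0, fun h => absurd h hr⟩
  choose w hw using lim
  have hwa : Admissible ρ w := by
    refine ⟨aestronglyMeasurable_of_tendsto_ae atTop (fun n => (hUa n).1) ?_,
      fun r hr => le_of_tendsto' (hw r hr) fun n => (hUa n).2 r hr⟩
    exact (ae_restrict_iff' measurableSet_Ioi).2 (ae_of_all _ fun s hs => hw s (le_of_lt hs))
  have hfix : ∀ r, 0 ≤ r → w r = picardMap a γ p ρ g w r := by
    intro R hR
    obtain ⟨d, hd, hdist⟩ := step R hR
    obtain ⟨M, hM0, hM⟩ := exists_picardMap_estimate (ρ := ρ) hg hm hpos hγ hp hq0 hq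
      (ρ - R ^ q / q * (g ρ / (γ + 1)) ^ p) R
    have hwm : ∀ s ∈ Icc 0 R, ρ - R ^ q / q * (g ρ / (γ + 1)) ^ p ≤ w s := fun s hs =>
      ge_of_tendsto' (hw s hs.1) fun n => hUm R n s hs
    have tail : Tendsto (fun n => ∑' k, d (n + k)) atTop (𝓝 0) := by
      simpa only [add_comm] using tendsto_sum_nat_add d
    have hclose : ∀ n, ∀ s ∈ Icc 0 R, |U n s - w s| ≤ ∑' k, d (n + k) := fun n s hs =>
      dist_le_tsum_of_dist_le_of_tendsto d (fun n => hdist n s hs) hd (hw s hs.1) n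
    have hT : ∀ n, |U (n + 1) R - picardMap a γ p ρ g w R|
        ≤ (∑' k, d (n + k)) * (M * R ^ q) := by
      intro n
      have h0 : 0 ≤ ∑' k, d (n + k) :=
        (abs_nonneg _).trans (hclose n R ⟨hR, le_rfl⟩)
      have := hM (U n) w (hUa n) hwa (hUm R n) hwm _ 0 h0
        (fun s hs => by simpa using hclose n s (Ioc_subset_Icc_self hs)) R ⟨hR, le_rfl⟩
      rw [hU1]
      simpa [mul_assoc] using this
    have hlim : Tendsto (fun n => U (n + 1) R) atTop (𝓝 (picardMap a γ p ρ g w R)) := by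
      refine tendsto_iff_dist_tendsto_zero.2 (squeeze_zero (fun _ => dist_nonneg) hT ?_)
      simpa using tail.mul_const (M * R ^ q)
    exact tendsto_nhds_unique ((tendsto_add_atTop_iff_nat 1).2 (hw R hR)) hlim
  exact ⟨w, (hwa.continuousOn_picardMap hc hm hpos hγ hp hq0 hq).congr hfix, hfix⟩

end

/-- Lemma 3.2: existence and uniqueness of the continuous solution on `[0,∞)` of the
integral equation equivalent to `−L(u) = e^{f(u)}`, `u(0) = ρ`, `u'(0) = 0`. -/
theorem stmt_13 (α β γ θ : ℝ) (hθ : θ = γ + 2 + β - α)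
    (f : ℝ → ℝ) (hf : ContDiff ℝ 1 f) (hf' : ∀ u : ℝ, 0 < deriv f u)
    (hftop : Tendsto f atTop atTop)
    (hαβ : α > β + 1) (hβ : 0 < β + 1) (hθpos : 0 < θ)
    (ρ : ℝ) :
    (∃ u : ℝ → ℝ, ContinuousOn u (Ici 0) ∧ ∀ r, 0 ≤ r →
      u r = ρ - ∫ t in (0:ℝ)..r, t ^ (-(α / (β + 1))) *
        (∫ s in (0:ℝ)..t, s ^ γ * Real.exp (f (u s))) ^ ((1:ℝ) / (β + 1))) ∧
    (∀ u v : ℝ → ℝ,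
      (ContinuousOn u (Ici 0) ∧ ∀ r, 0 ≤ r →
        u r = ρ - ∫ t in (0:ℝ)..r, t ^ (-(α / (β + 1))) *
          (∫ s in (0:ℝ)..t, s ^ γ * Real.exp (f (u s))) ^ ((1:ℝ) / (β + 1))) →
      (ContinuousOn v (Ici 0) ∧ ∀ r, 0 ≤ r →
        v r = ρ - ∫ t in (0:ℝ)..r, t ^ (-(α / (β + 1))) *
          (∫ s in (0:ℝ)..t, s ^ γ * Real.exp (f (v s))) ^ ((1:ℝ) / (β + 1))) →
      ∀ r, 0 ≤ r → u r = v r) := by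
  have hp : 0 < 1 / (β + 1) := by positivity
  have hγ : 0 < γ + 1 := by linarith
  have hq : θ / (β + 1) = (γ + 1) * (1 / (β + 1)) - α / (β + 1) + 1 := by
    rw [hθ]; field_simp; ring
  have hq0 : 0 < θ / (β + 1) := by positivity
  have hg : ContDiff ℝ 1 fun x => Real.exp (f x) := hf.exp
  have hm : Monotone fun x => Real.exp (f x) :=
    Real.exp_monotone.comp (strictMono_of_deriv_pos hf').monotone
  exact ⟨exists_picardMap_fixedPoint hg hm (fun _ => Real.exp_pos _) hγ hp hq0 hq,
    fun u v hu hv r hr => picardMap_fixedPoint_unique hg hm (fun _ => Real.exp_pos _) hγ hp hq0 hq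
      hu.1 hv.1 hu.2 hv.2 hr⟩
end
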